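/- For every integer q ≥ 3, every β > 0 and every d with 0 < d < d_cond(q,β), the Erdős–Rényi random graph 𝔾 = 𝔾(n,d/n) and the stochastic block model 𝔾* are mutually contiguous: for every sequence (A_n)_n of sets of graphs on V_n, lim_{n→∞} P[𝔾 ∈ A_n] = 0 if and only if lim_{n→∞} P[𝔾* ∈ A_n] = 0. (In particular, no test or algorithm can decide with probability tending to 1 whether a given graph was generated from the stochastic block model or from the Erdős–Rényi model when d < d_cond(q,β).) -/

import Mathlib

open MeasureTheory Finset

/-- `Λ(x) = x ln x`. -/
noncomputable def LamFn (x : ℝ) : ℝ := x * Real.log x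

/-- Membership in `P²_*(Ω)`: a (probability) measure on `ℝ^Ω` concentrated on the simplex
`P(Ω)` whose barycenter is the uniform distribution. -/
def memP2star (q : ℕ) (π : ProbabilityMeasure (Fin q → ℝ)) : Prop :=
  (∀ᵐ μ ∂(π : Measure (Fin q → ℝ)), μ ∈ stdSimplex ℝ (Fin q)) ∧
    ∀ s : Fin q, (∫ μ, μ s ∂(π : Measure (Fin q → ℝ))) = (q : ℝ)⁻¹

/-- The Bethe functional `B_Potts(q,β,d,π)`: with `γ ~ Poisson(d)` and `ρ_1, ρ_2, …`
i.i.d. samples from `π`, independent of `γ`, this is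
`E[Λ(Σ_σ Π_{i≤γ}(1-(1-e^{-β})ρ_i(σ)))/(q(1-(1-e^{-β})/q)^γ)
  - (d/2)·Λ(1-(1-e^{-β})Σ_τ ρ_1(τ)ρ_2(τ))/(1-(1-e^{-β})/q)]`. -/
noncomputable def BPotts (q : ℕ) (β d : ℝ) (π : ProbabilityMeasure (Fin q → ℝ)) : ℝ :=
  (∑' γ : ℕ, (Real.exp (-d) * d ^ γ / γ.factorial) *
      ∫ ρ : Fin γ → Fin q → ℝ,
        LamFn (∑ σ : Fin q, ∏ i, (1 - (1 - Real.exp (-β)) * ρ i σ)) /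
          ((q : ℝ) * (1 - (1 - Real.exp (-β)) / q) ^ γ)
        ∂(Measure.pi fun _ : Fin γ => (π : Measure (Fin q → ℝ)))) -
    d / 2 *
      ∫ ρ : Fin 2 → Fin q → ℝ,
        LamFn (1 - (1 - Real.exp (-β)) * ∑ τ : Fin q, ρ 0 τ * ρ 1 τ) /
          (1 - (1 - Real.exp (-β)) / q)
        ∂(Measure.pi fun _ : Fin 2 => (π : Measure (Fin q → ℝ)))

/-- The condensation threshold
`d_cond(q,β) = inf{d > 0 : sup_{π ∈ P²_*(Ω)} B_Potts(q,β,d,π) > ln q + (d/2)ln(1-(1-e^{-β})/q)}`. -/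
noncomputable def dcond (q : ℕ) (β : ℝ) : ℝ :=
  sInf {d : ℝ | 0 < d ∧ ∃ π : ProbabilityMeasure (Fin q → ℝ), memP2star q π ∧
    BPotts q β d π >
      Real.log q + d / 2 * Real.log (1 - (1 - Real.exp (-β)) / q)}

/-- The index set of potential edges of a graph on `{x_1,…,x_n}`: unordered pairs,
represented by ordered pairs `(v,w)` with `v < w`. -/
abbrev EdgeIdx (n : ℕ) := {e : Fin n × Fin n // e.1 < e.2}

/-- A graph on `{x_1,…,x_n}`, given by the indicator of its edge set. -/
abbrev GraphCfg (n : ℕ) := EdgeIdx n → Bool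

/-- The probability of the graph `g` under the Erdős–Rényi model `𝔾(n, pr)`: each edge is
present independently with probability `pr`. -/
noncomputable def erProb (n : ℕ) (pr : ℝ) (g : GraphCfg n) : ℝ :=
  ∏ e : EdgeIdx n, if g e then pr else 1 - pr

/-- The probability of the graph `g` under the disassortative stochastic block model `𝔾*`:
a coloring `σ* : V_n → Ω` is chosen uniformly at random and then each edge `{v,w}` is
included independently with probability `d_in/n` if `σ*(v) = σ*(w)` and `d_out/n`
otherwise, where `d_in = dq·e^{-β}/(q-1+e^{-β})` and `d_out = dq/(q-1+e^{-β})`. -/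
noncomputable def sbmProb (q : ℕ) (β d : ℝ) (n : ℕ) (g : GraphCfg n) : ℝ :=
  ((q : ℝ) ^ n)⁻¹ * ∑ σ : Fin n → Fin q,
    ∏ e : EdgeIdx n,
      if g e then
        (if σ e.1.1 = σ e.1.2 then
          d * q * Real.exp (-β) / (((q : ℝ) - 1 + Real.exp (-β)) * n)
        else d * q / (((q : ℝ) - 1 + Real.exp (-β)) * n))
      else
        1 - (if σ e.1.1 = σ e.1.2 then
          d * q * Real.exp (-β) / (((q : ℝ) - 1 + Real.exp (-β)) * n)
        else d * q / (((q : ℝ) - 1 + Real.exp (-β)) * n))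

set_option linter.unusedSectionVars false

namespace BlockModel

section EdgeModel

variable {ι X : Type*} [Fintype ι] [DecidableEq ι] [Fintype X]

/-- Bernoulli weight of a single bit. -/
noncomputable def bw (p : ℝ) (b : Bool) : ℝ := if b then p else 1 - p

/-- Product Bernoulli weight of a bit vector. -/
noncomputable def bern (p : ι → ℝ) (g : ι → Bool) : ℝ := ∏ e, bw (p e) (g e)

/-- Expectation under the product Bernoulli measure. -/
noncomputable def avg (p : ι → ℝ) (f : (ι → Bool) → ℝ) : ℝ := ∑ g, bern p g * f g

/-- Likelihood ratio of one bit whose success probability is `p * (1 + t)` instead of `p`. -/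
noncomputable def lr (p t : ℝ) (b : Bool) : ℝ := if b then 1 + t else 1 - p * t / (1 - p)

/-- Likelihood ratio of a bit vector given the hidden variable `x`. -/
noncomputable def lik (p : ι → ℝ) (θ : ι → X → ℝ) (g : ι → Bool) (x : X) : ℝ :=
  ∏ e, lr (p e) (θ e x) (g e)

/-- Weighted total likelihood. -/
noncomputable def tot (p : ι → ℝ) (θ : ι → X → ℝ) (c : X → ℝ) (g : ι → Bool) : ℝ :=
  ∑ x, c x * lik p θ g x

/-- Weighted total likelihood with the coordinate `e` left out. -/
noncomputable def totE (p : ι → ℝ) (θ : ι → X → ℝ) (e : ι) (c : X → ℝ) (g : ι → Bool) : ℝ :=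
  tot p (Function.update θ e 0) c g

/-- The range of admissible edge probabilities. -/
def Box (p : ι → ℝ) : Prop := ∀ e, 0 ≤ p e ∧ p e ≤ 1 / 2

/-- The range of admissible tilts. -/
def Tilt (c0 : ℝ) (θ : ι → X → ℝ) : Prop := ∀ e x, c0 - 1 ≤ θ e x ∧ θ e x ≤ 1 / 2

lemma Tilt.update {c0 : ℝ} {θ : ι → X → ℝ} (h : Tilt c0 θ) (h1 : c0 ≤ 1) (e : ι) :
    Tilt c0 (Function.update θ e 0) := by
  intro e' x
  by_cases he : e' = e
  · subst he; simp; linarith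
  · simpa [Function.update_of_ne he] using h e' x

lemma Box.update {p : ι → ℝ} (h : Box p) (e : ι) {r : ℝ} (h0 : 0 ≤ r) (h1 : r ≤ 1 / 2) :
    Box (Function.update p e r) := by
  intro e'
  by_cases he : e' = e
  · subst he; simp; exact ⟨h0, by linarith⟩
  · simpa [Function.update_of_ne he] using h e'

lemma bern_nonneg {p : ι → ℝ} (hp : Box p) (g : ι → Bool) : 0 ≤ bern p g := by
  refine prod_nonneg fun e _ => ?_
  unfold bw
  split_ifs
  · exact (hp e).1
  · linarith [(hp e).2]

lemma bern_sum (p : ι → ℝ) : ∑ g, bern p g = 1 := by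
  unfold bern
  rw [← Fintype.prod_sum]
  simp [bw]

lemma avg_const (p : ι → ℝ) (a : ℝ) : avg p (fun _ => a) = a := by
  unfold avg
  rw [← sum_mul, bern_sum, one_mul]

lemma avg_add (p : ι → ℝ) (f h : (ι → Bool) → ℝ) :
    avg p (fun g => f g + h g) = avg p f + avg p h := by
  simp [avg, mul_add, sum_add_distrib]

lemma avg_sub (p : ι → ℝ) (f h : (ι → Bool) → ℝ) :
    avg p (fun g => f g - h g) = avg p f - avg p h := by
  simp [avg, mul_sub, sum_sub_distrib]

lemma avg_mul (p : ι → ℝ) (a : ℝ) (f : (ι → Bool) → ℝ) :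
    avg p (fun g => a * f g) = a * avg p f := by
  simp only [avg, mul_sum]
  exact sum_congr rfl fun _ _ => by ring

lemma avg_sum {κ : Type*} (p : ι → ℝ) (s : Finset κ) (f : κ → (ι → Bool) → ℝ) :
    avg p (fun g => ∑ k ∈ s, f k g) = ∑ k ∈ s, avg p (f k) := by
  simp only [avg, mul_sum]
  exact sum_comm

lemma avg_mono {p : ι → ℝ} (hp : Box p) {f h : (ι → Bool) → ℝ} (hfh : ∀ g, f g ≤ h g) :
    avg p f ≤ avg p h :=
  sum_le_sum fun g _ => mul_le_mul_of_nonneg_left (hfh g) (bern_nonneg hp g)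

lemma avg_nonneg {p : ι → ℝ} (hp : Box p) {f : (ι → Bool) → ℝ} (hf : ∀ g, 0 ≤ f g) :
    0 ≤ avg p f :=
  sum_nonneg fun g _ => mul_nonneg (bern_nonneg hp g) (hf g)

lemma bern_split (p : ι → ℝ) (g : ι → Bool) (e : ι) :
    bern p g = bw (p e) (g e) * ∏ e' ∈ univ.erase e, bw (p e') (g e') :=
  (mul_prod_erase univ (fun e' => bw (p e') (g e')) (mem_univ e)).symm

lemma sum_update_bool (e : ι) (F : (ι → Bool) → ℝ) :
    2 * ∑ g, F g = ∑ g, (F (Function.update g e true) + F (Function.update g e false)) := by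
  have h1 : ∑ g : ι → Bool, F (Function.update g e (!(g e))) = ∑ g, F g := by
    refine Fintype.sum_equiv
      (Function.Involutive.toPerm (fun g : ι → Bool => Function.update g e (!(g e))) ?_) _ _ ?_
    · intro g; simp
    · intro g; rfl
  have h2 : ∀ g : ι → Bool, F (Function.update g e true) + F (Function.update g e false)
      = F g + F (Function.update g e (!(g e))) := by
    intro g
    cases hg : g e
    · have : Function.update g e false = g := by rw [← hg]; simp
      rw [this, Bool.not_false, add_comm]
    · have : Function.update g e true = g := by rw [← hg]; simp
      rw [this, Bool.not_true]
  rw [sum_congr rfl fun g _ => h2 g, sum_add_distrib, h1]; ring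

lemma bern_update (p : ι → ℝ) (g : ι → Bool) (e : ι) (b : Bool) :
    bern p (Function.update g e b) = bw (p e) b * ∏ e' ∈ univ.erase e, bw (p e') (g e') := by
  rw [bern_split p _ e, Function.update_self]
  congr 1
  refine prod_congr rfl fun e' he' => ?_
  rw [Function.update_of_ne (ne_of_mem_erase he')]

/-- Averaging over a single coordinate first. -/
lemma avg_coord (p : ι → ℝ) (e : ι) (f : (ι → Bool) → ℝ) :
    avg p f = avg p (fun g => p e * f (Function.update g e true)
      + (1 - p e) * f (Function.update g e false)) := by
  have h := sum_update_bool e (fun g => bern p g * f g)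
  have h' := sum_update_bool e (fun g => bern p g * (p e * f (Function.update g e true)
      + (1 - p e) * f (Function.update g e false)))
  have : (2 : ℝ) * avg p f = 2 * avg p (fun g => p e * f (Function.update g e true)
      + (1 - p e) * f (Function.update g e false)) := by
    unfold avg
    rw [h, h']
    refine sum_congr rfl fun g _ => ?_
    simp only [Function.update_idem, bern_update, bw]
    simp
    ring
  linarith

/-- The average of a function not depending on `e` does not depend on `p e`. -/
lemma avg_indep (p : ι → ℝ) (e : ι) (r : ℝ) (f : (ι → Bool) → ℝ)
    (hf : ∀ g b, f (Function.update g e b) = f g) :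
    avg (Function.update p e r) f = avg p f := by
  have h := sum_update_bool e (fun g => bern p g * f g)
  have h' := sum_update_bool e (fun g => bern (Function.update p e r) g * f g)
  have : (2 : ℝ) * avg (Function.update p e r) f = 2 * avg p f := by
    unfold avg
    rw [h, h']
    refine sum_congr rfl fun g _ => ?_
    have hpr : ∏ e' ∈ univ.erase e, bw (Function.update p e r e') (g e')
        = ∏ e' ∈ univ.erase e, bw (p e') (g e') :=
      prod_congr rfl fun e' he' => by rw [Function.update_of_ne (ne_of_mem_erase he')]
    simp only [hf, bern_update, hpr]
    simp [bw]
    ring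
  linarith

lemma lr_pos {c0 p t : ℝ} (hc : 0 < c0) (hp : 0 ≤ p ∧ p ≤ 1 / 2)
    (ht : c0 - 1 ≤ t ∧ t ≤ 1 / 2) (b : Bool) : 0 < lr p t b := by
  unfold lr
  split_ifs
  · linarith
  · have h1 : (0 : ℝ) < 1 - p := by linarith
    rw [sub_pos, div_lt_one h1]
    nlinarith

lemma lr_zero (p : ℝ) (b : Bool) : lr p 0 b = 1 := by
  unfold lr; split_ifs <;> simp

lemma lik_pos {c0 : ℝ} (hc : 0 < c0) {p : ι → ℝ} (hp : Box p) {θ : ι → X → ℝ} (hθ : Tilt c0 θ)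
    (g : ι → Bool) (x : X) : 0 < lik p θ g x :=
  prod_pos fun e _ => lr_pos hc (hp e) (hθ e x) _

lemma lik_split (p : ι → ℝ) (θ : ι → X → ℝ) (g : ι → Bool) (e : ι) (x : X) :
    lik p θ g x = lr (p e) (θ e x) (g e) * lik p (Function.update θ e 0) g x := by
  unfold lik
  rw [← mul_prod_erase univ (fun e' => lr (p e') (θ e' x) (g e')) (mem_univ e),
    ← mul_prod_erase univ (fun e' => lr (p e') (Function.update θ e 0 e' x) (g e')) (mem_univ e)]
  have : ∏ e' ∈ univ.erase e, lr (p e') (Function.update θ e 0 e' x) (g e')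
      = ∏ e' ∈ univ.erase e, lr (p e') (θ e' x) (g e') :=
    prod_congr rfl fun e' he' => by rw [Function.update_of_ne (ne_of_mem_erase he')]
  rw [this]
  simp [lr_zero]

lemma likE_update (p : ι → ℝ) (θ : ι → X → ℝ) (g : ι → Bool) (e : ι) (b : Bool) (x : X) :
    lik p (Function.update θ e 0) (Function.update g e b) x
      = lik p (Function.update θ e 0) g x := by
  unfold lik
  refine prod_congr rfl fun e' _ => ?_
  by_cases h : e' = e
  · subst h; simp [lr_zero]
  · rw [Function.update_of_ne h, Function.update_of_ne h]

lemma likE_update_p (p : ι → ℝ) (θ : ι → X → ℝ) (g : ι → Bool) (e : ι) (r : ℝ) (x : X) :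
    lik (Function.update p e r) (Function.update θ e 0) g x
      = lik p (Function.update θ e 0) g x := by
  unfold lik
  refine prod_congr rfl fun e' _ => ?_
  by_cases h : e' = e
  · subst h; simp [lr_zero]
  · rw [Function.update_of_ne h, Function.update_of_ne h]

lemma totE_update (p : ι → ℝ) (θ : ι → X → ℝ) (e : ι) (c : X → ℝ) (g : ι → Bool) (b : Bool) :
    totE p θ e c (Function.update g e b) = totE p θ e c g := by
  simp [totE, tot, likE_update]

lemma totE_update_p (p : ι → ℝ) (θ : ι → X → ℝ) (e : ι) (c : X → ℝ) (g : ι → Bool) (r : ℝ) :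
    totE (Function.update p e r) θ e c g = totE p θ e c g := by
  simp [totE, tot, likE_update_p]

lemma tot_true (p : ι → ℝ) (θ : ι → X → ℝ) (e : ι) (c : X → ℝ) (g : ι → Bool) :
    tot p θ c (Function.update g e true)
      = totE p θ e c g + totE p θ e (fun x => c x * θ e x) g := by
  simp only [totE, tot, ← sum_add_distrib]
  refine sum_congr rfl fun x _ => ?_
  rw [lik_split p θ _ e x, likE_update]
  simp [lr]; ring

lemma tot_false (p : ι → ℝ) (θ : ι → X → ℝ) (e : ι) (c : X → ℝ) (g : ι → Bool) :
    tot p θ c (Function.update g e false)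
      = totE p θ e c g - p e / (1 - p e) * totE p θ e (fun x => c x * θ e x) g := by
  simp only [totE, tot, mul_sum, ← sum_sub_distrib]
  refine sum_congr rfl fun x _ => ?_
  rw [lik_split p θ _ e x, likE_update]
  simp [lr]; ring

/-- Changing the coordinates of `p` into those of `p'` one at a time. -/
lemma telescope_coord (Ψ : (ι → ℝ) → ℝ) (p p' : ι → ℝ) (hpp : ∀ e, p e ≤ p' e) (a : ι → ℝ)
    (h : ∀ (r : ι → ℝ) (e : ι), (∀ e', p e' ≤ r e' ∧ r e' ≤ p' e') → r e = p e →
      a e ≤ Ψ (Function.update r e (p' e)) - Ψ r) :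
    ∑ e, a e ≤ Ψ p' - Ψ p := by
  have key : ∀ s : Finset ι, ∑ e ∈ s, a e ≤ Ψ (s.piecewise p' p) - Ψ p := by
    intro s
    induction s using Finset.induction_on with
    | empty => simp
    | insert e s hes ih =>
      rw [sum_insert hes, piecewise_insert]
      have := h (s.piecewise p' p) e ?_ ?_
      · linarith
      · intro e'
        by_cases he : e' ∈ s
        · simp [he, hpp e']
        · simp [he, hpp e']
      · simp [hes]
  simpa using key univ

/-- Total likelihoods are sub-martingales under convex functions when the edge probabilities
increase. -/
lemma avg_convex_mono {S : Set (ℝ × ℝ)} {F : ℝ × ℝ → ℝ} (hF : ConvexOn ℝ S F)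
    (θ : ι → X → ℝ) (c₁ c₂ : X → ℝ)
    (hS : ∀ p : ι → ℝ, Box p → ∀ g, (tot p θ c₁ g, tot p θ c₂ g) ∈ S)
    {p p' : ι → ℝ} (hp : Box p) (hp' : Box p') (hpp : ∀ e, p e ≤ p' e) :
    avg p (fun g => F (tot p θ c₁ g, tot p θ c₂ g))
      ≤ avg p' (fun g => F (tot p' θ c₁ g, tot p' θ c₂ g)) := by
  have := telescope_coord (fun p => avg p (fun g => F (tot p θ c₁ g, tot p θ c₂ g))) p p' hpp
    (fun _ => 0) ?_
  · simp at this; linarith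
  intro r e hr hre
  have hrB : Box r := fun e' => ⟨(hp e').1.trans (hr e').1, (hr e').2.trans (hp' e').2⟩
  set r' := Function.update r e (p' e) with hr'
  have hr'B : Box r' := hrB.update e (hp' e).1 (hp' e).2
  have h1 : r' e = p' e := by simp [hr']
  rw [sub_nonneg, avg_coord r e, avg_coord r' e]
  rw [hr', avg_indep r e (p' e), ← hr', h1]
  swap
  · intro g b; simp
  refine avg_mono hrB fun g => ?_
  set u := (tot r' θ c₁ (Function.update g e true), tot r' θ c₂ (Function.update g e true)) with hu
  set v := (tot r' θ c₁ (Function.update g e false), tot r' θ c₂ (Function.update g e false))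
    with hv
  have e1 : (tot r θ c₁ (Function.update g e true), tot r θ c₂ (Function.update g e true)) = u := by
    rw [hu]
    simp only [tot_true, hr', totE_update_p]
  have hq1 : (0 : ℝ) < 1 - p e := by linarith [(hp e).2]
  have hq2 : (0 : ℝ) < 1 - p' e := by linarith [(hp' e).2]
  have hcomb : ((p' e - p e) / (1 - p e)) • u + ((1 - p' e) / (1 - p e)) • v
      = (tot r θ c₁ (Function.update g e false), tot r θ c₂ (Function.update g e false)) := by
    rw [hu, hv]
    simp only [tot_true, tot_false, hr', totE_update_p, Function.update_self, hre]
    ext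
    · simp; field_simp; ring
    · simp; field_simp; ring
  have hcv := hF.2 (hS r' hr'B (Function.update g e true)) (hS r' hr'B (Function.update g e false))
    
    (div_nonneg (sub_nonneg.2 (hpp e)) hq1.le) (div_nonneg hq2.le hq1.le)
    (show (p' e - p e) / (1 - p e) + (1 - p' e) / (1 - p e) = 1 by field_simp; ring)
  rw [← hu, ← hv, hcomb] at hcv
  rw [e1, hre]
  have h3 : (1 - p e) * F (tot r θ c₁ (Function.update g e false),
      tot r θ c₂ (Function.update g e false)) ≤ (p' e - p e) * F u + (1 - p' e) * F v := by
    have := mul_le_mul_of_nonneg_left hcv hq1.le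
    refine this.trans (le_of_eq ?_)
    simp only [smul_eq_mul]
    field_simp
  linarith

/-- One-variable version of `avg_convex_mono`. -/
lemma avg_convex_mono₁ {S : Set ℝ} {F : ℝ → ℝ} (hF : ConvexOn ℝ S F)
    (θ : ι → X → ℝ) (c : X → ℝ)
    (hS : ∀ p : ι → ℝ, Box p → ∀ g, tot p θ c g ∈ S)
    {p p' : ι → ℝ} (hp : Box p) (hp' : Box p') (hpp : ∀ e, p e ≤ p' e) :
    avg p (fun g => F (tot p θ c g)) ≤ avg p' (fun g => F (tot p' θ c g)) := by
  have := avg_convex_mono (S := LinearMap.fst ℝ ℝ ℝ ⁻¹' S) (F := fun z => F z.1)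
    (hF.comp_linearMap (LinearMap.fst ℝ ℝ ℝ)) θ c c (fun p hp g => hS p hp g) hp hp' hpp
  exact this

/-- The likelihood ratio integrates to one. -/
lemma avg_tot (p : ι → ℝ) (hp : Box p) (θ : ι → X → ℝ) (c : X → ℝ) :
    avg p (tot p θ c) = ∑ x, c x := by
  unfold tot
  rw [avg_sum]
  refine sum_congr rfl fun x _ => ?_
  rw [avg_mul]
  have : avg p (fun g => lik p θ g x) = 1 := by
    unfold avg bern lik
    simp_rw [← prod_mul_distrib]
    rw [← Fintype.prod_sum (fun e b => bw (p e) b * lr (p e) (θ e x) b)]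
    refine prod_eq_one fun e _ => ?_
    have : (1 - p e) ≠ 0 := by linarith [(hp e).2]
    simp [bw, lr]
    field_simp
    ring
  rw [this, mul_one]

end EdgeModel

section Scalar

lemma log_sub_ge {a b : ℝ} (ha : 0 < a) (hb : 0 < b) : 1 - b / a ≤ Real.log a - Real.log b := by
  have h := Real.log_le_sub_one_of_pos (div_pos hb ha)
  rw [Real.log_div hb.ne' ha.ne'] at h
  linarith

lemma ent_step {l m p p' : ℝ} (hp : 0 ≤ p) (hpp : p ≤ p') (hp' : p' ≤ 1 / 2)
    (hl : 0 < l) (hm : 0 < l + m) (hz : 0 < l - p / (1 - p) * m)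
    (hz' : 0 < l - p' / (1 - p') * m) :
    (p' - p) * ((l + m) * Real.log ((l + m) / l) - m) ≤
      (p' * LamFn (l + m) + (1 - p') * LamFn (l - p' / (1 - p') * m)) -
      (p * LamFn (l + m) + (1 - p) * LamFn (l - p / (1 - p) * m)) := by
  have q1 : 0 < 1 - p := by linarith
  have q2 : 0 < 1 - p' := by linarith
  set z := l - p / (1 - p) * m with hzd
  set z' := l - p' / (1 - p') * m with hzd'
  have e1 : (1 - p) * z = (1 - p) * l - p * m := by rw [hzd]; field_simp
  have e2 : (1 - p') * z' = (1 - p') * l - p' * m := by rw [hzd']; field_simp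
  have h1 := log_sub_ge hz' hz
  have h2 := log_sub_ge hl hz
  unfold LamFn
  rw [Real.log_div hm.ne' hl.ne']
  have h3 : (1 - p') * z' * (1 - z / z') ≤ (1 - p') * z' * (Real.log z' - Real.log z) :=
    mul_le_mul_of_nonneg_left h1 (mul_pos q2 hz').le
  have h4 : (p' - p) * (l + m) * (1 - z / l) ≤ (p' - p) * (l + m) * (Real.log l - Real.log z) :=
    mul_le_mul_of_nonneg_left h2 (mul_nonneg (by linarith) hm.le)
  have h5 : (1 - p') * z' * (1 - z / z') = (1 - p') * (z' - z) := by field_simp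
  have h6 : (p' - p) * (l + m) * (1 - z / l) + (p' - p) * (z - l)
      = (p' - p) * (p / (1 - p)) * (m ^ 2 / l) := by
    rw [hzd]; field_simp; ring
  have h7 : 0 ≤ (p' - p) * (p / (1 - p)) * (m ^ 2 / l) := by
    have : 0 ≤ p' - p := by linarith
    positivity
  have h8 : (1 - p') * (z' - z) = (p' - p) * (z - l - m) := by
    have : (1 - p') * (z' - z) = (1 - p') * z' - (1 - p) * z + (p' - p) * z := by ring
    rw [this, e1, e2]; ring
  have h9 : (1 - p) * z = (1 - p') * z' + (p' - p) * (l + m) := by rw [e1, e2]; ring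
  have h10 : (1 - p) * (z * Real.log z)
      = (1 - p') * z' * Real.log z + (p' - p) * (l + m) * Real.log z := by
    rw [← mul_assoc, h9]; ring
  nlinarith [h3, h4, h5, h6, h7, h8, h10]

lemma sub_log_ge {w : ℝ} (h : 0 < 1 + w) (h2 : w ≤ 2) : w ^ 2 / 8 ≤ w - Real.log (1 + w) := by
  set s := Real.sqrt (1 + w) with hs
  have hs0 : 0 < s := Real.sqrt_pos.2 h
  have hss : s ^ 2 = 1 + w := Real.sq_sqrt h.le
  have hl : Real.log (1 + w) = 2 * Real.log s := by
    rw [← hss, Real.log_pow]; norm_num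
  have := Real.log_le_sub_one_of_pos hs0
  rw [hl]
  have hw : w = s ^ 2 - 1 := by linarith
  have h3 : (s + 1) ^ 2 ≤ 8 := by
    have : s ≤ 1.8 := by
      nlinarith
    nlinarith
  have h4 : w ^ 2 / 8 ≤ (s - 1) ^ 2 := by
    have : w ^ 2 = (s - 1) ^ 2 * (s + 1) ^ 2 := by rw [hw]; ring
    rw [this]
    nlinarith [sq_nonneg (s - 1)]
  nlinarith

lemma neglog_step {l m p p' : ℝ} (hp : 0 ≤ p) (hpp : p ≤ p') (hp' : p' ≤ 1 / 2)
    (hl : 0 < l) (hm : 0 < l + m) (hml : m ≤ l / 2) :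
    (p' - p) * ((m / l) ^ 2 / 8) ≤
      (p' * (-Real.log (l + m)) + (1 - p') * (-Real.log (l - p' / (1 - p') * m))) -
      (p * (-Real.log (l + m)) + (1 - p) * (-Real.log (l - p / (1 - p) * m))) := by
  have q1 : 0 < 1 - p := by linarith
  have q2 : 0 < 1 - p' := by linarith
  set z := l - p / (1 - p) * m with hzd
  set z' := l - p' / (1 - p') * m with hzd'
  have e1 : (1 - p) * z = (1 - p) * l - p * m := by rw [hzd]; field_simp
  have e2 : (1 - p') * z' = (1 - p') * l - p' * m := by rw [hzd']; field_simp
  have zge : l / 2 ≤ z := by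
    have : (1 - p) * (l / 2) ≤ (1 - p) * z := by rw [e1]; nlinarith
    exact le_of_mul_le_mul_left this q1
  have zge' : l / 2 ≤ z' := by
    have : (1 - p') * (l / 2) ≤ (1 - p') * z' := by rw [e2]; nlinarith
    exact le_of_mul_le_mul_left this q2
  have hz : 0 < z := by linarith
  have hz' : 0 < z' := by linarith
  have hw1 : 1 + ((l + m) / z - 1) = (l + m) / z := by ring
  have hwpos : 0 < 1 + ((l + m) / z - 1) := by rw [hw1]; positivity
  have hw2 : (l + m) / z - 1 ≤ 2 := by
    have : (l + m) / z ≤ 3 := by rw [div_le_iff₀ hz]; linarith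
    linarith
  have hA := sub_log_ge hwpos hw2
  rw [hw1, Real.log_div hm.ne' hz.ne'] at hA
  have hwx : (m / l) ^ 2 ≤ ((l + m) / z - 1) ^ 2 := by
    have : (l + m) / z - 1 = m / ((1 - p) * z) := by
      rw [div_sub_one hz.ne', div_eq_div_iff hz.ne' (by positivity)]
      have : (l + m - z) * ((1 - p) * z) = ((1 - p) * (l + m) - (1 - p) * z) * z := by ring
      rw [this, e1]; ring
    rw [this, div_pow, div_pow]
    have h1 : 0 < (1 - p) * z := by positivity
    have h2 : (1 - p) * z ≤ l := by rw [e1]; nlinarith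
    gcongr
  have hB := log_sub_ge hz hz'
  have hC : (1 - p') * (1 - z' / z) ≤ (1 - p') * (Real.log z - Real.log z') :=
    mul_le_mul_of_nonneg_left hB q2.le
  have hD : (1 - p') * (1 - z' / z) = (p' - p) * ((l + m) / z - 1) := by
    have : (1 - p') * z' = (1 - p) * z - (p' - p) * (l + m) := by rw [e1, e2]; ring
    have h2 : (1 - p') * (1 - z' / z) = (1 - p') - (1 - p') * z' / z := by ring
    rw [h2, this]; field_simp; ring
  have hE : (p' - p) * ((m / l) ^ 2 / 8)
      ≤ (p' - p) * (((l + m) / z - 1) - (Real.log (l + m) - Real.log z)) :=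
    mul_le_mul_of_nonneg_left (by linarith) (by linarith)
  nlinarith [hC, hD, hE]

lemma log_ratio_sq_le {l m p c0 : ℝ} (hc : 0 < c0) (hc1 : c0 ≤ 1) (hp : 0 ≤ p) (hp' : p ≤ 1 / 2)
    (hl : 0 < l) (hm : (c0 - 1) * l ≤ m) (hml : m ≤ l / 2) :
    (Real.log (l + m) - Real.log (l - p / (1 - p) * m)) ^ 2 ≤ 64 / c0 ^ 2 * (m / l) ^ 2 := by
  have q1 : 0 < 1 - p := by linarith
  set z := l - p / (1 - p) * m with hzd
  have e1 : (1 - p) * z = (1 - p) * l - p * m := by rw [hzd]; field_simp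
  have hlm : 0 < l + m := by nlinarith
  have zge : l / 2 ≤ z := by
    have : (1 - p) * (l / 2) ≤ (1 - p) * z := by rw [e1]; nlinarith
    exact le_of_mul_le_mul_left this q1
  have zle : z ≤ 2 * l := by
    have : (1 - p) * z ≤ (1 - p) * (2 * l) := by rw [e1]; nlinarith
    exact le_of_mul_le_mul_left this q1
  have hz : 0 < z := by linarith
  have hdiff : l + m - z = m / (1 - p) := by
    rw [hzd]; field_simp; ring
  have h1 := log_sub_ge hlm hz
  have h2 := log_sub_ge hz hlm
  have hdabs : |l + m - z| ≤ 2 * |m| := by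
    rw [hdiff, abs_div, abs_of_pos q1, div_le_iff₀ q1]
    nlinarith [abs_nonneg m]
  have hlmc : c0 * l ≤ l + m := by nlinarith
  have hb : |Real.log (l + m) - Real.log z| ≤ 8 / c0 * |m / l| := by
    have ha : |m / l| = |m| / l := by rw [abs_div, abs_of_pos hl]
    rw [ha, abs_le]
    have hk1 : |l + m - z| / (l + m) ≤ 8 / c0 * (|m| / l) := by
      rw [div_le_iff₀ hlm]
      calc |l + m - z| ≤ 2 * |m| := hdabs
        _ ≤ 8 / c0 * (|m| / l) * (c0 * l) := by
          have : 8 / c0 * (|m| / l) * (c0 * l) = 8 * |m| := by field_simp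
          rw [this]; nlinarith [abs_nonneg m]
        _ ≤ _ := by gcongr
    have hk2 : |l + m - z| / z ≤ 8 / c0 * (|m| / l) := by
      rw [div_le_iff₀ hz]
      calc |l + m - z| ≤ 2 * |m| := hdabs
        _ ≤ 8 / c0 * (|m| / l) * (l / 2) := by
          have : 8 / c0 * (|m| / l) * (l / 2) = 4 * |m| / c0 := by field_simp; ring
          rw [this, le_div_iff₀ hc]; nlinarith [abs_nonneg m]
        _ ≤ _ := by gcongr
    constructor
    · have : -(|l + m - z| / (l + m)) ≤ 1 - z / (l + m) := by
        rw [one_sub_div hlm.ne', ← neg_div]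
        exact div_le_div_of_nonneg_right (neg_abs_le _) hlm.le
      linarith
    · have : -(|l + m - z| / z) ≤ 1 - (l + m) / z := by
        rw [one_sub_div hz.ne', ← neg_div]
        refine div_le_div_of_nonneg_right ?_ hz.le
        linarith [le_abs_self (l + m - z)]
      linarith
  calc (Real.log (l + m) - Real.log z) ^ 2 = |Real.log (l + m) - Real.log z| ^ 2 := (sq_abs _).symm
    _ ≤ (8 / c0 * |m / l|) ^ 2 := by gcongr
    _ = _ := by rw [mul_pow, sq_abs]; ring

/-- The function `a log (a/b) - (a - b)` is jointly convex. -/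
lemma convexOn_relEnt : ConvexOn ℝ {z : ℝ × ℝ | 0 < z.1 ∧ 0 < z.2}
    (fun z => z.1 * Real.log (z.1 / z.2) - (z.1 - z.2)) := by
  constructor
  · intro x hx y hy a b ha hb hab
    rcases ha.eq_or_lt with rfl | ha'
    · have : b = 1 := by linarith
      subst this; simpa using hy
    · exact ⟨by
        have h1 := hx.1; have h2 := hy.1
        simp only [Prod.fst_add, Prod.smul_fst, smul_eq_mul]; positivity, by
        have h1 := hx.2; have h2 := hy.2
        simp only [Prod.snd_add, Prod.smul_snd, smul_eq_mul]; positivity⟩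
  · rintro ⟨a1, b1⟩ ⟨h1, h1'⟩ ⟨a2, b2⟩ ⟨h2, h2'⟩ t s ht hs hts
    simp only [Prod.smul_mk, Prod.mk_add_mk, smul_eq_mul] at *
    set A := t * a1 + s * a2 with hA
    set B := t * b1 + s * b2 with hB
    have hApos : 0 < A := by
      rcases ht.eq_or_lt with rfl | ht'
      · have : s = 1 := by linarith
        subst this; simp [hA, h2]
      · positivity
    have hBpos : 0 < B := by
      rcases ht.eq_or_lt with rfl | ht'
      · have : s = 1 := by linarith
        subst this; simp [hB, h2']
      · positivity
    have key : ∀ a b : ℝ, 0 < a → 0 < b →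
        a * Real.log (A / B) + a - A * b / B ≤ a * Real.log (a / b) := by
      intro a b ha hb
      have h := log_sub_ge (div_pos ha hb) (div_pos hApos hBpos)
      have := mul_le_mul_of_nonneg_left h ha.le
      have e : a * (1 - A / B / (a / b)) = a - A * b / B := by field_simp
      rw [e] at this
      linarith
    have k1 := mul_le_mul_of_nonneg_left (key a1 b1 h1 h1') ht
    have k2 := mul_le_mul_of_nonneg_left (key a2 b2 h2 h2') hs
    have e3 : t * (A * b1 / B) + s * (A * b2 / B) = A := by
      have : t * (A * b1 / B) + s * (A * b2 / B) = A * B / B := by rw [hB]; ring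
      rw [this]; field_simp
    have e4 : A * Real.log (A / B) = t * (a1 * Real.log (A / B)) + s * (a2 * Real.log (A / B)) := by
      rw [hA]; ring
    linarith

end Scalar

section EdgeModel

variable {ι X : Type*} [Fintype ι] [DecidableEq ι] [Fintype X]

/-- A nonnegative weight that is not identically zero. -/
def PosWt (μ : X → ℝ) : Prop := (∀ x, 0 ≤ μ x) ∧ ∃ x, 0 < μ x

lemma tot_pos {c0 : ℝ} (hc : 0 < c0) {p : ι → ℝ} (hp : Box p) {θ : ι → X → ℝ} (hθ : Tilt c0 θ)
    {μ : X → ℝ} (hμ : PosWt μ) (g : ι → Bool) : 0 < tot p θ μ g := by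
  obtain ⟨x, hx⟩ := hμ.2
  exact sum_pos' (fun y _ => mul_nonneg (hμ.1 y) (lik_pos hc hp hθ g y).le)
    ⟨x, mem_univ x, mul_pos hx (lik_pos hc hp hθ g x)⟩

lemma totE_pos {c0 : ℝ} (hc : 0 < c0) (hc1 : c0 ≤ 1) {p : ι → ℝ} (hp : Box p) {θ : ι → X → ℝ}
    (hθ : Tilt c0 θ) {μ : X → ℝ} (hμ : PosWt μ) (e : ι) (g : ι → Bool) : 0 < totE p θ e μ g :=
  tot_pos hc hp (hθ.update hc1 e) hμ g

lemma totE_mul_bounds {c0 : ℝ} (hc : 0 < c0) (hc1 : c0 ≤ 1) {p : ι → ℝ} (hp : Box p)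
    {θ : ι → X → ℝ} (hθ : Tilt c0 θ) {μ : X → ℝ} (hμ : ∀ x, 0 ≤ μ x) (e : ι) (g : ι → Bool) :
    (c0 - 1) * totE p θ e μ g ≤ totE p θ e (fun x => μ x * θ e x) g ∧
      totE p θ e (fun x => μ x * θ e x) g ≤ totE p θ e μ g / 2 := by
  have hl := fun x => (lik_pos hc hp (hθ.update hc1 e) g x).le
  constructor
  · simp only [totE, tot, mul_sum]
    refine sum_le_sum fun x _ => ?_
    have := mul_le_mul_of_nonneg_left (hθ e x).1 (mul_nonneg (hμ x) (hl x))
    linarith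
  · simp only [totE, tot, sum_div]
    refine sum_le_sum fun x _ => ?_
    have := mul_le_mul_of_nonneg_left (hθ e x).2 (mul_nonneg (hμ x) (hl x))
    linarith

/-- Relative entropy gained by raising the edge probabilities. -/
lemma ent_gain {c0 : ℝ} (hc : 0 < c0) (hc1 : c0 ≤ 1) {θ : ι → X → ℝ} (hθ : Tilt c0 θ)
    {μ : X → ℝ} (hμ : PosWt μ) {p p' : ι → ℝ} (hp : Box p) (hp' : Box p')
    (hpp : ∀ e, p e ≤ p' e) :
    ∑ e, (p' e - p e) * avg p (fun g =>
        (totE p θ e μ g + totE p θ e (fun x => μ x * θ e x) g) *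
          Real.log ((totE p θ e μ g + totE p θ e (fun x => μ x * θ e x) g) / totE p θ e μ g)
        - totE p θ e (fun x => μ x * θ e x) g)
      ≤ avg p' (fun g => LamFn (tot p' θ μ g)) - avg p (fun g => LamFn (tot p θ μ g)) := by
  refine telescope_coord (fun p => avg p (fun g => LamFn (tot p θ μ g))) p p' hpp _ ?_
  intro r e hr hre
  have hrB : Box r := fun e' => ⟨(hp e').1.trans (hr e').1, (hr e').2.trans (hp' e').2⟩
  set r' := Function.update r e (p' e) with hr'
  have hr'B : Box r' := hrB.update e (hp' e).1 (hp' e).2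
  have h1 : r' e = p' e := by simp [hr']
  have hsum : ∀ (s : ι → ℝ) g, totE s θ e (fun x => μ x * (1 + θ e x)) g
      = totE s θ e μ g + totE s θ e (fun x => μ x * θ e x) g := by
    intro s g
    simp only [totE, tot, ← sum_add_distrib]
    exact sum_congr rfl fun x _ => by ring
  have hmono := avg_convex_mono convexOn_relEnt (Function.update θ e 0)
    (fun x => μ x * (1 + θ e x)) μ (fun s hs g => ?_) hp hrB (fun e' => (hr e').1)
  swap
  · refine ⟨?_, totE_pos hc hc1 hs hθ hμ e g⟩
    change 0 < totE s θ e (fun x => μ x * (1 + θ e x)) g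
    rw [hsum]
    nlinarith [(totE_mul_bounds hc hc1 hs hθ hμ.1 e g).1, totE_pos hc hc1 hs hθ hμ e g]
  have hstep : ∀ g, (p' e - p e) * ((totE r θ e μ g + totE r θ e (fun x => μ x * θ e x) g) *
          Real.log ((totE r θ e μ g + totE r θ e (fun x => μ x * θ e x) g) / totE r θ e μ g)
        - totE r θ e (fun x => μ x * θ e x) g) ≤
      (p' e * LamFn (tot r' θ μ (Function.update g e true))
        + (1 - p' e) * LamFn (tot r' θ μ (Function.update g e false)))
      - (p e * LamFn (tot r θ μ (Function.update g e true))
        + (1 - p e) * LamFn (tot r θ μ (Function.update g e false))) := by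
    intro g
    have b1 := totE_pos hc hc1 hrB hθ hμ e g
    have b2 := totE_mul_bounds hc hc1 hrB hθ hμ.1 e g
    have t1 := tot_pos hc hrB hθ hμ (Function.update g e true)
    have t2 := tot_pos hc hrB hθ hμ (Function.update g e false)
    have t3 := tot_pos hc hr'B hθ hμ (Function.update g e false)
    simp only [tot_true, tot_false, hr', totE_update_p, Function.update_self, hre] at t1 t2 t3 ⊢
    exact ent_step (hp e).1 (hpp e) (hp' e).2 b1 t1 t2 t3
  have hfin : (p' e - p e) * avg r (fun g => (totE r θ e μ g + totE r θ e (fun x => μ x * θ e x) g) *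
          Real.log ((totE r θ e μ g + totE r θ e (fun x => μ x * θ e x) g) / totE r θ e μ g)
        - totE r θ e (fun x => μ x * θ e x) g) ≤
      avg r' (fun g => LamFn (tot r' θ μ g)) - avg r (fun g => LamFn (tot r θ μ g)) := by
    rw [avg_coord r e, avg_coord r' e (fun g => LamFn (tot r' θ μ g)),
      avg_coord r e (fun g => LamFn (tot r θ μ g))]
    rw [hr', avg_indep r e (p' e), ← hr', h1, hre, ← avg_sub, ← avg_mul]
    · refine avg_mono hrB fun g => ?_
      simp only [totE_update]
      have := hstep g
      linarith
    · intro g b; simp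
  refine le_trans ?_ hfin
  refine mul_le_mul_of_nonneg_left ?_ (sub_nonneg.2 (hpp e))
  change avg p (fun g => totE p θ e (fun x => μ x * (1 + θ e x)) g *
      Real.log (totE p θ e (fun x => μ x * (1 + θ e x)) g / totE p θ e μ g)
      - (totE p θ e (fun x => μ x * (1 + θ e x)) g - totE p θ e μ g)) ≤
    avg r (fun g => totE r θ e (fun x => μ x * (1 + θ e x)) g *
      Real.log (totE r θ e (fun x => μ x * (1 + θ e x)) g / totE r θ e μ g)
      - (totE r θ e (fun x => μ x * (1 + θ e x)) g - totE r θ e μ g)) at hmono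
  simp only [hsum, add_sub_cancel_left] at hmono
  exact hmono

/-- One-edge increment of the reversed relative entropy. -/
lemma neglog_gain {c0 : ℝ} (hc : 0 < c0) (hc1 : c0 ≤ 1) {θ : ι → X → ℝ} (hθ : Tilt c0 θ)
    {μ : X → ℝ} (hμ : PosWt μ) {r : ι → ℝ} (hrB : Box r) (e : ι) {a : ℝ} (ha : r e ≤ a)
    (ha' : a ≤ 1 / 2) :
    (a - r e) * avg r (fun g => (totE r θ e (fun x => μ x * θ e x) g / totE r θ e μ g) ^ 2 / 8) ≤
      avg (Function.update r e a) (fun g => -Real.log (tot (Function.update r e a) θ μ g))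
      - avg r (fun g => -Real.log (tot r θ μ g)) := by
  set r' := Function.update r e a with hr'
  have h1 : r' e = a := by simp [hr']
  rw [avg_coord r e, avg_coord r' e (fun g => -Real.log (tot r' θ μ g)),
      avg_coord r e (fun g => -Real.log (tot r θ μ g))]
  rw [hr', avg_indep r e a, ← hr', h1, ← avg_sub, ← avg_mul]
  · refine avg_mono hrB fun g => ?_
    have b1 := totE_pos hc hc1 hrB hθ hμ e g
    have b2 := totE_mul_bounds hc hc1 hrB hθ hμ.1 e g
    have t1 := tot_pos hc hrB hθ hμ (Function.update g e true)
    simp only [tot_true, tot_false, hr', totE_update_p, Function.update_self, totE_update] at t1 ⊢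
    have := neglog_step (hrB e).1 ha ha' b1 t1 b2.2
    linarith
  · intro g b; simp

/-- Averaging out one coordinate. -/
noncomputable def avgAt (p : ι → ℝ) (e : ι) (f : (ι → Bool) → ℝ) : (ι → Bool) → ℝ :=
  fun g => p e * f (Function.update g e true) + (1 - p e) * f (Function.update g e false)

lemma avg_avgAt (p : ι → ℝ) (e : ι) (f : (ι → Bool) → ℝ) : avg p (avgAt p e f) = avg p f :=
  (avg_coord p e f).symm

/-- Discrete derivative in one coordinate. -/
def dif (e : ι) (f : (ι → Bool) → ℝ) : (ι → Bool) → ℝ :=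
  fun g => f (Function.update g e true) - f (Function.update g e false)

lemma avg_dif_avgAt_le {p : ι → ℝ} (hp : Box p) (e e' : ι) (f : (ι → Bool) → ℝ) :
    avg p (fun g => dif e (avgAt p e' f) g ^ 2) ≤ avg p (fun g => dif e f g ^ 2) := by
  by_cases h : e = e'
  · subst h
    have : ∀ g, dif e (avgAt p e f) g = 0 := by
      intro g; simp [dif, avgAt]
    simp only [this]
    exact avg_mono hp fun g => by simpa using sq_nonneg (dif e f g)
  · rw [← avg_avgAt p e' (fun g => dif e f g ^ 2)]
    refine avg_mono hp fun g => ?_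
    have hc : ∀ b b', Function.update (Function.update g e b) e' b'
        = Function.update (Function.update g e' b') e b := fun b b' =>
      Function.update_comm h b b' g
    simp only [dif, avgAt, hc]
    have h0 := (hp e').1
    have h1 : 0 ≤ 1 - p e' := by linarith [(hp e').2]
    nlinarith [mul_nonneg (mul_nonneg h0 h1) (sq_nonneg
      ((f (Function.update (Function.update g e' true) e true)
        - f (Function.update (Function.update g e' true) e false))
      - (f (Function.update (Function.update g e' false) e true)
        - f (Function.update (Function.update g e' false) e false))))]

lemma eq_of_update_invariant (h : (ι → Bool) → ℝ)
    (hh : ∀ g e b, h (Function.update g e b) = h g) (g g' : ι → Bool) : h g = h g' := by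
  have key : ∀ s : Finset ι, h (s.piecewise g' g) = h g := by
    intro s
    induction s using Finset.induction_on with
    | empty => simp
    | insert e s hes ih => rw [piecewise_insert, hh, ih]
  simpa using (key univ).symm

/-- The Efron–Stein inequality for product Bernoulli measures. -/
lemma efron_stein {p : ι → ℝ} (hp : Box p) (f : (ι → Bool) → ℝ) :
    avg p (fun g => f g ^ 2) - (avg p f) ^ 2
      ≤ ∑ e, p e * (1 - p e) * avg p (fun g => dif e f g ^ 2) := by
  have key : ∀ s : Finset ι, ∃ h : (ι → Bool) → ℝ, avg p h = avg p f ∧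
      (∀ e ∈ s, ∀ g b, h (Function.update g e b) = h g) ∧
      (∀ e, avg p (fun g => dif e h g ^ 2) ≤ avg p (fun g => dif e f g ^ 2)) ∧
      avg p (fun g => f g ^ 2) - avg p (fun g => h g ^ 2)
        ≤ ∑ e ∈ s, p e * (1 - p e) * avg p (fun g => dif e f g ^ 2) := by
    intro s
    induction s using Finset.induction_on with
    | empty => exact ⟨f, rfl, by simp, fun _ => le_rfl, by simp⟩
    | insert e s hes ih =>
      obtain ⟨h, h1, h2, h3, h4⟩ := ih
      refine ⟨avgAt p e h, by rw [avg_avgAt, h1], ?_, ?_, ?_⟩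
      · intro e' he' g b
        by_cases hee : e' = e
        · subst hee; simp [avgAt]
        · have hmem : e' ∈ s := by
            rcases mem_insert.1 he' with h | h
            · exact absurd h hee
            · exact h
          simp only [avgAt, Function.update_comm hee, h2 e' hmem]
      · intro e'
        exact (avg_dif_avgAt_le hp e' e h).trans (h3 e')
      · rw [sum_insert hes]
        have hv : avg p (fun g => h g ^ 2) - avg p (fun g => avgAt p e h g ^ 2)
            = p e * (1 - p e) * avg p (fun g => dif e h g ^ 2) := by
          rw [avg_coord p e (fun g => h g ^ 2), ← avg_sub, ← avg_mul]
          congr 1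
          funext g
          simp only [avgAt, dif]
          ring
        have h0 : 0 ≤ p e * (1 - p e) :=
          mul_nonneg (hp e).1 (by linarith [(hp e).2])
        have := mul_le_mul_of_nonneg_left (h3 e) h0
        linarith
  obtain ⟨h, h1, h2, -, h4⟩ := key univ
  have hconst : ∀ g, h g = h (fun _ => true) := fun g =>
    eq_of_update_invariant h (fun g e b => h2 e (mem_univ e) g b) g _
  have e1 : avg p (fun g => h g ^ 2) = (avg p h) ^ 2 := by
    have a1 : (fun g => h g ^ 2) = fun _ => h (fun _ => true) ^ 2 := by
      funext g; rw [hconst g]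
    have a2 : h = fun _ => h (fun _ => true) := funext hconst
    rw [a1, avg_const]
    conv_rhs => rw [a2, avg_const]
  rw [← h1, ← e1]
  exact h4

/-- Variance bound for the log-likelihood ratio. -/
lemma var_log_le {c0 : ℝ} (hc : 0 < c0) (hc1 : c0 ≤ 1) {θ : ι → X → ℝ} (hθ : Tilt c0 θ)
    {μ : X → ℝ} (hμ : PosWt μ) {p : ι → ℝ} (hp : Box p) :
    avg p (fun g => Real.log (tot p θ μ g) ^ 2) - (avg p (fun g => Real.log (tot p θ μ g))) ^ 2
      ≤ ∑ e, p e * (64 / c0 ^ 2 *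
        avg p (fun g => (totE p θ e (fun x => μ x * θ e x) g / totE p θ e μ g) ^ 2)) := by
  refine (efron_stein hp _).trans (sum_le_sum fun e _ => ?_)
  have h0 := (hp e).1
  have h1 := (hp e).2
  have hA : avg p (fun g => dif e (fun g => Real.log (tot p θ μ g)) g ^ 2) ≤ 64 / c0 ^ 2 *
        avg p (fun g => (totE p θ e (fun x => μ x * θ e x) g / totE p θ e μ g) ^ 2) := by
    rw [← avg_mul]
    refine avg_mono hp fun g => ?_
    have b1 := totE_pos hc hc1 hp hθ hμ e g
    have b2 := totE_mul_bounds hc hc1 hp hθ hμ.1 e g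
    simp only [dif, tot_true, tot_false]
    exact log_ratio_sq_le hc hc1 h0 h1 b1 b2.1 b2.2
  have hB : 0 ≤ avg p (fun g => dif e (fun g => Real.log (tot p θ μ g)) g ^ 2) :=
    avg_nonneg hp fun g => sq_nonneg _
  calc _ ≤ p e * avg p (fun g => dif e (fun g => Real.log (tot p θ μ g)) g ^ 2) := by
        rw [mul_assoc]
        refine mul_le_mul_of_nonneg_left ?_ h0
        nlinarith
    _ ≤ _ := mul_le_mul_of_nonneg_left hA h0

end EdgeModel

section Riccati

variable {ι X : Type*} [Fintype ι] [DecidableEq ι] [Fintype X]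

lemma continuous_bern (g : ι → Bool) : Continuous fun p : ι → ℝ => bern p g := by
  unfold bern bw
  refine continuous_finsetProd _ fun e _ => ?_
  split_ifs <;> fun_prop

lemma continuousAt_tot {p : ι → ℝ} (hp : Box p) (θ : ι → X → ℝ) (c : X → ℝ) (g : ι → Bool) :
    ContinuousAt (fun p : ι → ℝ => tot p θ c g) p := by
  unfold tot lik lr
  refine tendsto_finsetSum _ fun x _ => Filter.Tendsto.mul tendsto_const_nhds ?_
  refine tendsto_finsetProd _ fun e _ => ?_
  split_ifs
  · exact tendsto_const_nhds
  · have h1 : (1 : ℝ) - p e ≠ 0 := by linarith [(hp e).2]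
    have : ContinuousAt (fun p : ι → ℝ => 1 - p e * θ e x / (1 - p e)) p := by
      fun_prop (disch := exact h1)
    exact this

/-- The squared influence of an edge. -/
noncomputable def infl (θ : ι → X → ℝ) (μ : X → ℝ) (p : ι → ℝ) (e : ι) : ℝ :=
  avg p (fun g => (totE p θ e (fun x => μ x * θ e x) g / totE p θ e μ g) ^ 2)

lemma infl_nonneg (θ : ι → X → ℝ) (μ : X → ℝ) {p : ι → ℝ} (hp : Box p) (e : ι) :
    0 ≤ infl θ μ p e := avg_nonneg hp fun _ => sq_nonneg _

lemma continuousAt_infl {c0 : ℝ} (hc : 0 < c0) (hc1 : c0 ≤ 1) {θ : ι → X → ℝ} (hθ : Tilt c0 θ)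
    {μ : X → ℝ} (hμ : PosWt μ) {p : ι → ℝ} (hp : Box p) (e : ι) :
    ContinuousAt (fun p => infl θ μ p e) p := by
  unfold infl avg
  refine tendsto_finsetSum _ fun g _ => Filter.Tendsto.mul
    ((continuous_bern g).continuousAt) ?_
  have h2 := continuousAt_tot hp (Function.update θ e 0) μ g
  have h1 := continuousAt_tot hp (Function.update θ e 0) (fun x => μ x * θ e x) g
  exact (h1.div h2 (totE_pos hc hc1 hp hθ hμ e g).ne').pow 2

/-- Expected negative log-likelihood ratio at constant edge probability `t / N`. -/
noncomputable def negLog (θ : ι → X → ℝ) (μ : X → ℝ) (N t : ℝ) : ℝ :=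
  avg (fun _ : ι => t / N) (fun g => -Real.log (tot (fun _ : ι => t / N) θ μ g))

lemma box_const {p : ℝ} (h0 : 0 ≤ p) (h1 : p ≤ 1 / 2) : Box (fun _ : ι => p) := fun _ => ⟨h0, h1⟩

lemma differentiableAt_negLog {c0 : ℝ} (hc : 0 < c0) {θ : ι → X → ℝ} (hθ : Tilt c0 θ)
    {μ : X → ℝ} (hμ : PosWt μ) {N t : ℝ} (h0 : 0 ≤ t / N) (h1 : t / N ≤ 1 / 2) :
    DifferentiableAt ℝ (negLog θ μ N) t := by
  unfold negLog avg
  refine DifferentiableAt.fun_sum fun g _ => DifferentiableAt.mul ?_ ?_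
  · unfold bern bw
    refine DifferentiableAt.fun_finsetProd fun e _ => ?_
    split_ifs <;> fun_prop
  · refine DifferentiableAt.fun_neg (DifferentiableAt.log ?_ (tot_pos hc (box_const h0 h1) hθ hμ g).ne')
    unfold tot lik lr
    refine DifferentiableAt.fun_sum fun x _ => DifferentiableAt.const_mul ?_ _
    refine DifferentiableAt.fun_finsetProd fun e _ => ?_
    split_ifs
    · fun_prop
    · have h1 : (1 : ℝ) - t / N ≠ 0 := by linarith
      fun_prop (disch := exact h1)

lemma deriv_negLog_ge {c0 : ℝ} (hc : 0 < c0) (hc1 : c0 ≤ 1) {θ : ι → X → ℝ} (hθ : Tilt c0 θ)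
    {μ : X → ℝ} (hμ : PosWt μ) {N t : ℝ} (hN : 0 < N) (h0 : 0 ≤ t) (h1 : t / N < 1 / 2) :
    ∑ e, infl θ μ (fun _ : ι => t / N) e / (8 * N) ≤ deriv (negLog θ μ N) t := by
  have hb : Box (fun _ : ι => t / N) := box_const (by positivity) h1.le
  have hd := (differentiableAt_negLog hc hθ hμ (N := N) (t := t) (by positivity) h1.le).hasDerivAt
  have hs : Filter.Tendsto (slope (negLog θ μ N) t) (nhdsWithin t (Set.Ioi t))
      (nhds (deriv (negLog θ μ N) t)) :=
    hd.tendsto_slope.mono_left (nhdsWithin_mono _ fun x hx => ne_of_gt hx)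
  refine le_of_forall_pos_le_add fun ε hε => ?_
  suffices h : ∑ e, infl θ μ (fun _ : ι => t / N) e / (8 * N) - ε ≤ deriv (negLog θ μ N) t by
    linarith
  set η : ℝ := ε * (8 * N) / (Fintype.card ι + 1) with hη
  have hηpos : 0 < η := by positivity
  have hcont : ∀ᶠ r in nhds (fun _ : ι => t / N),
      ∀ e, infl θ μ (fun _ : ι => t / N) e - η < infl θ μ r e := by
    rw [Filter.eventually_all]
    intro e
    exact (continuousAt_infl hc hc1 hθ hμ hb e).eventually_const_lt (by linarith)
  obtain ⟨δ, hδ, hball⟩ := Metric.eventually_nhds_iff.1 hcont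
  refine ge_of_tendsto hs ?_
  have hmem : Set.Ioo t (t + min (δ * N) (N * (1 / 2 - t / N))) ∈ nhdsWithin t (Set.Ioi t) :=
    Ioo_mem_nhdsGT (by
      have : 0 < min (δ * N) (N * (1 / 2 - t / N)) :=
        lt_min (by positivity) (mul_pos hN (by linarith))
      linarith)
  filter_upwards [hmem] with t' ht'
  have hlt : t < t' := ht'.1
  have hA : t' - t < δ * N := by linarith [ht'.2, min_le_left (δ * N) (N * (1 / 2 - t / N))]
  have hB : t' - t < N * (1 / 2 - t / N) := by
    linarith [ht'.2, min_le_right (δ * N) (N * (1 / 2 - t / N))]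
  have hB' : t' / N ≤ 1 / 2 := by
    rw [div_le_iff₀ hN]
    have : N * (t / N) = t := by field_simp
    nlinarith
  have htt : t / N ≤ t' / N := by gcongr
  have key := telescope_coord
    (fun p : ι → ℝ => avg p (fun g => -Real.log (tot p θ μ g))) (fun _ => t / N) (fun _ => t' / N)
    (fun _ => htt)
    (fun e => (t' / N - t / N) * ((infl θ μ (fun _ : ι => t / N) e - η) / 8)) ?_
  · change _ ≤ negLog θ μ N t' - negLog θ μ N t at key
    rw [slope_def_field, le_div_iff₀ (by linarith)]
    refine le_trans ?_ key
    have e1 : ∑ e, infl θ μ (fun _ : ι => t / N) e / (8 * N)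
        = (∑ e, infl θ μ (fun _ : ι => t / N) e) / (8 * N) := (sum_div _ _ _).symm
    rw [e1, ← mul_sum, ← sum_div univ (fun i => infl θ μ (fun _ : ι => t / N) i - η), sum_sub_distrib]
    simp only [sum_const, card_univ, nsmul_eq_mul]
    have e2 : (Fintype.card ι : ℝ) * η ≤ ε * (8 * N) := by
      rw [hη, mul_div_assoc', div_le_iff₀ (by positivity)]
      nlinarith [show 0 < ε * (8 * N) by positivity]
    have e3 : (t' / N - t / N) * ((∑ e, infl θ μ (fun _ : ι => t / N) e
          - (Fintype.card ι : ℝ) * η) / 8)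
        = (∑ e, infl θ μ (fun _ : ι => t / N) e - (Fintype.card ι : ℝ) * η) / (8 * N) * (t' - t) := by
      field_simp
    rw [e3]
    refine mul_le_mul_of_nonneg_right ?_ (by linarith)
    rw [sub_div]
    have : (Fintype.card ι : ℝ) * η / (8 * N) ≤ ε := by
      rw [div_le_iff₀ (by positivity)]; exact e2
    linarith
  · intro r e hr hre
    have hrB : Box r := fun e' => ⟨le_trans (by positivity) (hr e').1, (hr e').2.trans hB'⟩
    have := neglog_gain hc hc1 hθ hμ hrB e (a := t' / N) (by rw [hre]; exact htt) hB'
    refine le_trans ?_ this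
    rw [hre]
    refine mul_le_mul_of_nonneg_left ?_ (by linarith)
    have hr2 : infl θ μ (fun _ : ι => t / N) e - η < infl θ μ r e := by
      refine hball ?_ e
      rw [dist_pi_lt_iff hδ]
      intro e'
      rw [Real.dist_eq, abs_of_nonneg (by linarith [(hr e').1])]
      have : t' / N - t / N < δ := by rw [← sub_div, div_lt_iff₀ hN]; exact hA
      linarith [(hr e').2]
    have e4 : avg r (fun g => (totE r θ e (fun x => μ x * θ e x) g / totE r θ e μ g) ^ 2 / 8)
        = infl θ μ r e / 8 := by
      have := avg_mul r (1 / 8) (fun g => (totE r θ e (fun x => μ x * θ e x) g / totE r θ e μ g) ^ 2)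
      unfold infl
      rw [div_eq_inv_mul, ← one_div, ← this]
      congr 1; ext g; ring
    rw [e4]
    linarith

lemma convexOn_posPart (M : ℝ) : ConvexOn ℝ Set.univ (fun x : ℝ => max (x - M) 0) := by
  have h1 : ConvexOn ℝ Set.univ (fun x : ℝ => x - M) :=
    ((convexOn_id convex_univ).add (convexOn_const (-M) convex_univ)).congr fun x _ => by
      simp [sub_eq_add_neg]
  exact h1.sup (convexOn_const 0 convex_univ)

/-- Chebyshev's inequality for the log-likelihood ratio under uniform integrability. -/
lemma sq_negLog_le_var {μ : X → ℝ} (hμ1 : ∑ x, μ x = 1) {θ : ι → X → ℝ}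
    {p : ι → ℝ} (hp : Box p) {M : ℝ} (hM : 0 < M)
    (hUI : avg p (fun g => max (tot p θ μ g - M) 0) ≤ 1 / 4)
    (hD : Real.log 4 ≤ avg p (fun g => -Real.log (tot p θ μ g))) :
    (avg p (fun g => -Real.log (tot p θ μ g)) - Real.log 4) ^ 2 / (2 * M) ≤
      avg p (fun g => Real.log (tot p θ μ g) ^ 2) - (avg p (fun g => Real.log (tot p θ μ g))) ^ 2 := by
  classical
  set D := avg p (fun g => -Real.log (tot p θ μ g)) with hDdef
  have hneg : avg p (fun g => Real.log (tot p θ μ g)) = -D := by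
    have := avg_mul p (-1) (fun g => Real.log (tot p θ μ g))
    simp only [neg_one_mul] at this
    rw [hDdef, this]; ring
  set I : (ι → Bool) → ℝ := fun g => if 1 / 4 ≤ tot p θ μ g then 1 else 0 with hI
  have hprob : 1 / (2 * M) ≤ avg p I := by
    have h1 : avg p (tot p θ μ) ≤ avg p (fun g => (1 / 4 + M * I g) + max (tot p θ μ g - M) 0) := by
      refine avg_mono hp fun g => ?_
      simp only [hI]
      split_ifs with h
      · linarith [le_max_left (tot p θ μ g - M) 0]
      · linarith [le_max_right (tot p θ μ g - M) 0, not_le.1 h]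
    rw [avg_tot p hp θ μ, hμ1, avg_add, avg_add, avg_const, avg_mul] at h1
    rw [div_le_iff₀ (by positivity)]
    linarith
  have h2 : avg p (fun g => (Real.log (tot p θ μ g) + D) ^ 2)
      = avg p (fun g => Real.log (tot p θ μ g) ^ 2) - D ^ 2 := by
    have : (fun g => (Real.log (tot p θ μ g) + D) ^ 2) = fun g =>
        (Real.log (tot p θ μ g) ^ 2 + (2 * D) * Real.log (tot p θ μ g)) + D ^ 2 := by
      ext g; ring
    rw [this, avg_add, avg_add, avg_mul, avg_const, hneg]; ring
  rw [hneg, neg_sq, ← h2]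
  have h3 : avg p (fun g => (D - Real.log 4) ^ 2 * I g)
      ≤ avg p (fun g => (Real.log (tot p θ μ g) + D) ^ 2) := by
    refine avg_mono hp fun g => ?_
    simp only [hI]
    split_ifs with h
    · have : -Real.log 4 ≤ Real.log (tot p θ μ g) := by
        rw [← Real.log_inv]; exact Real.log_le_log (by norm_num) (by linarith)
      nlinarith
    · simpa using sq_nonneg _
  rw [avg_mul] at h3
  refine le_trans ?_ h3
  rw [div_eq_mul_one_div]
  exact mul_le_mul_of_nonneg_left hprob (sq_nonneg _)

/-- Uniform integrability at a larger edge density bounds the expected negative log-likelihood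
ratio, through a Riccati differential inequality in the edge density. -/
theorem negLog_bounded {c0 : ℝ} (hc : 0 < c0) (hc1 : c0 ≤ 1) {θ : ι → X → ℝ} (hθ : Tilt c0 θ)
    {μ : X → ℝ} (hμ : PosWt μ) (hμ1 : ∑ x, μ x = 1) {N d d1 M : ℝ} (hN : 0 < N) (hd : 0 < d)
    (hdd : d < d1) (h1 : d1 / N < 1 / 2) (hM : 0 < M)
    (hUI : avg (fun _ : ι => d1 / N) (fun g => max (tot (fun _ : ι => d1 / N) θ μ g - M) 0) ≤ 1 / 4) :
    negLog θ μ N d ≤ Real.log 4 + 1024 * M * d1 / (c0 ^ 2 * (d1 - d)) := by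
  have hd1 : 0 < d1 := hd.trans hdd
  set c : ℝ := c0 ^ 2 / (1024 * M * d1) with hcdef
  have hcpos : 0 < c := by positivity
  have hbox : ∀ t ∈ Set.Icc d d1, 0 ≤ t ∧ t / N < 1 / 2 := fun t ht =>
    ⟨hd.le.trans ht.1, lt_of_le_of_lt (by gcongr; exact ht.2) h1⟩
  have hdiff : ∀ t ∈ Set.Icc d d1, DifferentiableAt ℝ (negLog θ μ N) t := fun t ht =>
    differentiableAt_negLog hc hθ hμ (div_nonneg (hbox t ht).1 hN.le) (hbox t ht).2.le
  have hcont : ContinuousOn (negLog θ μ N) (Set.Icc d d1) := fun t ht =>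
    (hdiff t ht).continuousAt.continuousWithinAt
  have hderiv0 : ∀ t ∈ Set.Icc d d1, 0 ≤ deriv (negLog θ μ N) t := fun t ht =>
    le_trans (sum_nonneg fun e _ => div_nonneg (infl_nonneg θ μ
      (box_const (div_nonneg (hbox t ht).1 hN.le) (hbox t ht).2.le) e) (by positivity))
      (deriv_negLog_ge hc hc1 hθ hμ hN (hbox t ht).1 (hbox t ht).2)
  have hmono : MonotoneOn (negLog θ μ N) (Set.Icc d d1) := by
    refine monotoneOn_of_deriv_nonneg (convex_Icc d d1) hcont ?_ ?_
    · rw [interior_Icc]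
      exact fun t ht => (hdiff t (Set.Ioo_subset_Icc_self ht)).differentiableWithinAt
    · rw [interior_Icc]
      exact fun t ht => hderiv0 t (Set.Ioo_subset_Icc_self ht)
  rcases le_or_gt (negLog θ μ N d) (Real.log 4) with hle | hgt
  · have : 0 ≤ 1024 * M * d1 / (c0 ^ 2 * (d1 - d)) := by
      have : 0 < d1 - d := by linarith
      positivity
    linarith
  have hy : ∀ t ∈ Set.Icc d d1, 0 < negLog θ μ N t - Real.log 4 := fun t ht => by
    have := hmono (Set.left_mem_Icc.2 hdd.le) ht ht.1
    linarith
  have hric : ∀ t ∈ Set.Icc d d1, c * (negLog θ μ N t - Real.log 4) ^ 2 ≤ deriv (negLog θ μ N) t := by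
    intro t ht
    have hb : Box (fun _ : ι => t / N) :=
      box_const (div_nonneg (hbox t ht).1 hN.le) (hbox t ht).2.le
    have hb1 : Box (fun _ : ι => d1 / N) := box_const (by positivity) h1.le
    have hUIt := (avg_convex_mono₁ (convexOn_posPart M) θ μ (fun _ _ _ => Set.mem_univ _) hb hb1
      (fun _ => by gcongr; exact ht.2)).trans hUI
    have hv := sq_negLog_le_var hμ1 hb hM hUIt
      (by have := hy t ht; unfold negLog at this; linarith)
    have hv2 := var_log_le hc hc1 hθ hμ hb
    have hv3 := deriv_negLog_ge hc hc1 hθ hμ hN (hbox t ht).1 (hbox t ht).2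
    change (negLog θ μ N t - Real.log 4) ^ 2 / (2 * M) ≤ _ at hv
    have hv4 := hv.trans hv2
    set S : ℝ := ∑ e, infl θ μ (fun _ : ι => t / N) e with hS
    have e1 : ∑ e, t / N * (64 / c0 ^ 2 * avg (fun _ : ι => t / N) (fun g =>
        (totE (fun _ : ι => t / N) θ e (fun x => μ x * θ e x) g
          / totE (fun _ : ι => t / N) θ e μ g) ^ 2)) = t / N * (64 / c0 ^ 2 * S) := by
      rw [hS, mul_sum, mul_sum]; rfl
    rw [e1] at hv4
    rw [← sum_div, ← hS] at hv3
    refine le_trans ?_ hv3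
    have hS0 : 0 ≤ S := sum_nonneg fun e _ => infl_nonneg θ μ hb e
    rw [div_le_iff₀ (by positivity)] at hv4
    rw [hcdef, div_mul_eq_mul_div, div_le_div_iff₀ (by positivity) (by positivity)]
    have hv5 : t / N * (64 / c0 ^ 2 * S) * (2 * M) ≤ d1 / N * (64 / c0 ^ 2 * S) * (2 * M) := by
      have := ht.2
      gcongr
    have hv6 := mul_le_mul_of_nonneg_left (hv4.trans hv5) (show 0 ≤ c0 ^ 2 * (8 * N) by positivity)
    have e2 : c0 ^ 2 * (8 * N) * (d1 / N * (64 / c0 ^ 2 * S) * (2 * M)) = S * (1024 * M * d1) := by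
      field_simp; ring
    rw [e2] at hv6
    linarith
  have hmono2 : MonotoneOn (fun t => -(negLog θ μ N t - Real.log 4)⁻¹ - c * t) (Set.Icc d d1) := by
    have hder : ∀ t ∈ Set.Icc d d1, HasDerivAt (fun t => -(negLog θ μ N t - Real.log 4)⁻¹ - c * t)
        (-(-(deriv (negLog θ μ N) t) / (negLog θ μ N t - Real.log 4) ^ 2) - c * 1) t := by
      intro t ht
      exact ((((hdiff t ht).hasDerivAt.sub_const _).fun_inv (hy t ht).ne').fun_neg).fun_sub
        ((hasDerivAt_id t).const_mul c)
    refine monotoneOn_of_deriv_nonneg (convex_Icc d d1)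
      (fun t ht => (hder t ht).continuousAt.continuousWithinAt) ?_ ?_
    · rw [interior_Icc]
      exact fun t ht =>
        (hder t (Set.Ioo_subset_Icc_self ht)).differentiableAt.differentiableWithinAt
    · rw [interior_Icc]
      intro t ht
      have ht := Set.Ioo_subset_Icc_self ht
      rw [(hder t ht).deriv, neg_div, neg_neg, mul_one, sub_nonneg,
        le_div_iff₀ (pow_pos (hy t ht) 2)]
      exact hric t ht
  have hfin := hmono2 (Set.left_mem_Icc.2 hdd.le) (Set.right_mem_Icc.2 hdd.le) hdd.le
  simp only at hfin
  have hy1 := inv_pos.2 (hy d1 (Set.right_mem_Icc.2 hdd.le))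
  have hy0 := hy d (Set.left_mem_Icc.2 hdd.le)
  have h3 : c * (d1 - d) ≤ (negLog θ μ N d - Real.log 4)⁻¹ := by linarith
  have hcd : 0 < c * (d1 - d) := mul_pos hcpos (by linarith)
  have h4 := (le_inv_comm₀ hcd hy0).1 h3
  have h5 : (c * (d1 - d))⁻¹ = 1024 * M * d1 / (c0 ^ 2 * (d1 - d)) := by
    have : d1 - d ≠ 0 := by linarith
    rw [hcdef]; field_simp
  linarith

/-- A bound on the expected negative log-likelihood ratio makes small values unlikely. -/
lemma log_mul_prob_small_le {θ : ι → X → ℝ} {μ : X → ℝ} (hμ1 : ∑ x, μ x = 1) {p : ι → ℝ}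
    (hp : Box p) (hpos : ∀ g, 0 < tot p θ μ g) (δ : ℝ) :
    Real.log δ⁻¹ * avg p (fun g => if tot p θ μ g < δ then 1 else 0) ≤
      avg p (fun g => -Real.log (tot p θ μ g)) + 1 := by
  have h1 : avg p (tot p θ μ) = 1 := by rw [avg_tot p hp θ μ, hμ1]
  have h3 : avg p (fun g => Real.log δ⁻¹ * (if tot p θ μ g < δ then 1 else 0)) ≤
      avg p (fun g => -Real.log (tot p θ μ g) + tot p θ μ g) := by
    refine avg_mono hp fun g => ?_
    have h2 := Real.log_le_sub_one_of_pos (hpos g)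
    split_ifs with h
    · have := Real.log_le_log (hpos g) h.le
      rw [Real.log_inv]
      linarith [hpos g]
    · linarith
  rw [avg_mul, avg_add] at h3
  linarith

end Riccati

section Potts

/-- The centred equality kernel on colors. -/
def ker (q : ℕ) (i j : Fin q) : ℝ := q * (if i = j then 1 else 0) - 1

/-- Admissible second eigenvalue of the Potts channel. -/
def PottsPar (q : ℕ) (lam : ℝ) : Prop := 3 ≤ q ∧ lam < 0 ∧ 0 < 1 + lam * (q - 1)

/-- The relative change of the probability of the edge `e` given the coloring. -/
def tilt (q : ℕ) (lam : ℝ) (n : ℕ) (e : EdgeIdx n) (σ : Fin n → Fin q) : ℝ :=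
  lam * ker q (σ e.1.1) (σ e.1.2)

/-- The smallest edge likelihood ratio. -/
def minRatio (q : ℕ) (lam : ℝ) : ℝ := 1 + lam * (q - 1)

/-- Uniform weights on colorings. -/
noncomputable def unif (q n : ℕ) : (Fin n → Fin q) → ℝ := fun _ => ((q : ℝ) ^ n)⁻¹

/-- The likelihood ratio between the block model and the Erdős–Rényi graph. -/
noncomputable def LR (q : ℕ) (lam : ℝ) (n : ℕ) (p : ℝ) (g : GraphCfg n) : ℝ :=
  tot (fun _ => p) (tilt q lam n) (unif q n) g

lemma PottsPar.q_pos {q : ℕ} {lam : ℝ} (h : PottsPar q lam) : (3 : ℝ) ≤ q := by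
  exact_mod_cast h.1

lemma PottsPar.minRatio_pos {q : ℕ} {lam : ℝ} (h : PottsPar q lam) : 0 < minRatio q lam := h.2.2

lemma PottsPar.minRatio_le {q : ℕ} {lam : ℝ} (h : PottsPar q lam) : minRatio q lam ≤ 1 := by
  unfold minRatio
  nlinarith [h.q_pos, h.2.1]

lemma PottsPar.neg_half_lt {q : ℕ} {lam : ℝ} (h : PottsPar q lam) : -(1 / 2) < lam := by
  nlinarith [h.q_pos, h.2.1, h.2.2]

lemma lam_ker_bounds {q : ℕ} {lam : ℝ} (h : PottsPar q lam) (i j : Fin q) :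
    minRatio q lam - 1 ≤ lam * ker q i j ∧ lam * ker q i j ≤ 1 / 2 := by
  have h1 := h.q_pos
  have h2 := h.2.1
  have h3 := h.neg_half_lt
  unfold minRatio ker
  split_ifs <;> constructor <;> nlinarith

lemma tilt_tilt {q : ℕ} {lam : ℝ} (h : PottsPar q lam) (n : ℕ) :
    Tilt (minRatio q lam) (tilt q lam n) := fun _ _ => lam_ker_bounds h _ _

lemma unif_posWt {q : ℕ} (hq : 3 ≤ q) (n : ℕ) : PosWt (unif q n) := by
  have : 0 < q := by omega
  refine ⟨fun x => by unfold unif; positivity, fun _ => ⟨0, this⟩, by unfold unif; positivity⟩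

lemma unif_sum {q : ℕ} (hq : 3 ≤ q) (n : ℕ) : ∑ σ, unif q n σ = 1 := by
  have : (q : ℝ) ≠ 0 := by positivity
  simp [unif, this]

/-- The Potts parameter of the model. -/
noncomputable def pottsLam (q : ℕ) (β : ℝ) : ℝ :=
  -(1 - Real.exp (-β)) / ((q : ℝ) - 1 + Real.exp (-β))

lemma pottsPar_pottsLam {q : ℕ} (hq : 3 ≤ q) {β : ℝ} (hβ : 0 < β) :
    PottsPar q (pottsLam q β) := by
  have h1 : Real.exp (-β) < 1 := by rw [← Real.exp_zero]; exact Real.exp_lt_exp.2 (by linarith)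
  have h2 := Real.exp_pos (-β)
  have h3 : (3 : ℝ) ≤ q := by exact_mod_cast hq
  have h4 : 0 < (q : ℝ) - 1 + Real.exp (-β) := by linarith
  refine ⟨hq, div_neg_of_neg_of_pos (by linarith) h4, ?_⟩
  unfold pottsLam
  have : 1 + -(1 - Real.exp (-β)) / ((q : ℝ) - 1 + Real.exp (-β)) * (q - 1)
      = q * Real.exp (-β) / ((q : ℝ) - 1 + Real.exp (-β)) := by field_simp; ring
  rw [this]; positivity

lemma erProb_eq (n : ℕ) (pr : ℝ) (g : GraphCfg n) : erProb n pr g = bern (fun _ => pr) g := by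
  rfl

lemma sbmProb_eq {q : ℕ} (hq : 3 ≤ q) {β d : ℝ} {n : ℕ} (hn : 0 < n)
    (hp : d / n ≤ 1 / 2) (g : GraphCfg n) :
    sbmProb q β d n g = bern (fun _ => d / n) g * LR q (pottsLam q β) n (d / n) g := by
  have h2 := Real.exp_pos (-β)
  have h3 : (3 : ℝ) ≤ q := by exact_mod_cast hq
  have h4 : (q : ℝ) - 1 + Real.exp (-β) ≠ 0 := by linarith
  have hn' : (n : ℝ) ≠ 0 := by positivity
  have hp1 : 1 - d / (n : ℝ) ≠ 0 := by linarith
  unfold sbmProb LR tot unif bern lik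
  rw [← mul_sum, mul_left_comm]
  congr 1
  rw [mul_sum]
  refine sum_congr rfl fun σ _ => ?_
  rw [← prod_mul_distrib]
  refine prod_congr rfl fun e _ => ?_
  have A1 : d * q * Real.exp (-β) / (((q : ℝ) - 1 + Real.exp (-β)) * n)
      = d / n * (1 + pottsLam q β * (q * 1 - 1)) := by
    unfold pottsLam; field_simp; ring
  have A2 : d * q / (((q : ℝ) - 1 + Real.exp (-β)) * n)
      = d / n * (1 + pottsLam q β * (q * 0 - 1)) := by
    unfold pottsLam; field_simp; ring
  have A3 : ∀ t : ℝ, 1 - d / n * (1 + t) = (1 - d / n) * (1 - d / n * t / (1 - d / n)) := by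
    intro t
    rw [mul_sub, mul_one, mul_div_cancel₀ _ hp1]; ring
  rw [A1, A2]
  unfold bw lr tilt ker
  by_cases hg : g e = true <;> by_cases hs : σ e.1.1 = σ e.1.2 <;>
    simp [hg, hs, A3]

lemma box_div_nat {ι : Type*} {d : ℝ} {n : ℕ} (hd : 0 ≤ d) (h : d / n ≤ 1 / 2) :
    Box (fun _ : ι => d / (n : ℝ)) := fun _ => ⟨by positivity, h⟩

lemma eventually_div_nat_lt (d : ℝ) {c : ℝ} (hc : 0 < c) :
    ∀ᶠ n : ℕ in Filter.atTop, 0 < n ∧ d / (n : ℝ) < c := by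
  have h := (tendsto_const_div_atTop_nhds_zero_nat d).eventually_lt_const hc
  filter_upwards [h, Filter.eventually_gt_atTop 0] with n h1 h2 using ⟨h2, h1⟩

/-- Uniform integrability of the likelihood ratios at average degree `d`. -/
def UnifInt (q : ℕ) (lam d : ℝ) : Prop :=
  ∀ ε > 0, ∃ M > 0, ∀ᶠ n : ℕ in Filter.atTop,
    avg (fun _ => d / (n : ℝ)) (fun g => max (LR q lam n (d / n) g - M) 0) ≤ ε

lemma UnifInt.mono {q : ℕ} {lam d d1 : ℝ} (h : UnifInt q lam d1) (hd : 0 ≤ d) (hdd : d ≤ d1) :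
    UnifInt q lam d := by
  intro ε hε
  obtain ⟨M, hM, hev⟩ := h ε hε
  refine ⟨M, hM, ?_⟩
  filter_upwards [hev, eventually_div_nat_lt d1 (show (0 : ℝ) < 1 / 2 by norm_num)] with n h1 h2
  refine le_trans ?_ h1
  have hle : d / (n : ℝ) ≤ d1 / n := by gcongr
  exact avg_convex_mono₁ (convexOn_posPart M) _ _ (fun _ _ _ => Set.mem_univ _)
    (box_div_nat hd (hle.trans h2.2.le)) (box_div_nat (hd.trans hdd) h2.2.le) (fun _ => hle)

/-- Uniform integrability slightly above `d` implies mutual contiguity at `d`. -/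
theorem contiguous_of_unifInt {q : ℕ} (hq : 3 ≤ q) {β : ℝ} (hβ : 0 < β) {d d1 : ℝ} (hd0 : 0 < d)
    (hdd : d < d1) (hUI : UnifInt q (pottsLam q β) d1) (A : ∀ n : ℕ, Finset (GraphCfg n)) :
    Filter.Tendsto (fun n : ℕ => ∑ g ∈ A n, erProb n (d / n) g)
        Filter.atTop (nhds 0) ↔
      Filter.Tendsto (fun n : ℕ => ∑ g ∈ A n, sbmProb q β d n g)
        Filter.atTop (nhds 0) := by
  have hP := pottsPar_pottsLam hq hβ
  set lam := pottsLam q β with hlam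
  have hd1 : 0 < d1 := hd0.trans hdd
  have hbig := eventually_div_nat_lt d1 (show (0 : ℝ) < 1 / 2 by norm_num)
  have hsmall : ∀ᶠ n : ℕ in Filter.atTop, 0 < n ∧ d / (n : ℝ) < 1 / 2 :=
    eventually_div_nat_lt d (by norm_num)
  have hLpos : ∀ n : ℕ, d / (n : ℝ) < 1 / 2 → ∀ g, 0 < LR q lam n (d / n) g := fun n hn g =>
    tot_pos hP.minRatio_pos (box_div_nat hd0.le hn.le) (tilt_tilt hP n) (unif_posWt hq n) g
  constructor
  · intro h
    rw [Metric.tendsto_atTop] at h ⊢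
    intro ε hε
    obtain ⟨M, hM, hev⟩ := (hUI.mono hd0.le hdd.le) (ε / 2) (by positivity)
    obtain ⟨n1, hn1⟩ := h (ε / (2 * M)) (by positivity)
    obtain ⟨n2, hn2⟩ := Filter.eventually_atTop.1 (hev.and hsmall)
    refine ⟨max n1 n2, fun n hn => ?_⟩
    obtain ⟨hu, hn0, hnd⟩ := hn2 n (le_of_max_le_right hn)
    have hb : Box (fun _ : EdgeIdx n => d / (n : ℝ)) := box_div_nat hd0.le hnd.le
    have h1 := hn1 n (le_of_max_le_left hn)
    rw [Real.dist_eq, sub_zero] at h1 ⊢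
    simp only [sbmProb_eq hq hn0 hnd.le, erProb_eq] at h1 ⊢
    rw [abs_of_nonneg (sum_nonneg fun g _ => bern_nonneg hb g)] at h1
    rw [abs_of_nonneg (sum_nonneg fun g _ => mul_nonneg (bern_nonneg hb g) (hLpos n hnd g).le)]
    calc ∑ g ∈ A n, bern (fun _ => d / (n : ℝ)) g * LR q lam n (d / n) g
        ≤ ∑ g ∈ A n, (bern (fun _ => d / (n : ℝ)) g * M
            + bern (fun _ => d / (n : ℝ)) g * max (LR q lam n (d / n) g - M) 0) := by
          refine sum_le_sum fun g _ => ?_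
          rw [← mul_add]
          refine mul_le_mul_of_nonneg_left ?_ (bern_nonneg hb g)
          linarith [le_max_left (LR q lam n (d / n) g - M) 0]
      _ = (∑ g ∈ A n, bern (fun _ => d / (n : ℝ)) g) * M
            + ∑ g ∈ A n, bern (fun _ => d / (n : ℝ)) g * max (LR q lam n (d / n) g - M) 0 := by
          rw [sum_add_distrib, sum_mul]
      _ ≤ (∑ g ∈ A n, bern (fun _ => d / (n : ℝ)) g) * M
            + avg (fun _ => d / (n : ℝ)) (fun g => max (LR q lam n (d / n) g - M) 0) := by
          refine add_le_add le_rfl (sum_le_univ_sum_of_nonneg fun g => ?_)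
          exact mul_nonneg (bern_nonneg hb g) (le_max_right _ _)
      _ < ε / (2 * M) * M + ε / 2 := by
          refine add_lt_add_of_lt_of_le (mul_lt_mul_of_pos_right h1 hM) hu
      _ = ε := by field_simp; ring
  · intro h
    obtain ⟨M, hM, hev⟩ := hUI (1 / 4) (by norm_num)
    set K : ℝ := Real.log 4 + 1024 * M * d1 / (minRatio q lam ^ 2 * (d1 - d)) with hK
    have hK0 : 0 < K + 1 := by
      have h1 : 0 < d1 - d := by linarith
      have h2 := hP.minRatio_pos
      have h3 : 0 ≤ Real.log 4 := Real.log_nonneg (by norm_num)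
      positivity
    rw [Metric.tendsto_atTop] at h ⊢
    intro ε hε
    set δ : ℝ := Real.exp (-(4 * (K + 1) / ε)) with hδ
    have hδpos : 0 < δ := Real.exp_pos _
    obtain ⟨n1, hn1⟩ := h (ε / 2 * δ) (by positivity)
    obtain ⟨n2, hn2⟩ := Filter.eventually_atTop.1 (hev.and (hsmall.and hbig))
    refine ⟨max n1 n2, fun n hn => ?_⟩
    obtain ⟨hu, ⟨hn0, hnd⟩, -, hnd1⟩ := hn2 n (le_of_max_le_right hn)
    have hb : Box (fun _ : EdgeIdx n => d / (n : ℝ)) := box_div_nat hd0.le hnd.le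
    have h1 := hn1 n (le_of_max_le_left hn)
    rw [Real.dist_eq, sub_zero] at h1 ⊢
    simp only [sbmProb_eq hq hn0 hnd.le, erProb_eq] at h1 ⊢
    rw [abs_of_nonneg (sum_nonneg fun g _ => mul_nonneg (bern_nonneg hb g) (hLpos n hnd g).le)] at h1
    rw [abs_of_nonneg (sum_nonneg fun g _ => bern_nonneg hb g)]
    have hnl := negLog_bounded hP.minRatio_pos hP.minRatio_le (tilt_tilt hP n) (unif_posWt hq n)
      (unif_sum hq n) (N := n) (by positivity) hd0 hdd hnd1 hM hu
    have hsm := (log_mul_prob_small_le (unif_sum hq n) hb (hLpos n hnd) δ).trans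
      (add_le_add hnl le_rfl)
    rw [hδ, ← Real.exp_neg, Real.log_exp, neg_neg, ← hδ, ← hK] at hsm
    have hsm2 : avg (fun _ => d / (n : ℝ)) (fun g => if LR q lam n (d / n) g < δ then (1 : ℝ) else 0)
        ≤ ε / 4 := by
      have h5 : 4 * (K + 1) / ε * avg (fun _ => d / (n : ℝ))
        (fun g => if LR q lam n (d / n) g < δ then (1 : ℝ) else 0) ≤ K + 1 := hsm
      rw [div_mul_eq_mul_div, div_le_iff₀ hε] at h5
      nlinarith
    calc ∑ g ∈ A n, bern (fun _ => d / (n : ℝ)) g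
        ≤ ∑ g ∈ A n, (bern (fun _ => d / (n : ℝ)) g * LR q lam n (d / n) g * δ⁻¹
            + bern (fun _ => d / (n : ℝ)) g * (if LR q lam n (d / n) g < δ then 1 else 0)) := by
          refine sum_le_sum fun g _ => ?_
          rw [mul_assoc, ← mul_add]
          refine le_mul_of_one_le_right (bern_nonneg hb g) ?_
          have := hLpos n hnd g
          split_ifs with hlt
          · linarith [show 0 ≤ LR q lam n (d / n) g * δ⁻¹ by positivity]
          · rw [add_zero, ← div_eq_mul_inv, le_div_iff₀ hδpos]
            linarith [not_lt.1 hlt]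
      _ = (∑ g ∈ A n, bern (fun _ => d / (n : ℝ)) g * LR q lam n (d / n) g) * δ⁻¹
            + ∑ g ∈ A n, bern (fun _ => d / (n : ℝ)) g *
              (if LR q lam n (d / n) g < δ then 1 else 0) := by
          rw [sum_add_distrib, sum_mul]
      _ ≤ (∑ g ∈ A n, bern (fun _ => d / (n : ℝ)) g * LR q lam n (d / n) g) * δ⁻¹
            + avg (fun _ => d / (n : ℝ))
              (fun g => if LR q lam n (d / n) g < δ then (1 : ℝ) else 0) := by
          refine add_le_add le_rfl (sum_le_univ_sum_of_nonneg fun g => ?_)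
          exact mul_nonneg (bern_nonneg hb g) (by split_ifs <;> norm_num)
      _ < ε / 2 * δ * δ⁻¹ + ε / 4 := by
          refine add_lt_add_of_lt_of_le (mul_lt_mul_of_pos_right h1 (inv_pos.2 hδpos)) hsm2
      _ < ε := by rw [mul_assoc, mul_inv_cancel₀ hδpos.ne']; linarith

end Potts

section SecondMoment

variable {ι X : Type*} [Fintype ι] [DecidableEq ι] [Fintype X]

/-- The correlation of two likelihood ratios. -/
lemma avg_lik_mul_lik {p : ι → ℝ} (hp : Box p) (θ : ι → X → ℝ) (x y : X) :
    avg p (fun g => lik p θ g x * lik p θ g y) = ∏ e, (1 + p e / (1 - p e) * (θ e x * θ e y)) := by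
  unfold avg bern lik
  simp_rw [← prod_mul_distrib]
  rw [← Fintype.prod_sum (fun e b => bw (p e) b * (lr (p e) (θ e x) b * lr (p e) (θ e y) b))]
  refine prod_congr rfl fun e _ => ?_
  have h1 : (1 : ℝ) - p e ≠ 0 := by linarith [(hp e).2]
  simp [bw, lr]
  field_simp
  ring

lemma sum_edgeIdx {n : ℕ} (f : Fin n → Fin n → ℝ) (hf : ∀ u v, f u v = f v u) :
    ∑ u, ∑ v, f u v = 2 * ∑ e : EdgeIdx n, f e.1.1 e.1.2 + ∑ u, f u u := by
  have h1 : ∑ e : EdgeIdx n, f e.1.1 e.1.2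
      = ∑ z : Fin n × Fin n, if z.1 < z.2 then f z.1 z.2 else 0 := by
    rw [← sum_filter]
    exact (sum_subtype (univ.filter fun z : Fin n × Fin n => z.1 < z.2) (by simp)
      (fun z => f z.1 z.2)).symm
  have h2 : ∑ u, ∑ v, f u v = ∑ u : Fin n, ∑ v : Fin n, ((if u < v then f u v else 0)
      + (if v < u then f u v else 0) + if u = v then f u v else 0) := by
    refine sum_congr rfl fun u _ => sum_congr rfl fun v _ => ?_
    rcases lt_trichotomy u v with h | h | h
    · simp [h, h.not_gt, h.ne]
    · simp [h]
    · simp [h, h.not_gt, h.ne']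
  have h3 : ∑ u : Fin n, ∑ v : Fin n, (if v < u then f u v else 0)
      = ∑ u : Fin n, ∑ v : Fin n, if u < v then f u v else 0 := by
    rw [sum_comm]
    refine sum_congr rfl fun u _ => sum_congr rfl fun v _ => ?_
    rw [hf]
  rw [h2]
  simp_rw [sum_add_distrib]
  rw [h3, h1, Fintype.sum_prod_type]
  simp
  ring

variable {q : ℕ}

/-- Centred color indicators, normalised so that they diagonalise `ker`. -/
noncomputable def cind (q : ℕ) (i s : Fin q) : ℝ :=
  Real.sqrt q * ((if s = i then 1 else 0) - (q : ℝ)⁻¹)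

lemma ker_eq_sum_cind (hq : 0 < q) (s t : Fin q) : ker q s t = ∑ i, cind q i s * cind q i t := by
  have hq' : (q : ℝ) ≠ 0 := by positivity
  have h1 : ∀ i, cind q i s * cind q i t = q * (((if s = i then 1 else 0) * (if t = i then 1 else 0))
      - (q : ℝ)⁻¹ * (if s = i then 1 else 0) - (q : ℝ)⁻¹ * (if t = i then 1 else 0)
      + (q : ℝ)⁻¹ * (q : ℝ)⁻¹) := by
    intro i
    have := Real.mul_self_sqrt (show (0 : ℝ) ≤ q by positivity)
    unfold cind
    linear_combination (((if s = i then 1 else 0) - (q : ℝ)⁻¹) *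
      ((if t = i then 1 else 0) - (q : ℝ)⁻¹)) * this
  simp_rw [h1]
  rw [← mul_sum, sum_add_distrib, sum_sub_distrib, sum_sub_distrib, ← mul_sum, ← mul_sum]
  simp [ker]
  split_ifs <;> field_simp <;> simp_all

lemma sum_cind (hq : 0 < q) (i : Fin q) : ∑ s, cind q i s = 0 := by
  have hq' : (q : ℝ) ≠ 0 := by positivity
  unfold cind
  rw [← mul_sum, sum_sub_distrib]
  simp [mul_inv_cancel₀ hq']

lemma sum_sq_cind_le (hq : 0 < q) (b : Fin q → ℝ) :
    (q : ℝ)⁻¹ * ∑ s, (∑ i, b i * cind q i s) ^ 2 ≤ ∑ i, b i ^ 2 := by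
  have hq' : (q : ℝ) ≠ 0 := by positivity
  have h1 : ∀ s, (∑ i, b i * cind q i s) = Real.sqrt q * (b s - (q : ℝ)⁻¹ * ∑ i, b i) := by
    intro s
    unfold cind
    rw [mul_sub, mul_sum, mul_sum]
    have : ∀ i, b i * (Real.sqrt q * ((if s = i then 1 else 0) - (q : ℝ)⁻¹))
        = Real.sqrt q * (if s = i then b i else 0) - Real.sqrt q * ((q : ℝ)⁻¹ * b i) := by
      intro i; split_ifs <;> ring
    simp_rw [this]
    rw [sum_sub_distrib, ← mul_sum]
    simp
  have h2 : (q : ℝ)⁻¹ * ∑ s, (∑ i, b i * cind q i s) ^ 2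
      = ∑ s, (b s - (q : ℝ)⁻¹ * ∑ i, b i) ^ 2 := by
    rw [mul_sum]
    refine sum_congr rfl fun s _ => ?_
    rw [h1, mul_pow, Real.sq_sqrt (by positivity)]
    field_simp
  rw [h2]
  have h3 : ∑ s, (b s - (q : ℝ)⁻¹ * ∑ i, b i) ^ 2
      = ∑ s, b s ^ 2 - (q : ℝ)⁻¹ * (∑ i, b i) ^ 2 := by
    have : ∀ s, (b s - (q : ℝ)⁻¹ * ∑ i, b i) ^ 2
        = b s ^ 2 - 2 * ((q : ℝ)⁻¹ * ∑ i, b i) * b s + ((q : ℝ)⁻¹ * ∑ i, b i) ^ 2 := by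
      intro s; ring
    simp_rw [this]
    rw [sum_add_distrib, sum_sub_distrib, ← mul_sum]
    simp only [sum_const, card_univ, Fintype.card_fin, nsmul_eq_mul]
    field_simp
    ring
  rw [h3]
  have : 0 ≤ (q : ℝ)⁻¹ * (∑ i, b i) ^ 2 := by positivity
  linarith

/-- The linear form in the pair of colors of a vertex. -/
noncomputable def pairForm (q : ℕ) (a : Fin q × Fin q → ℝ) (s t : Fin q) : ℝ :=
  ∑ z : Fin q × Fin q, a z * (cind q z.1 s * cind q z.2 t)

lemma pairForm_sq_le (hq : 0 < q) (a : Fin q × Fin q → ℝ) (s t : Fin q) :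
    pairForm q a s t ^ 2 ≤ (∑ z, a z ^ 2) * (q : ℝ) ^ 2 := by
  unfold pairForm
  refine (sum_mul_sq_le_sq_mul_sq univ a _).trans ?_
  refine mul_le_mul_of_nonneg_left ?_ (sum_nonneg fun _ _ => sq_nonneg _)
  have h1 : ∑ z : Fin q × Fin q, (cind q z.1 s * cind q z.2 t) ^ 2 = ker q s s * ker q t t := by
    rw [ker_eq_sum_cind hq, ker_eq_sum_cind hq, sum_mul_sum, Fintype.sum_prod_type]
    exact sum_congr rfl fun _ _ => sum_congr rfl fun _ _ => by ring
  rw [h1]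
  have h2 : (1 : ℝ) ≤ q := by exact_mod_cast hq
  simp [ker]
  nlinarith

lemma sum_pairForm (hq : 0 < q) (a : Fin q × Fin q → ℝ) : ∑ s, ∑ t, pairForm q a s t = 0 := by
  unfold pairForm
  simp_rw [sum_comm (s := (univ : Finset (Fin q))) (t := (univ : Finset (Fin q × Fin q)))]
  refine sum_eq_zero fun z _ => ?_
  simp_rw [← mul_sum]
  simp [sum_cind hq]

lemma sum_pairForm_sq_le (hq : 0 < q) (a : Fin q × Fin q → ℝ) :
    ((q : ℝ) ^ 2)⁻¹ * ∑ s, ∑ t, pairForm q a s t ^ 2 ≤ ∑ z, a z ^ 2 := by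
  have h0 : ∀ s t, pairForm q a s t = ∑ i, (∑ j, a (i, j) * cind q j t) * cind q i s := by
    intro s t
    unfold pairForm
    rw [Fintype.sum_prod_type]
    refine sum_congr rfl fun i _ => ?_
    rw [sum_mul]
    exact sum_congr rfl fun j _ => by ring
  calc ((q : ℝ) ^ 2)⁻¹ * ∑ s, ∑ t, pairForm q a s t ^ 2
      = (q : ℝ)⁻¹ * ∑ t, ((q : ℝ)⁻¹ * ∑ s, (∑ i, (∑ j, a (i, j) * cind q j t) * cind q i s) ^ 2) := by
        rw [sum_comm, ← mul_sum, ← mul_assoc, ← mul_inv, ← sq]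
        simp_rw [h0]
    _ ≤ (q : ℝ)⁻¹ * ∑ t, ∑ i, (∑ j, a (i, j) * cind q j t) ^ 2 := by
        gcongr with t _
        exact sum_sq_cind_le hq _
    _ = ∑ i, (q : ℝ)⁻¹ * ∑ t, (∑ j, a (i, j) * cind q j t) ^ 2 := by
        rw [sum_comm, mul_sum]
    _ ≤ ∑ i, ∑ j, a (i, j) ^ 2 := by
        gcongr with i _
        exact sum_sq_cind_le hq _
    _ = ∑ z, a z ^ 2 := by rw [Fintype.sum_prod_type]

lemma exp_le_quadratic {y η : ℝ} (hη : 0 ≤ η) (hη1 : η ≤ 1) (hy : |y| ≤ η) :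
    Real.exp y ≤ 1 + y + (1 + 2 * η) / 2 * y ^ 2 := by
  have h := Real.abs_exp_sub_one_sub_id_le (x := y) (hy.trans hη1)
  have h3 := Real.exp_bound (x := y) (hy.trans hη1) (n := 3) (by norm_num)
  simp [sum_range_succ] at h3
  have h4 := (abs_le.1 h3).2
  have h5 : |y| ^ 3 ≤ η * y ^ 2 := by
    rw [pow_succ, sq_abs, mul_comm]
    exact mul_le_mul_of_nonneg_right hy (sq_nonneg _)
  norm_num [Nat.factorial] at h4
  nlinarith [sq_nonneg y]

/-- The single-vertex moment generating function is subgaussian. -/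
lemma mgf_pairForm_le (hq : 0 < q) {η : ℝ} (hη : 0 ≤ η) (hη1 : η ≤ 1) (a : Fin q × Fin q → ℝ)
    (ha : (∑ z, a z ^ 2) * (q : ℝ) ^ 2 ≤ η ^ 2) :
    ((q : ℝ) ^ 2)⁻¹ * ∑ s, ∑ t, Real.exp (pairForm q a s t)
      ≤ Real.exp ((1 + 2 * η) / 2 * ∑ z, a z ^ 2) := by
  have hq' : (q : ℝ) ≠ 0 := by positivity
  have hy : ∀ s t, |pairForm q a s t| ≤ η := fun s t =>
    abs_le_of_sq_le_sq ((pairForm_sq_le hq a s t).trans ha) hη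
  calc ((q : ℝ) ^ 2)⁻¹ * ∑ s, ∑ t, Real.exp (pairForm q a s t)
      ≤ ((q : ℝ) ^ 2)⁻¹ * ∑ s, ∑ t,
          (1 + pairForm q a s t + (1 + 2 * η) / 2 * pairForm q a s t ^ 2) := by
        gcongr with s _ t _
        exact exp_le_quadratic hη hη1 (hy s t)
    _ = 1 + (1 + 2 * η) / 2 * (((q : ℝ) ^ 2)⁻¹ * ∑ s, ∑ t, pairForm q a s t ^ 2) := by
        simp_rw [sum_add_distrib]
        rw [sum_pairForm hq]
        simp_rw [← mul_sum]
        simp only [sum_const, card_univ, Fintype.card_fin, nsmul_eq_mul]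
        field_simp
        ring
    _ ≤ 1 + (1 + 2 * η) / 2 * ∑ z, a z ^ 2 := by
        gcongr
        exact sum_pairForm_sq_le hq a
    _ ≤ _ := by rw [add_comm]; exact Real.add_one_le_exp _

/-- Linearisation of a Gaussian weight on an integer grid. -/
lemma exp_sq_le_grid {κ z : ℝ} (hκ : 0 < κ) (hκ1 : κ ≤ 1) {K : ℕ} (hK : |z| + 1 ≤ K) :
    Real.exp (κ * z ^ 2 / 2) ≤ Real.exp (1 / (8 * κ)) *
      ∑ j ∈ Finset.Icc (-K : ℤ) K, Real.exp (j * z - j ^ 2 / (2 * κ)) := by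
  set j := round (κ * z) with hj
  have h1 : |κ * z - j| ≤ 1 / 2 := abs_sub_round _
  have h2 := abs_le.1 h1
  have h3 : |κ * z| ≤ |z| := by
    rw [abs_mul, abs_of_pos hκ]; exact mul_le_of_le_one_left (abs_nonneg _) hκ1
  have h4 := abs_le.1 h3
  have hmem : j ∈ Finset.Icc (-K : ℤ) K := by
    rw [Finset.mem_Icc]
    constructor
    · have : (-(K : ℝ)) ≤ j := by linarith
      exact_mod_cast this
    · have : (j : ℝ) ≤ K := by linarith
      exact_mod_cast this
  have h5 := single_le_sum (f := fun j : ℤ => Real.exp (j * z - j ^ 2 / (2 * κ)))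
    (fun _ _ => (Real.exp_pos _).le) hmem
  refine le_trans ?_ (mul_le_mul_of_nonneg_left h5 (Real.exp_pos _).le)
  rw [← Real.exp_add, Real.exp_le_exp]
  have h6 : 1 / (8 * κ) + ((j : ℝ) * z - (j : ℝ) ^ 2 / (2 * κ)) - κ * z ^ 2 / 2
      = (1 / 4 - (κ * z - j) ^ 2) / (2 * κ) := by field_simp; ring
  have h7 : 0 ≤ (1 / 4 - (κ * z - j) ^ 2) / (2 * κ) := by
    refine div_nonneg ?_ (by positivity)
    nlinarith
  linarith

lemma exists_gaussian_sum_le {c : ℝ} (hc : 0 < c) :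
    ∃ B : ℝ, 0 < B ∧ ∀ K : ℕ, ∑ j ∈ Finset.Icc (-K : ℤ) K, Real.exp (-c * (j : ℝ) ^ 2) ≤ B := by
  have hs : Summable fun j : ℤ => Real.exp (-c * (j : ℝ) ^ 2) := by
    have hnat : Summable fun j : ℕ => Real.exp (-c * (j : ℝ)) := by
      have := Real.summable_exp_nat_mul_iff.2 (show -c < 0 by linarith)
      simpa [mul_comm] using this
    have hnat2 : Summable fun j : ℕ => Real.exp (-c * (j : ℝ) ^ 2) := by
      refine hnat.of_nonneg_of_le (fun _ => (Real.exp_pos _).le) fun j => ?_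
      rw [Real.exp_le_exp]
      have : (j : ℝ) ≤ (j : ℝ) ^ 2 := by exact_mod_cast Nat.le_self_pow (by norm_num) j
      nlinarith
    refine Summable.of_nat_of_neg ?_ ?_
    · simpa using hnat2
    · simpa using hnat2
  refine ⟨∑' j : ℤ, Real.exp (-c * (j : ℝ) ^ 2), ?_, fun K =>
    hs.sum_le_tsum _ fun _ _ => (Real.exp_pos _).le⟩
  exact hs.tsum_pos (fun _ => (Real.exp_pos _).le) 0 (Real.exp_pos _)

end SecondMoment

section TruncatedSecondMoment

variable {q n : ℕ}

/-- The unnormalised overlap of two colorings. -/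
def overlap (q n : ℕ) (σ τ : Fin n → Fin q) : ℝ :=
  ∑ u, ∑ v, ker q (σ u) (σ v) * ker q (τ u) (τ v)

/-- The entries of the centred overlap matrix. -/
noncomputable def ovMat (σ τ : Fin n → Fin q) (z : Fin q × Fin q) : ℝ :=
  ∑ v, cind q z.1 (σ v) * cind q z.2 (τ v)

lemma overlap_eq (hq : 0 < q) (σ τ : Fin n → Fin q) : overlap q n σ τ = ∑ z, ovMat σ τ z ^ 2 := by
  unfold overlap ovMat
  simp_rw [sq, sum_mul_sum, ker_eq_sum_cind hq, Fintype.sum_prod_type, sum_mul_sum]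
  rw [sum_comm' (s := univ) (t := fun _ => univ) (s' := fun _ => univ) (t' := univ) (by simp)]
  have h1 : ∀ F : Fin q → Fin q → Fin n → Fin n → ℝ,
      ∑ v, ∑ u, ∑ i, ∑ j, F i j u v = ∑ i, ∑ j, ∑ u, ∑ v, F i j u v := by
    intro F
    calc ∑ v, ∑ u, ∑ i, ∑ j, F i j u v = ∑ v, ∑ i, ∑ j, ∑ u, F i j u v := by
          refine sum_congr rfl fun v _ => ?_
          rw [sum_comm]; exact sum_congr rfl fun i _ => sum_comm
      _ = ∑ i, ∑ j, ∑ v, ∑ u, F i j u v := by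
          rw [sum_comm]; exact sum_congr rfl fun i _ => sum_comm
      _ = _ := sum_congr rfl fun i _ => sum_congr rfl fun j _ => sum_comm
  rw [h1 (fun i j u v => cind q i (σ u) * cind q i (σ v) * (cind q j (τ u) * cind q j (τ v)))]
  exact sum_congr rfl fun i _ => sum_congr rfl fun j _ => sum_congr rfl fun u _ =>
    sum_congr rfl fun v _ => by ring

lemma ker_symm (i j : Fin q) : ker q i j = ker q j i := by
  unfold ker; simp only [eq_comm]

lemma abs_tilt_le {lam : ℝ} (hP : PottsPar q lam) (i j : Fin q) : |lam * ker q i j| ≤ 1 := by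
  have := lam_ker_bounds hP i j
  rw [abs_le]; constructor <;> linarith [hP.minRatio_pos]

lemma pair_second_moment_le {lam : ℝ} (hP : PottsPar q lam) {p : ℝ} (hp0 : 0 ≤ p) (hp : p ≤ 1 / 2)
    (σ τ : Fin n → Fin q) :
    avg (fun _ : EdgeIdx n => p) (fun g => lik (fun _ => p) (tilt q lam n) g σ
        * lik (fun _ => p) (tilt q lam n) g τ)
      ≤ Real.exp (p * lam ^ 2 / (1 - p) * overlap q n σ τ / 2) := by
  have h1p : 0 < 1 - p := by linarith
  rw [avg_lik_mul_lik (box_const hp0 hp)]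
  calc ∏ e : EdgeIdx n, (1 + p / (1 - p) * (tilt q lam n e σ * tilt q lam n e τ))
      ≤ ∏ e : EdgeIdx n, Real.exp (p / (1 - p) * (tilt q lam n e σ * tilt q lam n e τ)) := by
        refine prod_le_prod (fun e _ => ?_) fun e _ => by
          rw [add_comm]; exact Real.add_one_le_exp _
        have h1 : |p / (1 - p) * (tilt q lam n e σ * tilt q lam n e τ)| ≤ 1 := by
          rw [abs_mul, abs_mul, abs_of_nonneg (by positivity)]
          have h2 : p / (1 - p) ≤ 1 := by rw [div_le_one h1p]; linarith
          exact mul_le_one₀ h2 (by positivity)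
            (mul_le_one₀ (abs_tilt_le hP _ _) (abs_nonneg _) (abs_tilt_le hP _ _))
        linarith [(abs_le.1 h1).1]
    _ = Real.exp (p * lam ^ 2 / (1 - p) *
          ∑ e : EdgeIdx n, ker q (σ e.1.1) (σ e.1.2) * ker q (τ e.1.1) (τ e.1.2)) := by
        rw [← Real.exp_sum, mul_sum]
        congr 1
        refine sum_congr rfl fun e _ => ?_
        unfold tilt; ring
    _ ≤ _ := by
        rw [Real.exp_le_exp, mul_div_assoc _ (overlap q n σ τ)]
        refine mul_le_mul_of_nonneg_left ?_ (show 0 ≤ p * lam ^ 2 / (1 - p) by positivity)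
        have h3 := sum_edgeIdx (fun u v => ker q (σ u) (σ v) * ker q (τ u) (τ v))
          (fun u v => by rw [ker_symm (σ u), ker_symm (τ u)])
        have h4 : 0 ≤ ∑ u, ker q (σ u) (σ u) * ker q (τ u) (τ u) :=
          sum_nonneg fun u _ => by
            have := hP.q_pos
            simp only [ker, if_true]; nlinarith
        unfold overlap
        linarith

/-- The exponential moments of the overlap matrix factorise over the vertices. -/
lemma sum_exp_ovMat (a : Fin q × Fin q → ℝ) :
    ∑ σ : Fin n → Fin q, ∑ τ : Fin n → Fin q, Real.exp (∑ z, a z * ovMat σ τ z)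
      = (∑ s, ∑ t, Real.exp (pairForm q a s t)) ^ n := by
  have h1 : ∀ σ τ : Fin n → Fin q, Real.exp (∑ z, a z * ovMat σ τ z)
      = ∏ v, Real.exp (pairForm q a (σ v) (τ v)) := by
    intro σ τ
    rw [← Real.exp_sum]
    congr 1
    unfold ovMat pairForm
    simp_rw [mul_sum]
    exact sum_comm
  simp_rw [h1]
  rw [← Fintype.sum_prod_type' (f := fun σ τ : Fin n → Fin q =>
    ∏ v, Real.exp (pairForm q a (σ v) (τ v))),
    ← Fintype.sum_prod_type' (f := fun s t => Real.exp (pairForm q a s t))]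
  have h2 := Fintype.sum_pow (fun z : Fin q × Fin q => Real.exp (pairForm q a z.1 z.2)) n
  rw [h2]
  exact (Fintype.sum_equiv (Equiv.arrowProdEquivProdArrow (Fin n) (fun _ => Fin q) (fun _ => Fin q))
    _ _ (fun f => rfl)).symm

lemma truncated_exp_le (hq : 0 < q) {κ η c : ℝ} (hκ : 0 < κ) (hκ1 : κ ≤ 1) (hη : 0 ≤ η)
    (hη1 : η ≤ 1) (hc : c ≤ 1 / (2 * κ) - (1 + 2 * η) / 2) {K : ℕ} (hn : 0 < n)
    (hK : (q : ℝ) ^ 4 * K ^ 2 ≤ η ^ 2 * n) {r : ℝ} (hr : Real.sqrt (r / n) + 1 ≤ K)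
    {B : ℝ} (hB : ∑ j ∈ Finset.Icc (-K : ℤ) K, Real.exp (-c * (j : ℝ) ^ 2) ≤ B) :
    ((q : ℝ) ^ (2 * n))⁻¹ * ∑ σ : Fin n → Fin q, ∑ τ : Fin n → Fin q,
        (if overlap q n σ τ ≤ r then Real.exp (κ / n * overlap q n σ τ / 2) else 0)
      ≤ (Real.exp (1 / (8 * κ)) * B) ^ (q ^ 2) := by
  classical
  have hn' : (0 : ℝ) < n := by exact_mod_cast hn
  have hsn : 0 < Real.sqrt n := Real.sqrt_pos.2 hn'
  set J := Finset.Icc (-K : ℤ) K with hJ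
  set P : Finset (Fin q × Fin q → ℤ) := Fintype.piFinset fun _ => J with hPdef
  set E := Real.exp (1 / (8 * κ)) with hE
  have hpt : ∀ σ τ : Fin n → Fin q,
      (if overlap q n σ τ ≤ r then Real.exp (κ / n * overlap q n σ τ / 2) else 0)
      ≤ ∑ j ∈ P, E ^ (q ^ 2) * (Real.exp (-(∑ z, (j z : ℝ) ^ 2) / (2 * κ)) *
          Real.exp (∑ z, ((j z : ℝ) / Real.sqrt n) * ovMat σ τ z)) := by
    intro σ τ
    split_ifs with h
    · have hz : ∀ z, |ovMat σ τ z / Real.sqrt n| + 1 ≤ K := by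
        intro z
        refine le_trans (add_le_add (Real.abs_le_sqrt ?_) le_rfl) hr
        rw [div_pow, Real.sq_sqrt hn'.le]
        gcongr
        rw [overlap_eq hq] at h
        exact le_trans (single_le_sum (f := fun z => ovMat σ τ z ^ 2) (fun _ _ => sq_nonneg _)
          (mem_univ z)) h
      have h1 : Real.exp (κ / n * overlap q n σ τ / 2)
          = ∏ z, Real.exp (κ * (ovMat σ τ z / Real.sqrt n) ^ 2 / 2) := by
        rw [← Real.exp_sum, overlap_eq hq, mul_sum, sum_div]
        congr 1
        refine sum_congr rfl fun z _ => ?_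
        rw [div_pow, Real.sq_sqrt hn'.le]; ring
      rw [h1]
      refine (prod_le_prod (fun _ _ => (Real.exp_pos _).le) fun z _ =>
        exp_sq_le_grid hκ hκ1 (hz z)).trans (le_of_eq ?_)
      rw [prod_mul_distrib, prod_univ_sum, mul_sum]
      refine sum_congr rfl fun j _ => ?_
      congr 1
      · rw [prod_const, ← hE]; simp [sq]
      · rw [← Real.exp_sum, ← Real.exp_add]
        congr 1
        rw [neg_div, sum_div, ← sub_eq_neg_add, ← sum_sub_distrib]
        refine sum_congr rfl fun z _ => ?_
        ring
    · exact sum_nonneg fun j _ => by positivity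
  calc ((q : ℝ) ^ (2 * n))⁻¹ * ∑ σ : Fin n → Fin q, ∑ τ : Fin n → Fin q,
        (if overlap q n σ τ ≤ r then Real.exp (κ / n * overlap q n σ τ / 2) else 0)
      ≤ ((q : ℝ) ^ (2 * n))⁻¹ * ∑ σ : Fin n → Fin q, ∑ τ : Fin n → Fin q,
        ∑ j ∈ P, E ^ (q ^ 2) * (Real.exp (-(∑ z, (j z : ℝ) ^ 2) / (2 * κ)) *
          Real.exp (∑ z, ((j z : ℝ) / Real.sqrt n) * ovMat σ τ z)) := by
        gcongr with σ _ τ _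
        exact hpt σ τ
    _ = ∑ j ∈ P, E ^ (q ^ 2) * (Real.exp (-(∑ z, (j z : ℝ) ^ 2) / (2 * κ)) *
          (((q : ℝ) ^ 2)⁻¹ * ∑ s, ∑ t,
            Real.exp (pairForm q (fun z => (j z : ℝ) / Real.sqrt n) s t)) ^ n) := by
        simp_rw [sum_comm (s := (univ : Finset (Fin n → Fin q))) (t := P)]
        rw [mul_sum]
        refine sum_congr rfl fun j _ => ?_
        simp_rw [← mul_sum]
        rw [sum_exp_ovMat, mul_pow, pow_mul, inv_pow]
        ring
    _ ≤ ∑ j ∈ P, E ^ (q ^ 2) * ∏ z, Real.exp (-c * (j z : ℝ) ^ 2) := by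
        refine sum_le_sum fun j hj => ?_
        refine mul_le_mul_of_nonneg_left ?_ (by positivity)
        have hsum : ∑ z, ((j z : ℝ) / Real.sqrt n) ^ 2 = (∑ z, (j z : ℝ) ^ 2) / n := by
          rw [sum_div]
          refine sum_congr rfl fun z _ => ?_
          rw [div_pow, Real.sq_sqrt hn'.le]
        have hjK : ∑ z, (j z : ℝ) ^ 2 ≤ (q : ℝ) ^ 2 * K ^ 2 := by
          have : ∀ z, (j z : ℝ) ^ 2 ≤ (K : ℝ) ^ 2 := by
            intro z
            have h1 := Finset.mem_Icc.1 (Fintype.mem_piFinset.1 hj z)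
            have h2 : (-(K : ℝ)) ≤ j z := by exact_mod_cast h1.1
            have h3 : (j z : ℝ) ≤ K := by exact_mod_cast h1.2
            nlinarith
          refine (sum_le_sum fun z _ => this z).trans (le_of_eq ?_)
          rw [sum_const, nsmul_eq_mul]; simp [sq]
        have hmgf := mgf_pairForm_le hq hη hη1 (fun z => (j z : ℝ) / Real.sqrt n) (by
          rw [hsum, div_mul_eq_mul_div, div_le_iff₀ hn']
          refine le_trans ?_ hK
          have : 0 ≤ (q : ℝ) ^ 2 := by positivity
          nlinarith)
        rw [hsum] at hmgf
        have hpow := pow_le_pow_left₀ (by positivity) hmgf n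
        refine (mul_le_mul_of_nonneg_left hpow (Real.exp_pos _).le).trans ?_
        rw [← Real.exp_nat_mul, ← Real.exp_add, ← Real.exp_sum, Real.exp_le_exp, ← mul_sum]
        have e1 : (n : ℝ) * ((1 + 2 * η) / 2 * ((∑ z, (j z : ℝ) ^ 2) / n))
            = (1 + 2 * η) / 2 * ∑ z, (j z : ℝ) ^ 2 := by field_simp
        rw [e1]
        have e2 : 0 ≤ ∑ z, (j z : ℝ) ^ 2 := sum_nonneg fun _ _ => sq_nonneg _
        have e3 := mul_le_mul_of_nonneg_right hc e2
        have e4 : -(∑ z, (j z : ℝ) ^ 2) / (2 * κ) = -(1 / (2 * κ) * ∑ z, (j z : ℝ) ^ 2) := by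
          ring
        rw [e4]
        linarith
    _ = E ^ (q ^ 2) * (∑ j ∈ J, Real.exp (-c * (j : ℝ) ^ 2)) ^ (q ^ 2) := by
        rw [← mul_sum, hPdef,
          ← prod_univ_sum (fun _ : Fin q × Fin q => J) (fun _ j => Real.exp (-c * (j : ℝ) ^ 2))]
        simp [sq]
    _ ≤ E ^ (q ^ 2) * B ^ (q ^ 2) := by
        gcongr
    _ = _ := by rw [mul_pow]

/-- The average squared pair correlation under the block model. -/
noncomputable def pairCorr (q : ℕ) (lam : ℝ) (n : ℕ) (p : ℝ) (u v : Fin n) : ℝ :=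
  avg (fun _ : EdgeIdx n => p) (fun g =>
    (tot (fun _ => p) (tilt q lam n) (fun σ => unif q n σ * ker q (σ u) (σ v)) g) ^ 2
      / LR q lam n p g)

/-- Vanishing of the average squared pair correlation. -/
def CorrVanish (q : ℕ) (lam d : ℝ) : Prop :=
  Filter.Tendsto (fun n : ℕ => (∑ u, ∑ v, pairCorr q lam n (d / n) u v) / (n : ℝ) ^ 2)
    Filter.atTop (nhds 0)

lemma sum_lik_lik_overlap (w : (Fin n → Fin q) → ℝ) (f : (Fin n → Fin q) → ℝ) :
    ∑ σ, ∑ τ, w σ * f σ * (w τ * f τ) * overlap q n σ τ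
      = ∑ u, ∑ v, (∑ σ, w σ * ker q (σ u) (σ v) * f σ) ^ 2 := by
  unfold overlap
  have h1 : ∀ u v, (∑ σ, w σ * ker q (σ u) (σ v) * f σ) ^ 2
      = ∑ σ, ∑ τ, w σ * f σ * (w τ * f τ) * (ker q (σ u) (σ v) * ker q (τ u) (τ v)) := by
    intro u v
    rw [sq, sum_mul_sum]
    exact sum_congr rfl fun _ _ => sum_congr rfl fun _ _ => by ring
  simp_rw [h1, mul_sum]
  calc ∑ σ, ∑ τ, ∑ u, ∑ v, w σ * f σ * (w τ * f τ) * (ker q (σ u) (σ v) * ker q (τ u) (τ v))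
      = ∑ σ, ∑ u, ∑ v, ∑ τ, w σ * f σ * (w τ * f τ) * (ker q (σ u) (σ v) * ker q (τ u) (τ v)) := by
        refine sum_congr rfl fun σ _ => ?_
        rw [sum_comm]; exact sum_congr rfl fun _ _ => sum_comm
    _ = _ := by
        rw [sum_comm]; exact sum_congr rfl fun _ _ => sum_comm

/-- Vanishing pair correlations below the Kesten–Stigum bound imply uniform integrability. -/
theorem unifInt_of_corrVanish {lam d : ℝ} (hP : PottsPar q lam) (hd : 0 < d)
    (hKS : d * lam ^ 2 < 1) (hcorr : CorrVanish q lam d) : UnifInt q lam d := by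
  classical
  have hq : 0 < q := by have := hP.1; omega
  have hq3 := hP.q_pos
  have hlam : 0 < lam ^ 2 := by have := hP.2.1; exact sq_pos_of_neg this
  set κ : ℝ := (1 + d * lam ^ 2) / 2 with hκdef
  have hκ0 : 0 < κ := by positivity
  have hκ1 : κ < 1 := by rw [hκdef]; linarith
  have hdκ : d * lam ^ 2 < κ := by rw [hκdef]; linarith
  set η : ℝ := (1 - κ) / 4 with hηdef
  have hη0 : 0 < η := by rw [hηdef]; linarith
  have hη1 : η ≤ 1 := by rw [hηdef]; linarith
  set c : ℝ := 1 / (2 * κ) - (1 + 2 * η) / 2 with hcdef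
  have hc : 0 < c := by
    have h1 : (1 + 2 * η) / 2 * (2 * κ) < 1 := by
      rw [hηdef]; nlinarith
    have h2 : (1 + 2 * η) / 2 < 1 / (2 * κ) := by rw [lt_div_iff₀ (by positivity)]; exact h1
    linarith
  obtain ⟨B, hB0, hB⟩ := exists_gaussian_sum_le hc
  set C : ℝ := (Real.exp (1 / (8 * κ)) * B) ^ (q ^ 2) with hC
  have hCpos : 0 < C := by positivity
  set ε0 : ℝ := η / (2 * q ^ 2) with hε0
  have hε0pos : 0 < ε0 := by positivity
  intro ε hε
  refine ⟨4 * C / ε, by positivity, ?_⟩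
  have hcv := hcorr.eventually_lt_const (show (0 : ℝ) < ε * ε0 ^ 2 / 4 by positivity)
  have hn1 := eventually_div_nat_lt d (show (0 : ℝ) < 1 / 2 by norm_num)
  have hn2 := eventually_div_nat_lt d (show (0 : ℝ) < 1 - d * lam ^ 2 / κ by
    rw [sub_pos, div_lt_one hκ0]; exact hdκ)
  have hn3 : ∀ᶠ n : ℕ in Filter.atTop, 2 ≤ ε0 * Real.sqrt n := by
    have : Filter.Tendsto (fun n : ℕ => ε0 * Real.sqrt n) Filter.atTop Filter.atTop :=
      Filter.Tendsto.const_mul_atTop hε0pos (Real.tendsto_sqrt_atTop.comp tendsto_natCast_atTop_atTop)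
    exact this.eventually_ge_atTop 2
  filter_upwards [hcv, hn1, hn2, hn3] with n hcv hn1 hn2 hn3
  obtain ⟨hn0, hp⟩ := hn1
  have hn' : (0 : ℝ) < n := by exact_mod_cast hn0
  set p : ℝ := d / n with hpdef
  have hp0 : 0 < p := by positivity
  have hb : Box (fun _ : EdgeIdx n => p) := box_const hp0.le hp.le
  have hlikpos : ∀ g σ, 0 < lik (fun _ => p) (tilt q lam n) g σ := fun g σ =>
    lik_pos hP.minRatio_pos hb (tilt_tilt hP n) g σ
  have hLpos : ∀ g, 0 < LR q lam n p g := fun g =>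
    tot_pos hP.minRatio_pos hb (tilt_tilt hP n) (unif_posWt hP.1 n) g
  set r : ℝ := (ε0 * n) ^ 2 with hr
  have hrpos : 0 < r := by positivity
  set Wt : GraphCfg n → (Fin n → Fin q) → (Fin n → Fin q) → ℝ := fun g σ τ =>
    unif q n σ * lik (fun _ => p) (tilt q lam n) g σ *
      (unif q n τ * lik (fun _ => p) (tilt q lam n) g τ) with hWt
  have hunif : ∀ σ : Fin n → Fin q, 0 < unif q n σ := fun σ => by unfold unif; positivity
  have hWpos : ∀ g σ τ, 0 ≤ Wt g σ τ := fun g σ τ =>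
    mul_nonneg (mul_nonneg (hunif σ).le (hlikpos g σ).le) (mul_nonneg (hunif τ).le (hlikpos g τ).le)
  set A : GraphCfg n → ℝ := fun g => ∑ σ, ∑ τ, Wt g σ τ * (if overlap q n σ τ ≤ r then 1 else 0) with hA
  set Bd : GraphCfg n → ℝ := fun g => ∑ σ, ∑ τ, Wt g σ τ * (if overlap q n σ τ ≤ r then 0 else 1) with hBd
  have hAB : ∀ g, LR q lam n p g ^ 2 = A g + Bd g := by
    intro g
    simp only [hA, hBd, ← sum_add_distrib]
    unfold LR tot
    rw [sq, sum_mul_sum]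
    refine sum_congr rfl fun σ _ => sum_congr rfl fun τ _ => ?_
    simp only [hWt]
    split_ifs <;> ring
  have hA0 : ∀ g, 0 ≤ A g := fun g => sum_nonneg fun σ _ => sum_nonneg fun τ _ =>
    mul_nonneg (hWpos g σ τ) (by split_ifs <;> norm_num)
  have hBd0 : ∀ g, 0 ≤ Bd g := fun g => sum_nonneg fun σ _ => sum_nonneg fun τ _ =>
    mul_nonneg (hWpos g σ τ) (by split_ifs <;> norm_num)
  have hBle : ∀ g, Bd g ≤ r⁻¹ * ∑ u, ∑ v,
      (tot (fun _ => p) (tilt q lam n) (fun σ => unif q n σ * ker q (σ u) (σ v)) g) ^ 2 := by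
    intro g
    have h1 := sum_lik_lik_overlap (unif q n) (lik (fun _ => p) (tilt q lam n) g)
    unfold tot
    rw [← h1, mul_sum]
    refine sum_le_sum fun σ _ => ?_
    rw [mul_sum]
    refine sum_le_sum fun τ _ => ?_
    change Wt g σ τ * _ ≤ r⁻¹ * (Wt g σ τ * _)
    rw [mul_left_comm]
    refine mul_le_mul_of_nonneg_left ?_ (hWpos g σ τ)
    split_ifs with h
    · refine mul_nonneg (by positivity) ?_
      rw [overlap_eq hq]; exact sum_nonneg fun _ _ => sq_nonneg _
    · rw [← div_eq_inv_mul, one_le_div hrpos]; exact (not_le.1 h).le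
  have hptw : ∀ g, max (LR q lam n p g - 4 * C / ε) 0
      ≤ 2 * r⁻¹ * (∑ u, ∑ v, (tot (fun _ => p) (tilt q lam n)
          (fun σ => unif q n σ * ker q (σ u) (σ v)) g) ^ 2 / LR q lam n p g) + ε / (2 * C) * A g := by
    intro g
    have hL := hLpos g
    have h1 : 2 * (Bd g / LR q lam n p g) ≤ 2 * r⁻¹ * (∑ u, ∑ v, (tot (fun _ => p) (tilt q lam n)
          (fun σ => unif q n σ * ker q (σ u) (σ v)) g) ^ 2 / LR q lam n p g) := by
      rw [mul_assoc]
      refine mul_le_mul_of_nonneg_left ?_ (by norm_num)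
      simp_rw [← sum_div]
      rw [← mul_div_assoc]
      gcongr
      exact hBle g
    have hx : 0 ≤ Bd g / LR q lam n p g := div_nonneg (hBd0 g) hL.le
    have hy : 0 ≤ ε / (2 * C) * A g := mul_nonneg (by positivity) (hA0 g)
    refine max_le ?_ (by linarith)
    refine le_trans ?_ (add_le_add h1 le_rfl)
    rcases le_or_gt (LR q lam n p g ^ 2 / 2) (Bd g) with h | h
    · have : LR q lam n p g / 2 ≤ Bd g / LR q lam n p g := by
        rw [le_div_iff₀ hL]; linarith [sq (LR q lam n p g)]
      have : 0 < 4 * C / ε := by positivity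
      linarith
    · have h2 : LR q lam n p g ^ 2 ≤ 2 * A g := by linarith [hAB g]
      have h3 : LR q lam n p g - 4 * C / ε ≤ ε / (4 * C) * LR q lam n p g ^ 2 := by
        have : 0 ≤ ε / (4 * C) * (LR q lam n p g - 4 * C / ε / 2) ^ 2 := by positivity
        have e1 : ε / (4 * C) * (LR q lam n p g - 4 * C / ε / 2) ^ 2
            = ε / (4 * C) * LR q lam n p g ^ 2 - LR q lam n p g + C / ε := by
          field_simp; ring
        have : 0 < C / ε := by positivity
        have e2 : 4 * C / ε = 4 * (C / ε) := by ring
        rw [e2]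
        linarith
      have h4 : ε / (4 * C) * LR q lam n p g ^ 2 ≤ ε / (4 * C) * (2 * A g) :=
        mul_le_mul_of_nonneg_left h2 (by positivity)
      have h5 : ε / (4 * C) * (2 * A g) = ε / (2 * C) * A g := by field_simp; ring
      linarith
  have hAavg : avg (fun _ => p) A ≤ C := by
    have h1 : avg (fun _ => p) A = ∑ σ : Fin n → Fin q, ∑ τ : Fin n → Fin q,
        ((q : ℝ) ^ (2 * n))⁻¹ * ((if overlap q n σ τ ≤ r then 1 else 0) *
        avg (fun _ : EdgeIdx n => p) (fun g => lik (fun _ => p) (tilt q lam n) g σ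
        * lik (fun _ => p) (tilt q lam n) g τ)) := by
      simp only [hA]
      rw [avg_sum]
      refine sum_congr rfl fun σ _ => ?_
      rw [avg_sum]
      refine sum_congr rfl fun τ _ => ?_
      rw [← avg_mul, ← avg_mul]
      congr 1
      ext g
      simp only [hWt, unif]
      rw [two_mul, pow_add, mul_inv]
      ring
    rw [h1]
    simp_rw [← mul_sum]
    obtain ⟨K, hK1, hK2⟩ : ∃ K : ℕ, ε0 * Real.sqrt n + 1 ≤ K ∧ (K : ℝ) ≤ 2 * (ε0 * Real.sqrt n) := by
      refine ⟨⌊2 * (ε0 * Real.sqrt n)⌋₊, ?_, Nat.floor_le (by positivity)⟩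
      linarith [(Nat.lt_floor_add_one (2 * (ε0 * Real.sqrt n))).le]
    refine le_trans ?_ (truncated_exp_le hq (n := n) hκ0 hκ1.le hη0.le hη1 hcdef.le (K := K) hn0
      ?_ (r := r) ?_ (hB K))
    · gcongr with σ _ τ _
      split_ifs with h
      · rw [one_mul]
        refine (pair_second_moment_le hP hp0.le hp.le σ τ).trans ?_
        rw [Real.exp_le_exp]
        have h5 : 0 ≤ overlap q n σ τ := by
          rw [overlap_eq hq]; exact sum_nonneg fun _ _ => sq_nonneg _
        have h6 : p * lam ^ 2 / (1 - p) ≤ κ / n := by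
          have h7 : d * lam ^ 2 / κ < 1 - p := by linarith [hn2.2]
          rw [div_lt_iff₀ hκ0] at h7
          have h8 : 0 < 1 - p := by linarith
          rw [div_le_div_iff₀ h8 hn']
          have : p * n = d := by rw [hpdef]; field_simp
          nlinarith
        gcongr
      · simp
    · have h5 : (K : ℝ) ^ 2 ≤ (2 * (ε0 * Real.sqrt n)) ^ 2 := by gcongr
      have h6 : (2 * (ε0 * Real.sqrt n)) ^ 2 = 4 * ε0 ^ 2 * n := by
        rw [mul_pow, mul_pow, Real.sq_sqrt hn'.le]; ring
      calc (q : ℝ) ^ 4 * K ^ 2 ≤ (q : ℝ) ^ 4 * (4 * ε0 ^ 2 * n) := by rw [← h6]; gcongr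
        _ = η ^ 2 * n := by rw [hε0]; field_simp; norm_num
    · refine le_trans (le_of_eq ?_) hK1
      rw [hr]
      have : (ε0 * (n : ℝ)) ^ 2 / n = (ε0 * Real.sqrt n) ^ 2 := by
        rw [mul_pow, mul_pow, Real.sq_sqrt hn'.le]; field_simp
      rw [this, Real.sqrt_sq (by positivity)]
  refine (avg_mono hb hptw).trans ?_
  rw [avg_add, avg_mul, avg_mul, avg_sum]
  simp_rw [avg_sum]
  change 2 * r⁻¹ * ∑ u, ∑ v, pairCorr q lam n p u v + _ ≤ ε
  have h8 : 2 * r⁻¹ * ∑ u, ∑ v, pairCorr q lam n p u v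
      = 2 / ε0 ^ 2 * ((∑ u, ∑ v, pairCorr q lam n p u v) / (n : ℝ) ^ 2) := by
    rw [hr]; field_simp
  have h9 : 2 / ε0 ^ 2 * ((∑ u, ∑ v, pairCorr q lam n p u v) / (n : ℝ) ^ 2) ≤ ε / 2 := by
    have := mul_le_mul_of_nonneg_left hcv.le (show 0 ≤ 2 / ε0 ^ 2 by positivity)
    refine this.trans (le_of_eq ?_)
    field_simp; ring
  have h10 : ε / (2 * C) * avg (fun _ => p) A ≤ ε / 2 := by
    have := mul_le_mul_of_nonneg_left hAavg (show 0 ≤ ε / (2 * C) by positivity)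
    refine this.trans (le_of_eq ?_)
    field_simp
  rw [h8]
  linarith

end TruncatedSecondMoment

section Correlation

variable {ι X : Type*} [Fintype ι] [DecidableEq ι] [Fintype X]

lemma sq_div_le_ent {l m : ℝ} (hl : 0 < l) (hm : 0 < l + m) (hml : m ≤ l / 2) :
    m ^ 2 / l ≤ 5 * ((l + m) * Real.log ((l + m) / l) - m) := by
  set t := (l + m) / l with ht
  have ht0 : 0 < t := by positivity
  set s := Real.sqrt t with hs
  have hs0 : 0 < s := Real.sqrt_pos.2 ht0
  have hst : s ^ 2 = t := Real.sq_sqrt ht0.le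
  have hm' : m = l * (s ^ 2 - 1) := by rw [hst, ht]; field_simp; ring
  have hlog : 2 * (1 - s⁻¹) ≤ Real.log t := by
    rw [← hst, Real.log_pow]
    have := Real.one_sub_inv_le_log_of_pos hs0
    push_cast; linarith
  have hs1 : s ^ 2 ≤ 3 / 2 := by
    rw [hst, ht, div_le_iff₀ hl]; linarith
  have hs2 : s ≤ 1.23 := by
    by_contra h
    have := not_le.1 h
    nlinarith
  have hlm : l + m = l * s ^ 2 := by rw [hm']; ring
  rw [hlm, hm']
  have e1 : (l * (s ^ 2 - 1)) ^ 2 / l = l * ((s - 1) ^ 2 * (s + 1) ^ 2) := by field_simp; ring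
  have e2 : l * s ^ 2 * (2 * (1 - s⁻¹)) ≤ l * s ^ 2 * Real.log t :=
    mul_le_mul_of_nonneg_left hlog (by positivity)
  have e3 : l * s ^ 2 * (2 * (1 - s⁻¹)) = l * (2 * s ^ 2 - 2 * s) := by field_simp
  have e4 : l * ((s - 1) ^ 2 * (s + 1) ^ 2) ≤ l * ((s - 1) ^ 2 * 5) := by
    have : (s + 1) ^ 2 ≤ 5 := by nlinarith
    gcongr
  rw [e1]
  nlinarith

lemma abs_tot_mul_le {c0 : ℝ} (hc : 0 < c0) {p : ι → ℝ} (hp : Box p) {θ : ι → X → ℝ}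
    (hθ : Tilt c0 θ) {μ : X → ℝ} (hμ : ∀ x, 0 ≤ μ x) {f : X → ℝ} (hf : ∀ x, |f x| ≤ 1)
    (g : ι → Bool) : |tot p θ (fun x => μ x * f x) g| ≤ tot p θ μ g := by
  unfold tot
  refine (abs_sum_le_sum_abs _ _).trans (sum_le_sum fun x _ => ?_)
  have := (lik_pos hc hp hθ g x).le
  rw [abs_mul, abs_mul, abs_of_nonneg (hμ x), abs_of_nonneg this]
  have h1 := hμ x
  exact mul_le_mul_of_nonneg_right (mul_le_of_le_one_right h1 (hf x)) this

/-- Reinstating the edge `e` changes its squared influence only slightly. -/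
lemma avg_corr_le {c0 : ℝ} (hc : 0 < c0) (hc1 : c0 ≤ 1) {θ : ι → X → ℝ} (hθ : Tilt c0 θ)
    {μ : X → ℝ} (hμ : PosWt μ) {p : ι → ℝ} (hp : Box p) (e : ι) :
    avg p (fun g => tot p θ (fun x => μ x * θ e x) g ^ 2 / tot p θ μ g) ≤
      avg p (fun g => totE p θ e (fun x => μ x * θ e x) g ^ 2 / totE p θ e μ g)
        + 8 * p e * ∑ x, μ x := by
  have hθ1 : ∀ x, |θ e x| ≤ 1 := fun x => by
    have := hθ e x
    rw [abs_le]; constructor <;> linarith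
  have hl : avg p (fun g => totE p θ e μ g) = ∑ x, μ x := avg_tot p hp _ μ
  rw [avg_coord p e, ← hl, ← avg_mul, ← avg_add]
  refine avg_mono hp fun g => ?_
  have hp0 := (hp e).1
  have hp1 := (hp e).2
  have h1p : 0 < 1 - p e := by linarith
  have hLt := tot_pos hc hp hθ hμ (Function.update g e true)
  have hLf := tot_pos hc hp hθ hμ (Function.update g e false)
  have hMt := abs_tot_mul_le hc hp hθ hμ.1 hθ1 (Function.update g e true)
  have hl := totE_pos hc hc1 hp hθ hμ e g
  obtain ⟨hm1, hm2⟩ := totE_mul_bounds hc hc1 hp hθ hμ.1 e g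
  have hm2' : |totE p θ e (fun x => μ x * θ e x * θ e x) g| ≤ totE p θ e μ g := by
    have := abs_tot_mul_le hc hp (hθ.update hc1 e) hμ.1 (f := fun x => θ e x * θ e x)
      (fun x => by rw [abs_mul]; exact mul_le_one₀ (hθ1 x) (abs_nonneg _) (hθ1 x)) g
    simpa [totE, mul_assoc] using this
  have hT : tot p θ (fun x => μ x * θ e x) (Function.update g e true) ^ 2
      / tot p θ μ (Function.update g e true) ≤ 3 / 2 * totE p θ e μ g := by
    rw [div_le_iff₀ hLt]
    have hsq : tot p θ (fun x => μ x * θ e x) (Function.update g e true) ^ 2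
        ≤ tot p θ μ (Function.update g e true) ^ 2 := sq_le_sq' (abs_le.1 hMt).1 (abs_le.1 hMt).2
    have : tot p θ μ (Function.update g e true) ≤ 3 / 2 * totE p θ e μ g := by
      rw [tot_true]; linarith
    nlinarith
  have hF : (1 - p e) * (tot p θ (fun x => μ x * θ e x) (Function.update g e false) ^ 2
      / tot p θ μ (Function.update g e false))
      ≤ totE p θ e (fun x => μ x * θ e x) g ^ 2 / totE p θ e μ g + 6 * p e * totE p θ e μ g := by
    rw [tot_false] at hLf
    rw [tot_false, tot_false]
    set l := totE p θ e μ g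
    set m := totE p θ e (fun x => μ x * θ e x) g
    set m2 := totE p θ e (fun x => μ x * θ e x * θ e x) g
    set s := p e / (1 - p e) with hs
    have hs0 : 0 ≤ s := by positivity
    have hs2 : s ≤ 2 * p e := by rw [hs, div_le_iff₀ h1p]; nlinarith
    have hs1 : s ≤ 1 := by linarith
    have hle : (1 - p e) * l ≤ l - s * m := by nlinarith
    have hml : |m| ≤ l := by rw [abs_le]; constructor <;> nlinarith
    have hmm : (m - s * m2) ^ 2 ≤ m ^ 2 + 3 * s * l ^ 2 := by
      have h1 : |m * m2| ≤ l * l := by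
        rw [abs_mul]; exact mul_le_mul hml hm2' (abs_nonneg _) hl.le
      have h2 : m2 ^ 2 ≤ l ^ 2 := sq_le_sq' (abs_le.1 hm2').1 (abs_le.1 hm2').2
      have h3 := mul_le_mul_of_nonneg_left (neg_le_of_abs_le h1) hs0
      have h4 : s ^ 2 * m2 ^ 2 ≤ s * l ^ 2 :=
        mul_le_mul (by nlinarith) h2 (sq_nonneg _) hs0
      nlinarith
    rw [mul_div_assoc', div_le_iff₀ hLf]
    have h5 : m ^ 2 / l + 6 * p e * l = (m ^ 2 + 6 * p e * l ^ 2) / l := by field_simp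
    rw [h5, div_mul_eq_mul_div (m ^ 2 + 6 * p e * l ^ 2) l, le_div_iff₀ hl]
    have h6 : (m - s * m2) ^ 2 ≤ m ^ 2 + 6 * p e * l ^ 2 := by
      nlinarith [mul_le_mul_of_nonneg_right hs2 (sq_nonneg l)]
    calc (1 - p e) * (m - s * m2) ^ 2 * l = (m - s * m2) ^ 2 * ((1 - p e) * l) := by ring
      _ ≤ (m ^ 2 + 6 * p e * l ^ 2) * (l - s * m) :=
        mul_le_mul h6 hle (by positivity) (by positivity)
  have := mul_le_mul_of_nonneg_left hT hp0
  nlinarith [mul_nonneg hp0 hl.le]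

lemma avg_LamFn_nonneg {θ : ι → X → ℝ} {μ : X → ℝ} (hμ1 : ∑ x, μ x = 1) {p : ι → ℝ} (hp : Box p)
    (hpos : ∀ g, 0 < tot p θ μ g) : 0 ≤ avg p (fun g => LamFn (tot p θ μ g)) := by
  have h1 : avg p (fun g => tot p θ μ g - 1) = 0 := by
    rw [avg_sub, avg_const, avg_tot p hp, hμ1, sub_self]
  rw [← h1]
  refine avg_mono hp fun g => ?_
  have := Real.one_sub_inv_le_log_of_pos (hpos g)
  unfold LamFn
  have h2 := mul_le_mul_of_nonneg_left this (hpos g).le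
  rwa [mul_sub, mul_one, mul_inv_cancel₀ (hpos g).ne'] at h2

end Correlation

section Potts

variable {q : ℕ}

/-- The relative entropy of the block model with respect to the Erdős–Rényi graph. -/
noncomputable def entD (q : ℕ) (lam : ℝ) (n : ℕ) (p : ℝ) : ℝ :=
  avg (fun _ : EdgeIdx n => p) (fun g => LamFn (LR q lam n p g))

/-- Sublinearity of the relative entropy. -/
def EntVanish (q : ℕ) (lam d : ℝ) : Prop :=
  Filter.Tendsto (fun n : ℕ => entD q lam n (d / n) / n) Filter.atTop (nhds 0)

lemma pairCorr_diag {lam : ℝ} (hP : PottsPar q lam) {n : ℕ} {p : ℝ} (hp0 : 0 ≤ p)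
    (hp : p ≤ 1 / 2) (u : Fin n) : pairCorr q lam n p u u = (q - 1) ^ 2 := by
  have hb : Box (fun _ : EdgeIdx n => p) := box_const hp0 hp
  have h1 : ∀ g, (tot (fun _ => p) (tilt q lam n) (fun σ => unif q n σ * ker q (σ u) (σ u)) g) ^ 2
      / LR q lam n p g = ((q : ℝ) - 1) ^ 2 * LR q lam n p g := by
    intro g
    have hL : 0 < LR q lam n p g :=
      tot_pos hP.minRatio_pos hb (tilt_tilt hP n) (unif_posWt hP.1 n) g
    have h2 : tot (fun _ => p) (tilt q lam n) (fun σ => unif q n σ * ker q (σ u) (σ u)) g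
        = ((q : ℝ) - 1) * LR q lam n p g := by
      unfold LR tot
      rw [mul_sum]
      refine sum_congr rfl fun σ _ => ?_
      simp only [ker, if_true]; ring
    rw [h2]; field_simp
  unfold pairCorr
  simp_rw [h1]
  rw [avg_mul]
  have : avg (fun _ : EdgeIdx n => p) (fun g => LR q lam n p g) = 1 := by
    unfold LR
    rw [← unif_sum hP.1 n]
    exact avg_tot _ hb _ _
  rw [this, mul_one]

lemma pairCorr_symm (lam : ℝ) (n : ℕ) (p : ℝ) (u v : Fin n) :
    pairCorr q lam n p u v = pairCorr q lam n p v u := by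
  unfold pairCorr
  simp_rw [ker_symm]

lemma sum_pairCorr_le {lam d d1 : ℝ} (hP : PottsPar q lam) (hd : 0 < d) (hdd : d < d1) {n : ℕ}
    (hn : 0 < n) (h1 : d1 / n ≤ 1 / 2) :
    (∑ u, ∑ v, pairCorr q lam n (d / n) u v) / (n : ℝ) ^ 2
      ≤ 10 / (lam ^ 2 * (d1 - d)) * (entD q lam n (d1 / n) / n)
        + (8 * d / lam ^ 2 + (q - 1) ^ 2) / n := by
  have hn' : (0 : ℝ) < n := by exact_mod_cast hn
  have hlam : 0 < lam ^ 2 := sq_pos_of_neg hP.2.1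
  have hdiff : 0 < d1 - d := by linarith
  have hle : d / (n : ℝ) ≤ d1 / n := by gcongr
  have hb : Box (fun _ : EdgeIdx n => d / (n : ℝ)) := box_div_nat hd.le (hle.trans h1)
  have hb1 : Box (fun _ : EdgeIdx n => d1 / (n : ℝ)) := box_div_nat (hd.trans hdd).le h1
  have hT := tilt_tilt hP n
  have hμ := unif_posWt hP.1 n
  have hμ1 := unif_sum hP.1 n
  have hg := ent_gain hP.minRatio_pos hP.minRatio_le hT hμ hb hb1 (fun _ => hle)
  have hD0 := avg_LamFn_nonneg (θ := tilt q lam n) hμ1 hb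
    (fun g => tot_pos hP.minRatio_pos hb hT hμ g)
  set Q : EdgeIdx n → ℝ := fun e => avg (fun _ => d / (n : ℝ)) (fun g =>
    totE (fun _ => d / (n : ℝ)) (tilt q lam n) e (fun x => unif q n x * tilt q lam n e x) g ^ 2
      / totE (fun _ => d / (n : ℝ)) (tilt q lam n) e (unif q n) g) with hQ
  have hQle : (d1 - d) / n * ∑ e, Q e ≤ 5 * entD q lam n (d1 / n) := by
    have h2 : ∑ e, (d1 / (n : ℝ) - d / n) * (Q e / 5) ≤ entD q lam n (d1 / n) := by
      refine le_trans (sum_le_sum fun e _ => ?_) (hg.trans (sub_le_self _ hD0))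
      refine mul_le_mul_of_nonneg_left ?_ (by linarith)
      rw [div_le_iff₀ (by norm_num), mul_comm, ← avg_mul]
      refine avg_mono hb fun g => ?_
      have hl := totE_pos hP.minRatio_pos hP.minRatio_le hb hT hμ e g
      obtain ⟨hm1, hm2⟩ := totE_mul_bounds hP.minRatio_pos hP.minRatio_le hb hT hμ.1 e g
      exact sq_div_le_ent hl (by nlinarith [hP.minRatio_pos]) hm2
    rw [← mul_sum, ← sum_div, ← sub_div] at h2
    linarith
  have hedge : ∀ e : EdgeIdx n, pairCorr q lam n (d / n) e.1.1 e.1.2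
      ≤ (Q e + 8 * (d / n)) / lam ^ 2 := by
    intro e
    have h3 := avg_corr_le hP.minRatio_pos hP.minRatio_le hT hμ hb e
    rw [hμ1, mul_one] at h3
    rw [le_div_iff₀ hlam, mul_comm]
    refine le_trans (le_of_eq ?_) h3
    unfold pairCorr
    rw [← avg_mul]
    congr 1
    ext g
    have : tot (fun _ => d / (n : ℝ)) (tilt q lam n) (fun x => unif q n x * tilt q lam n e x) g
        = lam * tot (fun _ => d / (n : ℝ)) (tilt q lam n)
          (fun σ => unif q n σ * ker q (σ e.1.1) (σ e.1.2)) g := by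
      unfold tot
      rw [mul_sum]
      refine sum_congr rfl fun σ _ => ?_
      simp only [tilt]; ring
    rw [this, LR]; ring
  rw [sum_edgeIdx _ (pairCorr_symm lam n _)]
  simp_rw [pairCorr_diag hP (by positivity) (hle.trans h1)]
  have hcard : (Fintype.card (EdgeIdx n) : ℝ) * 2 ≤ (n : ℝ) ^ 2 := by
    have := sum_edgeIdx (n := n) (fun _ _ => 1) (fun _ _ => rfl)
    simp at this
    nlinarith
  have hsum : ∑ e : EdgeIdx n, pairCorr q lam n (d / n) e.1.1 e.1.2
      ≤ (∑ e, Q e + Fintype.card (EdgeIdx n) * (8 * (d / n))) / lam ^ 2 := by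
    refine (sum_le_sum fun e _ => hedge e).trans (le_of_eq ?_)
    rw [← sum_div, sum_add_distrib]; simp
  have hQ2 : ∑ e, Q e ≤ 5 * entD q lam n (d1 / n) * n / (d1 - d) := by
    rw [le_div_iff₀ hdiff]
    rw [div_mul_eq_mul_div, div_le_iff₀ hn'] at hQle
    linarith
  rw [div_le_iff₀ (by positivity)]
  simp only [sum_const, card_univ, Fintype.card_fin, nsmul_eq_mul]
  have h4 : (Fintype.card (EdgeIdx n) : ℝ) * (8 * (d / n)) ≤ 4 * d * n := by
    have : (Fintype.card (EdgeIdx n) : ℝ) * (8 * (d / n))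
        = (Fintype.card (EdgeIdx n) : ℝ) * 2 * (4 * d) / n := by field_simp; ring
    rw [this, div_le_iff₀ hn']
    nlinarith
  have h5 : (∑ e, Q e + Fintype.card (EdgeIdx n) * (8 * (d / n))) / lam ^ 2
      ≤ (5 * entD q lam n (d1 / n) * n / (d1 - d) + 4 * d * n) / lam ^ 2 := by gcongr
  have h6 : (10 / (lam ^ 2 * (d1 - d)) * (entD q lam n (d1 / n) / n)
        + (8 * d / lam ^ 2 + ((q : ℝ) - 1) ^ 2) / n) * (n : ℝ) ^ 2
      = 2 * ((5 * entD q lam n (d1 / n) * n / (d1 - d) + 4 * d * n) / lam ^ 2)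
        + n * ((q : ℝ) - 1) ^ 2 := by
    have := hlam.ne'
    field_simp
    ring
  rw [h6]
  linarith

/-- A sublinear relative entropy at a larger degree forces the pair correlations to vanish. -/
theorem corrVanish_of_entVanish {lam d d1 : ℝ} (hP : PottsPar q lam) (hd : 0 < d) (hdd : d < d1)
    (h : EntVanish q lam d1) : CorrVanish q lam d := by
  have hlim : Filter.Tendsto (fun n : ℕ => 10 / (lam ^ 2 * (d1 - d)) * (entD q lam n (d1 / n) / n)
        + (8 * d / lam ^ 2 + ((q : ℝ) - 1) ^ 2) / n) Filter.atTop (nhds 0) := by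
    simpa using (h.const_mul (10 / (lam ^ 2 * (d1 - d)))).add
      (tendsto_const_div_atTop_nhds_zero_nat (8 * d / lam ^ 2 + ((q : ℝ) - 1) ^ 2))
  have hn1 := eventually_div_nat_lt d1 (show (0 : ℝ) < 1 / 2 by norm_num)
  refine tendsto_of_tendsto_of_tendsto_of_le_of_le' tendsto_const_nhds hlim ?_ ?_
  · filter_upwards [hn1] with n hn
    have hle : d / (n : ℝ) ≤ d1 / n := by gcongr
    have hb : Box (fun _ : EdgeIdx n => d / (n : ℝ)) := box_div_nat hd.le (hle.trans hn.2.le)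
    refine div_nonneg (sum_nonneg fun u _ => sum_nonneg fun v _ => avg_nonneg hb fun g => ?_)
      (by positivity)
    exact div_nonneg (sq_nonneg _)
      (tot_pos hP.minRatio_pos hb (tilt_tilt hP n) (unif_posWt hP.1 n) g).le
  · filter_upwards [hn1] with n hn
    exact sum_pairCorr_le hP hd hdd hn.1 hn.2.le

end Potts

section Bethe

/-- The average over the color of a new vertex of the product of its edge likelihood ratios, where
the neighbours have the color distributions `r i`. -/
noncomputable def vertexZ (q : ℕ) (lam : ℝ) {γ : ℕ} (r : Fin γ → Fin q → ℝ) : ℝ :=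
  (q : ℝ)⁻¹ * ∑ τ, ∏ i, (1 + lam * (q * r i τ - 1))

/-- The average edge likelihood ratio between vertices with color distributions `a` and `b`. -/
noncomputable def edgeZ (q : ℕ) (lam : ℝ) (a b : Fin q → ℝ) : ℝ :=
  1 + lam * (q * ∑ τ, a τ * b τ - 1)

/-- Poisson weights. -/
noncomputable def poisWt (d : ℝ) (γ : ℕ) : ℝ := Real.exp (-d) * d ^ γ / γ.factorial

variable {V : Type*} [Fintype V]

/-- A finitely supported distribution on the simplex with uniform barycenter. -/
structure IsMixture (q : ℕ) (w : V → ℝ) (ρ : V → Fin q → ℝ) : Prop where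
  nonneg : ∀ v, 0 ≤ w v
  sum_one : ∑ v, w v = 1
  mem : ∀ v, ρ v ∈ stdSimplex ℝ (Fin q)
  bary : ∀ s, ∑ v, w v * ρ v s = (q : ℝ)⁻¹

/-- The vertex part of the Bethe functional for `γ` neighbours. -/
noncomputable def vertexEnt (q : ℕ) (lam : ℝ) (w : V → ℝ) (ρ : V → Fin q → ℝ) (γ : ℕ) : ℝ :=
  ∑ f : Fin γ → V, (∏ i, w (f i)) * LamFn (vertexZ q lam fun i => ρ (f i))

/-- The edge part of the Bethe functional. -/
noncomputable def edgeEnt (q : ℕ) (lam : ℝ) (w : V → ℝ) (ρ : V → Fin q → ℝ) : ℝ :=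
  ∑ v, ∑ v', w v * w v' * LamFn (edgeZ q lam (ρ v) (ρ v'))

lemma factor_bounds {q : ℕ} {lam : ℝ} (hP : PottsPar q lam) {x : ℝ} (h0 : 0 ≤ x) (h1 : x ≤ 1) :
    minRatio q lam ≤ 1 + lam * (q * x - 1) ∧ 1 + lam * (q * x - 1) ≤ 3 / 2 := by
  have h2 := hP.q_pos
  have h3 := hP.2.1
  have h4 := hP.neg_half_lt
  have h5 : (q : ℝ) * x ≤ q := by nlinarith
  have h6 : 0 ≤ (q : ℝ) * x := by positivity
  unfold minRatio
  constructor <;> nlinarith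

lemma le_one_of_mem_stdSimplex {q : ℕ} {a : Fin q → ℝ} (ha : a ∈ stdSimplex ℝ (Fin q)) (s : Fin q) :
    a s ≤ 1 := by
  rw [← ha.2]; exact single_le_sum (fun i _ => ha.1 i) (mem_univ s)

lemma vertexZ_bounds {q : ℕ} {lam : ℝ} (hP : PottsPar q lam) {γ : ℕ} {r : Fin γ → Fin q → ℝ}
    (hr : ∀ i, r i ∈ stdSimplex ℝ (Fin q)) :
    0 < vertexZ q lam r ∧ vertexZ q lam r ≤ (3 / 2) ^ γ := by
  have hq := hP.q_pos
  have hq0 : 0 < q := by have := hP.1; omega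
  have : NeZero q := ⟨hq0.ne'⟩
  have hb := fun i τ => factor_bounds hP ((hr i).1 τ) (le_one_of_mem_stdSimplex (hr i) τ)
  constructor
  · refine mul_pos (by positivity) (sum_pos (fun τ _ => prod_pos fun i _ => ?_) univ_nonempty)
    exact hP.minRatio_pos.trans_le (hb i τ).1
  · unfold vertexZ
    rw [inv_mul_le_iff₀ (by positivity)]
    calc ∑ τ, ∏ i, (1 + lam * (q * r i τ - 1)) ≤ ∑ _τ : Fin q, ((3 : ℝ) / 2) ^ γ := by
          refine sum_le_sum fun τ _ => ?_
          calc ∏ i, (1 + lam * (q * r i τ - 1)) ≤ ∏ _i : Fin γ, (3 / 2 : ℝ) :=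
                prod_le_prod (fun i _ => (hP.minRatio_pos.trans_le (hb i τ).1).le)
                  fun i _ => (hb i τ).2
            _ = _ := by rw [prod_const, card_univ, Fintype.card_fin]
      _ = _ := by simp

lemma inner_mem {q : ℕ} {a b : Fin q → ℝ} (ha : a ∈ stdSimplex ℝ (Fin q))
    (hb : b ∈ stdSimplex ℝ (Fin q)) : 0 ≤ ∑ τ, a τ * b τ ∧ ∑ τ, a τ * b τ ≤ 1 := by
  refine ⟨sum_nonneg fun τ _ => mul_nonneg (ha.1 τ) (hb.1 τ), ?_⟩
  rw [← ha.2]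
  exact sum_le_sum fun τ _ => mul_le_of_le_one_right (ha.1 τ) (le_one_of_mem_stdSimplex hb τ)

lemma edgeZ_bounds {q : ℕ} {lam : ℝ} (hP : PottsPar q lam) {a b : Fin q → ℝ}
    (ha : a ∈ stdSimplex ℝ (Fin q)) (hb : b ∈ stdSimplex ℝ (Fin q)) :
    minRatio q lam ≤ edgeZ q lam a b ∧ edgeZ q lam a b ≤ 3 / 2 :=
  factor_bounds hP (inner_mem ha hb).1 (inner_mem ha hb).2

variable {q : ℕ} {w : V → ℝ} {ρ : V → Fin q → ℝ}

lemma IsMixture.sum_prod (h : IsMixture q w ρ) (γ : ℕ) : ∑ f : Fin γ → V, ∏ i, w (f i) = 1 := by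
  rw [← Fintype.sum_pow, h.sum_one, one_pow]

lemma IsMixture.sum_factor (h : IsMixture q w ρ) (hq : 3 ≤ q) (lam : ℝ) (τ : Fin q) :
    ∑ v, w v * (1 + lam * (q * ρ v τ - 1)) = 1 := by
  have hq' : (q : ℝ) ≠ 0 := by positivity
  have : ∀ v, w v * (1 + lam * (q * ρ v τ - 1)) = (1 - lam) * w v + lam * q * (w v * ρ v τ) :=
    fun v => by ring
  simp only [this, sum_add_distrib, ← mul_sum, h.sum_one, h.bary]
  field_simp; ring

lemma IsMixture.sum_vertexZ (h : IsMixture q w ρ) (hq : 3 ≤ q) (lam : ℝ) (γ : ℕ) :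
    ∑ f : Fin γ → V, (∏ i, w (f i)) * vertexZ q lam (fun i => ρ (f i)) = 1 := by
  have hq' : (q : ℝ) ≠ 0 := by positivity
  have : ∀ f : Fin γ → V, (∏ i, w (f i)) * vertexZ q lam (fun i => ρ (f i))
      = (q : ℝ)⁻¹ * ∑ τ, ∏ i, (w (f i) * (1 + lam * (q * ρ (f i) τ - 1))) := by
    intro f
    simp only [vertexZ, prod_mul_distrib, ← mul_sum]; ring
  simp only [this]
  rw [← mul_sum, sum_comm]
  have h2 : ∀ τ, ∑ f : Fin γ → V, ∏ i, (w (f i) * (1 + lam * (q * ρ (f i) τ - 1))) = 1 := by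
    intro τ
    rw [← Fintype.sum_pow (fun v => w v * (1 + lam * (q * ρ v τ - 1))), h.sum_factor hq, one_pow]
  simp [h2, hq']

lemma IsMixture.sum_edgeZ (h : IsMixture q w ρ) (hq : 3 ≤ q) (lam : ℝ) :
    ∑ v, ∑ v', w v * w v' * edgeZ q lam (ρ v) (ρ v') = 1 := by
  have hq' : (q : ℝ) ≠ 0 := by positivity
  have h1 : ∀ v, ∑ v', w v' * ∑ τ, ρ v τ * ρ v' τ = (q : ℝ)⁻¹ := by
    intro v
    simp only [mul_sum]
    rw [sum_comm]
    have : ∀ τ, ∑ v', w v' * (ρ v τ * ρ v' τ) = ρ v τ * (q : ℝ)⁻¹ := by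
      intro τ; rw [← h.bary τ, mul_sum]; exact sum_congr rfl fun _ _ => by ring
    simp only [this, ← sum_mul, (h.mem v).2, one_mul]
  have h2 : ∀ v, ∑ v', w v * w v' * edgeZ q lam (ρ v) (ρ v') = w v := by
    intro v
    have : ∀ v', w v * w v' * edgeZ q lam (ρ v) (ρ v')
        = w v * ((1 - lam) * w v' + lam * q * (w v' * ∑ τ, ρ v τ * ρ v' τ)) := by
      intro v'; unfold edgeZ; ring
    simp only [this, ← mul_sum, sum_add_distrib, h1, h.sum_one]
    field_simp; ring
  simp only [h2, h.sum_one]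

lemma abs_LamFn_le {x B : ℝ} (h0 : 0 < x) (hB : x ≤ B) (h1 : 1 ≤ B) : |LamFn x| ≤ B ^ 2 := by
  unfold LamFn
  have h2 := Real.log_le_sub_one_of_pos h0
  have h3 := Real.one_sub_inv_le_log_of_pos h0
  have h4 := mul_le_mul_of_nonneg_left h3 h0.le
  rw [mul_sub, mul_one, mul_inv_cancel₀ h0.ne'] at h4
  rw [abs_le]
  constructor <;> nlinarith

lemma vertexEnt_nonneg {lam : ℝ} (hP : PottsPar q lam) (h : IsMixture q w ρ) (γ : ℕ) :
    0 ≤ vertexEnt q lam w ρ γ := by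
  have h1 := h.sum_vertexZ hP.1 lam γ
  have h2 := h.sum_prod γ
  have : ∑ f : Fin γ → V, (∏ i, w (f i)) * (vertexZ q lam (fun i => ρ (f i)) - 1) = 0 := by
    simp only [mul_sub, mul_one, sum_sub_distrib, h1, h2, sub_self]
  rw [← this]
  refine sum_le_sum fun f _ => mul_le_mul_of_nonneg_left ?_ (prod_nonneg fun i _ => h.nonneg _)
  have h0 := (vertexZ_bounds hP (r := fun i => ρ (f i)) fun i => h.mem _).1
  have h3 := Real.one_sub_inv_le_log_of_pos h0
  have h4 := mul_le_mul_of_nonneg_left h3 h0.le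
  rwa [mul_sub, mul_one, mul_inv_cancel₀ h0.ne'] at h4

lemma vertexEnt_le {lam : ℝ} (hP : PottsPar q lam) (h : IsMixture q w ρ) (γ : ℕ) :
    vertexEnt q lam w ρ γ ≤ (9 / 4) ^ γ := by
  have : ((9 : ℝ) / 4) ^ γ = ∑ f : Fin γ → V, (∏ i, w (f i)) * (9 / 4) ^ γ := by
    rw [← sum_mul, h.sum_prod, one_mul]
  rw [this]
  refine sum_le_sum fun f _ => mul_le_mul_of_nonneg_left ?_ (prod_nonneg fun i _ => h.nonneg _)
  obtain ⟨h0, h1⟩ := vertexZ_bounds hP (r := fun i => ρ (f i)) fun i => h.mem _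
  have h2 := (abs_le.1 (abs_LamFn_le h0 h1 (one_le_pow₀ (by norm_num)))).2
  refine h2.trans (le_of_eq ?_)
  rw [← pow_mul, mul_comm, pow_mul]; norm_num

lemma poisWt_hasSum (d : ℝ) : HasSum (poisWt d) 1 := by
  have h : HasSum (fun n : ℕ => d ^ n / n.factorial) (Real.exp d) := by
    rw [Real.exp_eq_exp_ℝ]; exact NormedSpace.expSeries_div_hasSum_exp d
  have h2 := h.mul_left (Real.exp (-d))
  rw [← Real.exp_add, neg_add_cancel, Real.exp_zero] at h2
  refine h2.congr_fun fun n => ?_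
  unfold poisWt; ring

lemma poisWt_succ (d : ℝ) (n : ℕ) : ((n : ℝ) + 1) * poisWt d (n + 1) = d * poisWt d n := by
  unfold poisWt
  rw [Nat.factorial_succ]; push_cast; field_simp; ring

lemma poisWt_mul_hasSum (d : ℝ) : HasSum (fun n : ℕ => poisWt d n * n) d := by
  rw [← hasSum_nat_add_iff' 1]
  have : (fun n : ℕ => poisWt d (n + 1) * ((n + 1 : ℕ) : ℝ)) = fun n => d * poisWt d n := by
    funext n; rw [← poisWt_succ]; push_cast; ring
  rw [this]
  simpa using (poisWt_hasSum d).mul_left d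

lemma poisWt_nonneg {d : ℝ} (hd : 0 ≤ d) (n : ℕ) : 0 ≤ poisWt d n := by
  unfold poisWt; positivity

lemma poisWt_summable_pow (d b : ℝ) : Summable fun n : ℕ => poisWt d n * b ^ n := by
  have := (Real.summable_pow_div_factorial (d * b)).mul_left (Real.exp (-d))
  refine this.congr fun n => ?_
  unfold poisWt; rw [mul_pow]; ring

/-- The probability measure on a finite type with the given weights. -/
noncomputable def wtMeasure {V : Type*} [Fintype V] [MeasurableSpace V] (w : V → ℝ) : Measure V :=
  ∑ v, ENNReal.ofReal (w v) • Measure.dirac v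

lemma measurable_LamFn : Measurable LamFn := measurable_id.mul Real.measurable_log

lemma isProbabilityMeasure_wtMeasure [MeasurableSpace V] (h : IsMixture q w ρ) :
    IsProbabilityMeasure (wtMeasure w) := by
  constructor
  unfold wtMeasure
  rw [Measure.finsetSum_apply]
  simp only [Measure.smul_apply, measure_univ, smul_eq_mul, mul_one]
  rw [← ENNReal.ofReal_sum_of_nonneg fun v _ => h.nonneg v, h.sum_one, ENNReal.ofReal_one]

lemma integral_pi_map [MeasurableSpace V] [DiscreteMeasurableSpace V] (h : IsMixture q w ρ) {γ : ℕ}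
    (F : (Fin γ → Fin q → ℝ) → ℝ) (hF : Measurable F) :
    ∫ r, F r ∂(Measure.pi fun _ : Fin γ => (wtMeasure w).map ρ)
      = ∑ f : Fin γ → V, (∏ i, w (f i)) * F (fun i => ρ (f i)) := by
  classical
  have := isProbabilityMeasure_wtMeasure h
  have hρ : Measurable ρ := measurable_of_finite ρ
  rw [← Measure.pi_map_pi (fun _ => hρ.aemeasurable),
    integral_map (measurable_of_finite _).aemeasurable hF.aestronglyMeasurable, integral_fintype Integrable.of_finite]
  refine sum_congr rfl fun f _ => ?_
  rw [measureReal_def, Measure.pi_singleton, ENNReal.toReal_prod, smul_eq_mul]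
  congr 1
  refine prod_congr rfl fun i _ => ?_
  unfold wtMeasure
  rw [Measure.finsetSum_apply]
  simp [Set.indicator_apply, ENNReal.toReal_ofReal (h.nonneg _)]

lemma LamFn_mul {a x : ℝ} (ha : 0 < a) (hx : 0 < x) : LamFn (a * x) / a = LamFn x + x * Real.log a := by
  unfold LamFn
  rw [Real.log_mul ha.ne' hx.ne']
  field_simp; ring

/-- Below the condensation threshold, the Bethe functional of every finitely supported
distribution is at most the replica symmetric value. -/
theorem bethe_le (hq : 3 ≤ q) {β d : ℝ} (hβ : 0 < β) (hd : 0 < d) (hdc : d < dcond q β)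
    (h : IsMixture q w ρ) (Γ : ℕ) :
    ∑ γ ∈ range Γ, poisWt d γ * vertexEnt q (pottsLam q β) w ρ γ
      ≤ d / 2 * edgeEnt q (pottsLam q β) w ρ := by
  classical
  let _ : MeasurableSpace V := ⊤
  have hP := pottsPar_pottsLam hq hβ
  have := isProbabilityMeasure_wtMeasure h
  have hρ : Measurable ρ := measurable_of_finite ρ
  let π : ProbabilityMeasure (Fin q → ℝ) :=
    ⟨(wtMeasure w).map ρ, Measure.isProbabilityMeasure_map hρ.aemeasurable⟩
  have hπ : (π : Measure (Fin q → ℝ)) = (wtMeasure w).map ρ := rfl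
  have hmem : memP2star q π := by
    constructor
    · rw [hπ]
      refine (ae_map_iff (p := fun μ => μ ∈ stdSimplex ℝ (Fin q)) hρ.aemeasurable
        (isClosed_stdSimplex ℝ (Fin q)).measurableSet).2 ?_
      exact Filter.Eventually.of_forall h.mem
    · intro s
      rw [hπ, integral_map hρ.aemeasurable (measurable_pi_apply s).aestronglyMeasurable,
        integral_fintype Integrable.of_finite, ← h.bary s]
      refine sum_congr rfl fun v _ => ?_
      rw [measureReal_def, smul_eq_mul]
      congr 1
      unfold wtMeasure
      rw [Measure.finsetSum_apply]
      simp [Set.indicator_apply, ENNReal.toReal_ofReal (h.nonneg _)]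
  have hnot := notMem_of_lt_csInf hdc ⟨0, fun x hx => hx.1.le⟩
  have hle : BPotts q β d π ≤ Real.log q + d / 2 * Real.log (1 - (1 - Real.exp (-β)) / q) := by
    by_contra hcon
    exact hnot ⟨hd, π, hmem, not_le.1 hcon⟩
  have h2 := Real.exp_pos (-β)
  have h3 : (3 : ℝ) ≤ q := by exact_mod_cast hq
  have h4 : (q : ℝ) - 1 + Real.exp (-β) ≠ 0 := by linarith
  set κ : ℝ := 1 - (1 - Real.exp (-β)) / q with hκ
  have hκ0 : 0 < κ := by
    rw [hκ, sub_pos, div_lt_one (by linarith)]; linarith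
  have hfac : ∀ x : ℝ, 1 - (1 - Real.exp (-β)) * x = κ * (1 + pottsLam q β * (q * x - 1)) := by
    intro x
    rw [hκ]; unfold pottsLam; field_simp; ring
  have hv : ∀ γ : ℕ, ∫ r : Fin γ → Fin q → ℝ,
        LamFn (∑ σ : Fin q, ∏ i, (1 - (1 - Real.exp (-β)) * r i σ)) / ((q : ℝ) * κ ^ γ)
        ∂(Measure.pi fun _ : Fin γ => (π : Measure (Fin q → ℝ)))
      = vertexEnt q (pottsLam q β) w ρ γ + (Real.log q + γ * Real.log κ) := by
    intro γ
    have hmeas : Measurable fun r : Fin γ → Fin q → ℝ =>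
        LamFn (∑ σ : Fin q, ∏ i, (1 - (1 - Real.exp (-β)) * r i σ)) / ((q : ℝ) * κ ^ γ) := by
      refine Measurable.div_const (measurable_LamFn.comp ?_) _
      fun_prop
    rw [hπ, integral_pi_map h _ hmeas]
    have hterm : ∀ f : Fin γ → V, LamFn (∑ σ : Fin q, ∏ i, (1 - (1 - Real.exp (-β)) * ρ (f i) σ))
          / ((q : ℝ) * κ ^ γ)
        = LamFn (vertexZ q (pottsLam q β) fun i => ρ (f i))
          + vertexZ q (pottsLam q β) (fun i => ρ (f i)) * (Real.log q + γ * Real.log κ) := by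
      intro f
      have e1 : ∑ σ : Fin q, ∏ i, (1 - (1 - Real.exp (-β)) * ρ (f i) σ)
          = ((q : ℝ) * κ ^ γ) * vertexZ q (pottsLam q β) fun i => ρ (f i) := by
        unfold vertexZ
        simp only [hfac, prod_mul_distrib, prod_const, card_univ, Fintype.card_fin, ← mul_sum]
        field_simp
      rw [e1, LamFn_mul (by positivity) (vertexZ_bounds hP fun i => h.mem _).1,
        Real.log_mul (by positivity) (by positivity), Real.log_pow]
    simp only [hterm, mul_add (∏ i, w _), sum_add_distrib, ← mul_assoc]
    rw [← sum_mul, h.sum_vertexZ hq, one_mul]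
    rfl
  have he : ∫ r : Fin 2 → Fin q → ℝ,
        LamFn (1 - (1 - Real.exp (-β)) * ∑ τ : Fin q, r 0 τ * r 1 τ) / κ
        ∂(Measure.pi fun _ : Fin 2 => (π : Measure (Fin q → ℝ)))
      = edgeEnt q (pottsLam q β) w ρ + Real.log κ := by
    have hmeas : Measurable fun r : Fin 2 → Fin q → ℝ =>
        LamFn (1 - (1 - Real.exp (-β)) * ∑ τ : Fin q, r 0 τ * r 1 τ) / κ := by
      refine Measurable.div_const (measurable_LamFn.comp ?_) _
      fun_prop
    rw [hπ, integral_pi_map h _ hmeas, ← (finTwoArrowEquiv V).symm.sum_comp, Fintype.sum_prod_type]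
    simp only [finTwoArrowEquiv_symm_apply, Fin.prod_univ_two, Matrix.cons_val_zero,
      Matrix.cons_val_one]
    have hterm : ∀ v v' : V, LamFn (1 - (1 - Real.exp (-β)) * ∑ τ : Fin q, ρ v τ * ρ v' τ) / κ
        = LamFn (edgeZ q (pottsLam q β) (ρ v) (ρ v'))
          + edgeZ q (pottsLam q β) (ρ v) (ρ v') * Real.log κ := by
      intro v v'
      rw [hfac]
      exact LamFn_mul hκ0 (hP.minRatio_pos.trans_le (edgeZ_bounds hP (h.mem v) (h.mem v')).1)
    simp only [hterm, mul_add (w _ * w _), sum_add_distrib, ← mul_assoc, ← sum_mul]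
    rw [h.sum_edgeZ hq, one_mul]
    rfl
  have hsum : Summable fun γ => poisWt d γ * vertexEnt q (pottsLam q β) w ρ γ :=
    Summable.of_nonneg_of_le
      (fun γ => mul_nonneg (poisWt_nonneg hd.le γ) (vertexEnt_nonneg hP h γ))
      (fun γ => mul_le_mul_of_nonneg_left (vertexEnt_le hP h γ) (poisWt_nonneg hd.le γ))
      (poisWt_summable_pow d (9 / 4))
  have htot : HasSum (fun γ : ℕ => poisWt d γ *
        (vertexEnt q (pottsLam q β) w ρ γ + (Real.log q + γ * Real.log κ)))
      (∑' γ, poisWt d γ * vertexEnt q (pottsLam q β) w ρ γ + (Real.log q + d * Real.log κ)) := by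
    have := hsum.hasSum.add (((poisWt_hasSum d).mul_right (Real.log q)).add
      ((poisWt_mul_hasSum d).mul_right (Real.log κ)))
    rw [one_mul] at this
    refine this.congr_fun fun γ => ?_
    ring
  have hB : BPotts q β d π = ∑' γ, poisWt d γ * vertexEnt q (pottsLam q β) w ρ γ
      + (Real.log q + d * Real.log κ) - d / 2 * (edgeEnt q (pottsLam q β) w ρ + Real.log κ) := by
    unfold BPotts
    rw [← hκ, he, ← htot.tsum_eq]
    simp only [hv]
    rfl
  have hpart : ∑ γ ∈ range Γ, poisWt d γ * vertexEnt q (pottsLam q β) w ρ γ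
      ≤ ∑' γ, poisWt d γ * vertexEnt q (pottsLam q β) w ρ γ :=
    hsum.sum_le_tsum _ fun γ _ => mul_nonneg (poisWt_nonneg hd.le γ) (vertexEnt_nonneg hP h γ)
  rw [hB] at hle
  linarith

end Bethe

section KestenStigum

lemma abs_LamFn_one_add_sub_le {t : ℝ} (ht : |t| ≤ 1 / 2) :
    |LamFn (1 + t) - t - t ^ 2 / 2| ≤ 4 * |t| ^ 3 := by
  have h1 := Real.abs_log_sub_add_sum_range_le (x := -t) (by rw [abs_neg]; linarith) 2
  rw [abs_neg, sub_neg_eq_add] at h1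
  simp only [sum_range_succ, sum_range_zero] at h1
  set L := Real.log (1 + t)
  have h2 : |t| ^ (2 + 1) / (1 - |t|) ≤ 2 * |t| ^ 3 := by
    rw [div_le_iff₀ (by linarith)]
    have : 0 ≤ |t| ^ 3 * (1 / 2 - |t|) := mul_nonneg (by positivity) (by linarith)
    calc |t| ^ (2 + 1) = |t| ^ 3 := by norm_num
      _ ≤ 2 * |t| ^ 3 * (1 - |t|) := by linarith
  have h3 := h1.trans h2
  have h4 : LamFn (1 + t) - t - t ^ 2 / 2
      = (1 + t) * (0 + (-t) ^ (0 + 1) / ((0 : ℕ) + 1) + (-t) ^ (1 + 1) / ((1 : ℕ) + 1) + L)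
        - t ^ 3 / 2 := by
    unfold LamFn; push_cast; ring
  rw [h4]
  have h5 : |1 + t| ≤ 3 / 2 := by
    rw [abs_le] at *; constructor <;> linarith [ht.1, ht.2]
  calc _ ≤ |1 + t| * |(0 + (-t) ^ (0 + 1) / ((0 : ℕ) + 1) + (-t) ^ (1 + 1) / ((1 : ℕ) + 1) + L)|
        + |t ^ 3 / 2| := by rw [← abs_mul]; exact abs_sub _ _
    _ ≤ 3 / 2 * (2 * |t| ^ 3) + |t| ^ 3 / 2 := by
        gcongr
        rw [abs_div, abs_pow]; simp
    _ ≤ _ := by nlinarith [pow_nonneg (abs_nonneg t) 3]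

lemma exists_one_add_pow_bound (γ : ℕ) : ∃ B : ℝ, 0 ≤ B ∧ ∀ t : ℝ, |t| ≤ 1 →
    |(1 + t) ^ γ - 1 - γ * t - γ * (γ - 1) / 2 * t ^ 2| ≤ B * |t| ^ 3 := by
  induction γ with
  | zero => exact ⟨0, le_rfl, fun t _ => by simp⟩
  | succ γ ih =>
    obtain ⟨B, hB, h⟩ := ih
    refine ⟨2 * B + |(γ : ℝ) * (γ - 1) / 2|, by positivity, fun t ht => ?_⟩
    have h1 : (1 + t) ^ (γ + 1) - 1 - ((γ + 1 : ℕ) : ℝ) * t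
          - ((γ + 1 : ℕ) : ℝ) * (((γ + 1 : ℕ) : ℝ) - 1) / 2 * t ^ 2
        = (1 + t) * ((1 + t) ^ γ - 1 - γ * t - γ * (γ - 1) / 2 * t ^ 2)
          + γ * (γ - 1) / 2 * t ^ 3 := by push_cast; ring
    rw [h1]
    have h2 : |1 + t| ≤ 2 := by rw [abs_le] at *; constructor <;> linarith [ht.1, ht.2]
    calc _ ≤ |1 + t| * |(1 + t) ^ γ - 1 - γ * t - γ * (γ - 1) / 2 * t ^ 2|
          + |(γ : ℝ) * (γ - 1) / 2| * |t| ^ 3 := by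
            rw [← abs_mul, ← abs_pow, ← abs_mul]; exact abs_add_le _ _
      _ ≤ 2 * (B * |t| ^ 3) + |(γ : ℝ) * (γ - 1) / 2| * |t| ^ 3 := by
          gcongr; exact h t ht
      _ = _ := by ring

lemma abs_prod_one_add_sub_one_le {κ : Type*} [DecidableEq κ] (s : Finset κ) {t : κ → ℝ} {a : ℝ} (ha : a ≤ 1)
    (ht : ∀ i, |t i| ≤ a) : |∏ i ∈ s, (1 + t i) - 1| ≤ (2 ^ s.card - 1) * a := by
  induction s using Finset.induction_on with
  | empty => simp
  | insert i s hi ih =>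
    rw [prod_insert hi, card_insert_of_notMem hi]
    have h1 : (1 + t i) * ∏ i ∈ s, (1 + t i) - 1 = (1 + t i) * (∏ i ∈ s, (1 + t i) - 1) + t i := by
      ring
    have h2 : |1 + t i| ≤ 2 := by
      have := ht i
      rw [abs_le] at *; constructor <;> linarith [this.1, this.2]
    rw [h1]
    calc _ ≤ |1 + t i| * |∏ i ∈ s, (1 + t i) - 1| + |t i| := by
          rw [← abs_mul]; exact abs_add_le _ _
      _ ≤ 2 * ((2 ^ s.card - 1) * a) + a := by
          gcongr; exact ht i
      _ = _ := by ring

lemma sum_ker {q : ℕ} (s : Fin q) : ∑ τ, ker q s τ = 0 := by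
  simp [ker, sum_sub_distrib]

lemma sum_ker_left {q : ℕ} (τ : Fin q) : ∑ s, ker q s τ = 0 := by
  simp only [ker_symm _ τ, sum_ker]

lemma sum_ker_mul_ker {q : ℕ} (τ τ' : Fin q) : ∑ s, ker q s τ * ker q s τ' = q * ker q τ τ' := by
  have : ∀ s, ker q s τ * ker q s τ' = (if s = τ then q * ker q τ τ' else 0) - ker q τ' s := by
    intro s
    unfold ker
    by_cases h1 : s = τ <;> by_cases h2 : τ' = s
    · subst h1; subst h2; simp; ring
    · subst h1; have : s ≠ τ' := fun h => h2 h.symm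
      simp [this, h2]; ring
    · subst h2; simp [h1]
    · have : s ≠ τ' := fun h => h2 h.symm
      simp [this, h2, h1]
  simp only [this, sum_sub_distrib, sum_ker, sub_zero]
  simp

lemma sum_sum_ker_sq (q : ℕ) : ∑ s : Fin q, ∑ τ, ker q s τ ^ 2 = q ^ 2 * (q - 1) := by
  rw [sum_comm]
  have : ∀ τ : Fin q, ∑ s, ker q s τ ^ 2 = q * (q - 1) := by
    intro τ
    simp only [sq, sum_ker_mul_ker]
    simp [ker]
  simp only [this]
  simp; ring

/-- Slight perturbations of the uniform distribution. -/
noncomputable def pert (q : ℕ) (ε : ℝ) (s τ : Fin q) : ℝ := (q : ℝ)⁻¹ * (1 + ε * ker q s τ)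

variable {q : ℕ}

lemma isMixture_pert (hq : 3 ≤ q) {ε : ℝ} (h0 : 0 ≤ ε) (h1 : ε ≤ 1) :
    IsMixture q (fun _ : Fin q => (q : ℝ)⁻¹) (pert q ε) := by
  have hq' : (q : ℝ) ≠ 0 := by positivity
  have h3 : (3 : ℝ) ≤ q := by exact_mod_cast hq
  refine ⟨fun _ => by positivity, by simp [hq'], fun v => ⟨fun τ => ?_, ?_⟩, fun s => ?_⟩
  · refine mul_nonneg (by positivity) ?_
    unfold ker; split_ifs <;> nlinarith
  · simp only [pert, ← mul_sum, sum_add_distrib, sum_ker]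
    simp [hq']
  · simp only [pert, ← mul_sum, sum_add_distrib, sum_ker_left]
    simp [hq']

lemma vertexZ_pert (hq : 3 ≤ q) (lam ε : ℝ) {γ : ℕ} (f : Fin γ → Fin q) :
    vertexZ q lam (fun i => pert q ε (f i))
      = (q : ℝ)⁻¹ * ∑ τ, ∏ i, (1 + lam * ε * ker q (f i) τ) := by
  have hq' : (q : ℝ) ≠ 0 := by positivity
  unfold vertexZ pert
  congr 1
  refine sum_congr rfl fun τ _ => prod_congr rfl fun i _ => ?_
  field_simp; ring

lemma edgeZ_pert (hq : 3 ≤ q) (lam ε : ℝ) (s s' : Fin q) :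
    edgeZ q lam (pert q ε s) (pert q ε s') = 1 + lam * ε ^ 2 * ker q s s' := by
  have hq' : (q : ℝ) ≠ 0 := by positivity
  have h1 : ∑ τ, pert q ε s τ * pert q ε s' τ
      = (q : ℝ)⁻¹ ^ 2 * (q + ε ^ 2 * (q * ker q s s')) := by
    have : ∀ τ, pert q ε s τ * pert q ε s' τ = (q : ℝ)⁻¹ ^ 2 *
        (1 + ε * ker q s τ + ε * ker q s' τ + ε ^ 2 * (ker q τ s * ker q τ s')) := by
      intro τ; unfold pert; rw [ker_symm τ s, ker_symm τ s']; ring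
    simp only [this, ← mul_sum, sum_add_distrib, sum_ker, sum_ker_mul_ker]
    simp
  unfold edgeZ
  rw [h1]; field_simp; ring

lemma sum_vertexZ_sq_pert (hq : 3 ≤ q) (lam ε : ℝ) (γ : ℕ) :
    ∑ f : Fin γ → Fin q, (∏ _i : Fin γ, (q : ℝ)⁻¹) * vertexZ q lam (fun i => pert q ε (f i)) ^ 2
      = (q : ℝ)⁻¹ ^ 2 * ∑ τ : Fin q, ∑ τ', (1 + lam ^ 2 * ε ^ 2 * ker q τ τ') ^ γ := by
  have hq' : (q : ℝ) ≠ 0 := by positivity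
  have h1 : ∀ τ τ' : Fin q, (1 + lam ^ 2 * ε ^ 2 * ker q τ τ') ^ γ
      = ∑ f : Fin γ → Fin q, ∏ i, ((q : ℝ)⁻¹ *
        ((1 + lam * ε * ker q (f i) τ) * (1 + lam * ε * ker q (f i) τ'))) := by
    intro τ τ'
    rw [← Fintype.sum_pow
      (fun s => (q : ℝ)⁻¹ * ((1 + lam * ε * ker q s τ) * (1 + lam * ε * ker q s τ')))]
    congr 1
    have : ∀ s, (q : ℝ)⁻¹ * ((1 + lam * ε * ker q s τ) * (1 + lam * ε * ker q s τ'))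
        = (q : ℝ)⁻¹ * (1 + lam * ε * ker q τ s + lam * ε * ker q τ' s
          + lam ^ 2 * ε ^ 2 * (ker q s τ * ker q s τ')) := by
      intro s; rw [ker_symm τ s, ker_symm τ' s]; ring
    simp only [this, ← mul_sum, sum_add_distrib, sum_ker, sum_ker_mul_ker]
    simp; field_simp
  simp only [h1]
  have h2 : ∀ f : Fin γ → Fin q,
      (∏ _i : Fin γ, (q : ℝ)⁻¹) * vertexZ q lam (fun i => pert q ε (f i)) ^ 2
      = (q : ℝ)⁻¹ ^ 2 * ∑ τ : Fin q, ∑ τ' : Fin q, ∏ i, ((q : ℝ)⁻¹ *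
        ((1 + lam * ε * ker q (f i) τ) * (1 + lam * ε * ker q (f i) τ'))) := by
    intro f
    simp only [prod_mul_distrib, vertexZ_pert hq, ← mul_sum, ← sum_mul]
    ring
  simp only [h2, ← mul_sum]
  congr 1
  rw [sum_comm]
  refine sum_congr rfl fun τ _ => ?_
  rw [sum_comm]

lemma vertexEnt_pert_ge {lam : ℝ} (hP : PottsPar q lam) (γ : ℕ) : ∃ B : ℝ, ∀ ε : ℝ, 0 ≤ ε →
    2 ^ γ * (8 * ε) ≤ 1 → (1 / 2 - 2 ^ γ * (4 * ε)) *
      (γ * (γ - 1) / 2 * (lam ^ 4 * (q - 1)) - B * ε ^ 2) * ε ^ 4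
      ≤ vertexEnt q lam (fun _ => (q : ℝ)⁻¹) (pert q ε) γ := by
  have hq := hP.1
  have hq' : (q : ℝ) ≠ 0 := by positivity
  obtain ⟨B, hB, hpow⟩ := exists_one_add_pow_bound γ
  refine ⟨B, fun ε h0 h1 => ?_⟩
  have h2 : (1 : ℝ) ≤ 2 ^ γ := one_le_pow₀ (by norm_num)
  have hε : ε ≤ 1 / 8 := by nlinarith
  have hm := isMixture_pert hq h0 (by linarith)
  set Z : (Fin γ → Fin q) → ℝ := fun f => vertexZ q lam (fun i => pert q ε (f i)) with hZ
  set W : ℝ := ∏ _i : Fin γ, (q : ℝ)⁻¹ with hW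
  have hW0 : 0 ≤ W := by positivity
  have hs1 : ∑ f, W * Z f = 1 := hm.sum_vertexZ hq lam γ
  have hs0 : ∑ _f : Fin γ → Fin q, W = 1 := hm.sum_prod γ
  have hlam1 : |lam| ≤ 1 := by
    have := hP.neg_half_lt; have := hP.2.1
    rw [abs_le]; constructor <;> linarith
  have hsup : ∀ f, |Z f - 1| ≤ 2 ^ γ * ε := by
    intro f
    have e1 : Z f - 1 = (q : ℝ)⁻¹ * ∑ τ, (∏ i, (1 + lam * ε * ker q (f i) τ) - 1) := by
      simp only [hZ]
      rw [vertexZ_pert hq, sum_sub_distrib, mul_sub]; simp [hq']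
    rw [e1, abs_mul, abs_of_nonneg (by positivity), inv_mul_le_iff₀ (by positivity)]
    calc |∑ τ, (∏ i, (1 + lam * ε * ker q (f i) τ) - 1)|
        ≤ ∑ τ, |∏ i, (1 + lam * ε * ker q (f i) τ) - 1| := abs_sum_le_sum_abs _ _
      _ ≤ ∑ _τ : Fin q, 2 ^ γ * ε := by
          refine sum_le_sum fun τ _ => ?_
          have := abs_prod_one_add_sub_one_le (univ : Finset (Fin γ)) (a := ε)
            (t := fun i => lam * ε * ker q (f i) τ) (by linarith) fun i => by
              rw [mul_right_comm, abs_mul, abs_of_nonneg h0]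
              exact mul_le_of_le_one_left h0 (abs_tilt_le hP _ _)
          rw [card_univ, Fintype.card_fin] at this
          nlinarith
      _ = _ := by simp
  have hvar : γ * (γ - 1) / 2 * (lam ^ 4 * (q - 1)) * ε ^ 4 - B * ε ^ 6
      ≤ ∑ f, W * (Z f - 1) ^ 2 := by
    have e1 : ∑ f, W * (Z f - 1) ^ 2 = ∑ f, W * Z f ^ 2 - 1 := by
      have : ∀ f, W * (Z f - 1) ^ 2 = W * Z f ^ 2 - 2 * (W * Z f) + W := fun f => by ring
      simp only [this, sum_add_distrib, sum_sub_distrib, ← mul_sum, hs1, hs0]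
      ring
    rw [e1, sum_vertexZ_sq_pert hq]
    have e2 : ∀ τ τ' : Fin q, 1 + γ * (lam ^ 2 * ε ^ 2 * ker q τ τ')
        + γ * (γ - 1) / 2 * (lam ^ 2 * ε ^ 2 * ker q τ τ') ^ 2 - B * ε ^ 6
        ≤ (1 + lam ^ 2 * ε ^ 2 * ker q τ τ') ^ γ := by
      intro τ τ'
      have ht : |lam ^ 2 * ε ^ 2 * ker q τ τ'| ≤ ε ^ 2 := by
        have : lam ^ 2 * ε ^ 2 * ker q τ τ' = lam * (lam * ker q τ τ') * ε ^ 2 := by ring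
        rw [this, abs_mul, abs_mul, abs_of_nonneg (sq_nonneg ε)]
        exact mul_le_of_le_one_left (sq_nonneg ε)
          (mul_le_one₀ hlam1 (abs_nonneg _) (abs_tilt_le hP _ _))
      have h3 := (abs_le.1 (hpow _ (ht.trans (by nlinarith)))).1
      have h4 : |lam ^ 2 * ε ^ 2 * ker q τ τ'| ^ 3 ≤ ε ^ 6 := by
        calc _ ≤ (ε ^ 2) ^ 3 := pow_le_pow_left₀ (abs_nonneg _) ht 3
          _ = _ := by ring
      nlinarith [mul_le_mul_of_nonneg_left h4 hB]
    have e3 : ∑ τ : Fin q, ∑ τ', (1 + γ * (lam ^ 2 * ε ^ 2 * ker q τ τ')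
        + γ * (γ - 1) / 2 * (lam ^ 2 * ε ^ 2 * ker q τ τ') ^ 2 - B * ε ^ 6)
        = q ^ 2 * (1 + γ * (γ - 1) / 2 * (lam ^ 4 * (q - 1)) * ε ^ 4 - B * ε ^ 6) := by
      simp only [mul_pow, sum_sub_distrib, sum_add_distrib, ← mul_sum, sum_ker, sum_sum_ker_sq]
      simp; ring
    have e4 := sum_le_sum fun τ (_ : τ ∈ univ) => sum_le_sum fun τ' (_ : τ' ∈ univ) => e2 τ τ'
    rw [e3] at e4
    have e5 := mul_le_mul_of_nonneg_left e4 (show 0 ≤ (q : ℝ)⁻¹ ^ 2 by positivity)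
    rw [← mul_assoc, ← mul_pow, inv_mul_cancel₀ hq', one_pow, one_mul] at e5
    linarith
  have hlow : (1 / 2 - 2 ^ γ * (4 * ε)) * ∑ f, W * (Z f - 1) ^ 2
      ≤ vertexEnt q lam (fun _ => (q : ℝ)⁻¹) (pert q ε) γ := by
    have e1 : (1 / 2 - 2 ^ γ * (4 * ε)) * ∑ f, W * (Z f - 1) ^ 2
        = ∑ f, W * ((Z f - 1) + (1 / 2 - 2 ^ γ * (4 * ε)) * (Z f - 1) ^ 2) := by
      have : ∀ f, W * ((Z f - 1) + (1 / 2 - 2 ^ γ * (4 * ε)) * (Z f - 1) ^ 2)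
          = W * Z f - W + (1 / 2 - 2 ^ γ * (4 * ε)) * (W * (Z f - 1) ^ 2) := fun f => by ring
      simp only [this, sum_add_distrib, sum_sub_distrib, ← mul_sum, hs1, hs0]
      ring
    rw [e1]
    refine sum_le_sum fun f _ => mul_le_mul_of_nonneg_left ?_ hW0
    have h3 := hsup f
    have h4 := (abs_le.1 (abs_LamFn_one_add_sub_le (t := Z f - 1) (by linarith))).1
    rw [add_sub_cancel] at h4
    have h5 : |Z f - 1| ^ 3 ≤ 2 ^ γ * ε * (Z f - 1) ^ 2 := by
      rw [pow_succ, sq_abs, mul_comm]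
      exact mul_le_mul_of_nonneg_right h3 (sq_nonneg _)
    change _ ≤ LamFn (Z f)
    nlinarith
  refine le_trans ?_ hlow
  rw [mul_assoc]
  refine mul_le_mul_of_nonneg_left (le_trans (le_of_eq ?_) hvar) (by linarith)
  ring

lemma edgeEnt_pert_le {lam : ℝ} (hP : PottsPar q lam) {ε : ℝ} (h0 : 0 ≤ ε) (h1 : ε ≤ 1 / 2) :
    edgeEnt q lam (fun _ => (q : ℝ)⁻¹) (pert q ε)
      ≤ (lam ^ 2 * (q - 1) / 2 + 4 * ε ^ 2) * ε ^ 4 := by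
  have hq := hP.1
  have hq' : (q : ℝ) ≠ 0 := by positivity
  have h2 : ∀ s s' : Fin q, LamFn (edgeZ q lam (pert q ε s) (pert q ε s'))
      ≤ lam * ε ^ 2 * ker q s s' + (lam * ε ^ 2 * ker q s s') ^ 2 / 2 + 4 * ε ^ 6 := by
    intro s s'
    rw [edgeZ_pert hq]
    have ht : |lam * ε ^ 2 * ker q s s'| ≤ ε ^ 2 := by
      rw [mul_right_comm, abs_mul, abs_of_nonneg (sq_nonneg ε)]
      exact mul_le_of_le_one_left (sq_nonneg ε) (abs_tilt_le hP _ _)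
    have h3 := (abs_le.1 (abs_LamFn_one_add_sub_le (ht.trans (by nlinarith)))).2
    have h4 : |lam * ε ^ 2 * ker q s s'| ^ 3 ≤ ε ^ 6 := by
      calc _ ≤ (ε ^ 2) ^ 3 := pow_le_pow_left₀ (abs_nonneg _) ht 3
        _ = _ := by ring
    linarith
  calc edgeEnt q lam (fun _ => (q : ℝ)⁻¹) (pert q ε)
      ≤ ∑ s : Fin q, ∑ s' : Fin q, (q : ℝ)⁻¹ * (q : ℝ)⁻¹ *
        (lam * ε ^ 2 * ker q s s' + (lam * ε ^ 2 * ker q s s') ^ 2 / 2 + 4 * ε ^ 6) :=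
        sum_le_sum fun s _ => sum_le_sum fun s' _ =>
          mul_le_mul_of_nonneg_left (h2 s s') (by positivity)
    _ = _ := by
        simp only [mul_pow, sum_add_distrib, ← mul_sum, ← sum_div, sum_ker, sum_sum_ker_sq]
        simp; field_simp

/-- The condensation threshold does not exceed the Kesten–Stigum threshold. -/
theorem mul_sq_lt_one_of_lt_dcond (hq : 3 ≤ q) {β d : ℝ} (hβ : 0 < β) (hd : 0 < d)
    (hdc : d < dcond q β) : d * pottsLam q β ^ 2 < 1 := by
  have hP := pottsPar_pottsLam hq hβ
  set lam := pottsLam q β with hlam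
  have hq3 := hP.q_pos
  have key : ∀ d', 0 < d' → d' < dcond q β → d' * lam ^ 2 ≤ 1 := by
    intro d' hd' hdc'
    choose B hB using fun γ => vertexEnt_pert_ge hP γ
    have hpartial : ∀ Γ : ℕ, ∑ γ ∈ range Γ, poisWt d' γ * (1 / 2 * (γ * (γ - 1) / 2 *
        (lam ^ 4 * (q - 1)))) ≤ d' / 2 * (lam ^ 2 * (q - 1) / 2) := by
      intro Γ
      have hF : Continuous fun ε : ℝ => ∑ γ ∈ range Γ, poisWt d' γ *
          ((1 / 2 - 2 ^ γ * (4 * ε)) * (γ * (γ - 1) / 2 * (lam ^ 4 * (q - 1)) - B γ * ε ^ 2)) := by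
        fun_prop
      have hG : Continuous fun ε : ℝ => d' / 2 * (lam ^ 2 * (q - 1) / 2 + 4 * ε ^ 2) := by fun_prop
      have tF := (hF.tendsto 0).mono_left (nhdsWithin_le_nhds (s := Set.Ioi 0))
      have tG := (hG.tendsto 0).mono_left (nhdsWithin_le_nhds (s := Set.Ioi 0))
      have hle := le_of_tendsto_of_tendsto tF tG ?_
      · simpa using hle
      have hpos : (0 : ℝ) < (2 ^ Γ * 8)⁻¹ := by positivity
      filter_upwards [Ioo_mem_nhdsGT hpos] with ε hε
      have hε0 : 0 < ε := hε.1
      have hε1 : 2 ^ Γ * (8 * ε) ≤ 1 := by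
        have := hε.2.le
        rw [le_inv_comm₀ hε0 (by positivity)] at this
        have := mul_le_mul_of_nonneg_right this hε0.le
        rw [inv_mul_cancel₀ hε0.ne'] at this
        linarith
      have h2 : (1 : ℝ) ≤ 2 ^ Γ := one_le_pow₀ (by norm_num)
      have hε2 : ε ≤ 1 / 8 := by nlinarith
      have hb := bethe_le hq hβ hd' hdc' (isMixture_pert hq hε0.le (by linarith)) Γ
      have he := edgeEnt_pert_le hP hε0.le (by linarith)
      have hv : ∀ γ ∈ range Γ, poisWt d' γ * ((1 / 2 - 2 ^ γ * (4 * ε)) *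
          (γ * (γ - 1) / 2 * (lam ^ 4 * (q - 1)) - B γ * ε ^ 2)) * ε ^ 4
          ≤ poisWt d' γ * vertexEnt q lam (fun _ => (q : ℝ)⁻¹) (pert q ε) γ := by
        intro γ hγ
        rw [mul_assoc]
        refine mul_le_mul_of_nonneg_left (hB γ ε hε0.le ?_) (poisWt_nonneg hd'.le γ)
        refine le_trans (mul_le_mul_of_nonneg_right ?_ (by positivity)) hε1
        exact pow_le_pow_right₀ (by norm_num) (mem_range.1 hγ).le
      have hsum := sum_le_sum hv
      rw [← sum_mul] at hsum
      have hfin := hsum.trans (hb.trans (mul_le_mul_of_nonneg_left he (by positivity)))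
      rw [← mul_assoc] at hfin
      exact le_of_mul_le_mul_right hfin (by positivity)
    have hs : HasSum (fun γ : ℕ => poisWt d' γ * (γ * (γ - 1))) (d' * d') := by
      rw [← hasSum_nat_add_iff' 1]
      have : (fun n : ℕ => poisWt d' (n + 1) * (((n + 1 : ℕ) : ℝ) * (((n + 1 : ℕ) : ℝ) - 1)))
          = fun n => d' * (poisWt d' n * n) := by
        funext n
        have := poisWt_succ d' n
        push_cast
        linear_combination (n : ℝ) * this
      rw [this]
      simpa using (poisWt_mul_hasSum d').mul_left d'
    have hs2 := (hs.mul_right (1 / 4 * (lam ^ 4 * (q - 1)))).tendsto_sum_nat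
    have hle := le_of_tendsto' hs2 fun Γ => (le_of_eq (sum_congr rfl fun γ _ => by ring)).trans
      (hpartial Γ)
    have hl2 : 0 < lam ^ 2 := sq_pos_of_neg hP.2.1
    have hfac : 0 < d' / 4 * lam ^ 2 * ((q : ℝ) - 1) :=
      mul_pos (by positivity) (by linarith)
    have : d' / 4 * lam ^ 2 * ((q : ℝ) - 1) * (d' * lam ^ 2)
        ≤ d' / 4 * lam ^ 2 * ((q : ℝ) - 1) * 1 := by nlinarith
    exact le_of_mul_le_mul_left this hfac
  obtain ⟨d', h1, h2⟩ := exists_between hdc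
  have hl2 : 0 < lam ^ 2 := sq_pos_of_neg hP.2.1
  have := key d' (hd.trans h1) h2
  nlinarith

end KestenStigum

section Gibbs

variable {O X : Type*} [Fintype O] [Fintype X]

/-- Total weight of an observation. -/
def mass (m : O → X → ℝ) (o : O) : ℝ := ∑ x, m o x

/-- Unnormalized conditional expectation given an observation. -/
def cm (m : O → X → ℝ) (o : O) (f : X → ℝ) : ℝ := ∑ x, m o x * f x

/-- Conditional expectation given an observation. -/
noncomputable def gib (m : O → X → ℝ) (o : O) (f : X → ℝ) : ℝ := cm m o f / mass m o

/-- Expected square of the conditional expectation. -/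
noncomputable def energy (m : O → X → ℝ) (f : X → ℝ) : ℝ := ∑ o, cm m o f ^ 2 / mass m o

variable {m : O → X → ℝ}

lemma mass_nonneg (hm : ∀ o x, 0 ≤ m o x) (o : O) : 0 ≤ mass m o := sum_nonneg fun x _ => hm o x

lemma cm_const (o : O) (a : ℝ) : cm m o (fun _ => a) = mass m o * a := by
  simp [cm, mass, sum_mul]

lemma cm_add (o : O) (f g : X → ℝ) : cm m o (fun x => f x + g x) = cm m o f + cm m o g := by
  simp [cm, mul_add, sum_add_distrib]

lemma cm_mul (o : O) (a : ℝ) (f : X → ℝ) : cm m o (fun x => a * f x) = a * cm m o f := by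
  simp only [cm, mul_sum]; exact sum_congr rfl fun _ _ => by ring

lemma cm_sum {κ : Type*} (s : Finset κ) (o : O) (f : κ → X → ℝ) :
    cm m o (fun x => ∑ k ∈ s, f k x) = ∑ k ∈ s, cm m o (f k) := by
  simp only [cm, mul_sum]; exact sum_comm

lemma cm_mono (hm : ∀ o x, 0 ≤ m o x) (o : O) {f g : X → ℝ} (h : ∀ x, f x ≤ g x) :
    cm m o f ≤ cm m o g := sum_le_sum fun x _ => mul_le_mul_of_nonneg_left (h x) (hm o x)

lemma abs_cm_le (hm : ∀ o x, 0 ≤ m o x) (o : O) (f : X → ℝ) :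
    |cm m o f| ≤ cm m o (fun x => |f x|) := by
  refine (abs_sum_le_sum_abs _ _).trans (le_of_eq (sum_congr rfl fun x _ => ?_))
  rw [abs_mul, abs_of_nonneg (hm o x)]

lemma cm_eq_zero (hm : ∀ o x, 0 ≤ m o x) {o : O} (h : mass m o = 0) (f : X → ℝ) : cm m o f = 0 := by
  have := (sum_eq_zero_iff_of_nonneg fun x _ => hm o x).1 h
  exact sum_eq_zero fun x hx => by rw [this x hx, zero_mul]

lemma mass_mul_gib (hm : ∀ o x, 0 ≤ m o x) (o : O) (f : X → ℝ) :
    mass m o * gib m o f = cm m o f := by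
  unfold gib
  by_cases h : mass m o = 0
  · rw [cm_eq_zero hm h, h, zero_mul]
  · field_simp

lemma gib_le (hm : ∀ o x, 0 ≤ m o x) (o : O) {f : X → ℝ} {a : ℝ} (ha : 0 ≤ a) (h : ∀ x, f x ≤ a) :
    gib m o f ≤ a := by
  refine div_le_of_le_mul₀ (mass_nonneg hm o) ha ?_
  rw [mul_comm, ← cm_const]; exact cm_mono hm o h

lemma le_gib (hm : ∀ o x, 0 ≤ m o x) {o : O} (ho : mass m o ≠ 0) {f : X → ℝ} {a : ℝ}
    (h : ∀ x, a ≤ f x) : a ≤ gib m o f := by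
  have h0 := (mass_nonneg hm o).lt_of_ne' ho
  unfold gib
  rw [le_div_iff₀ h0, mul_comm, ← cm_const]; exact cm_mono hm o h

lemma abs_gib_le (hm : ∀ o x, 0 ≤ m o x) (o : O) {f : X → ℝ} {a : ℝ} (ha : 0 ≤ a)
    (h : ∀ x, |f x| ≤ a) : |gib m o f| ≤ a := by
  unfold gib
  rw [abs_div, abs_of_nonneg (mass_nonneg hm o)]
  refine div_le_of_le_mul₀ (mass_nonneg hm o) ha ?_
  rw [mul_comm, ← cm_const]; exact (abs_cm_le hm o f).trans (cm_mono hm o h)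

lemma gib_affine {o : O} (ho : mass m o ≠ 0) (a b : ℝ) (f : X → ℝ) :
    gib m o (fun x => a + b * f x) = a + b * gib m o f := by
  unfold gib
  rw [cm_add, cm_const, cm_mul]; field_simp

variable {q n : ℕ}

/-- Observing in addition the colors of the vertices `v`. -/
def pin {t : ℕ} (m : O → (Fin n → Fin q) → ℝ) (v : Fin t → Fin n) :
    O × (Fin t → Fin q) → (Fin n → Fin q) → ℝ :=
  fun oy σ => if σ ∘ v = oy.2 then m oy.1 σ else 0

variable {m : O → (Fin n → Fin q) → ℝ} {t : ℕ}

lemma pin_nonneg (hm : ∀ o x, 0 ≤ m o x) (v : Fin t → Fin n) : ∀ o x, 0 ≤ pin m v o x := by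
  intro o x; unfold pin; split_ifs
  exacts [hm _ _, le_rfl]

lemma sum_cm_pin (v : Fin t → Fin n) (o : O) (A : (Fin t → Fin q) → ℝ) (f : (Fin n → Fin q) → ℝ) :
    ∑ y, A y * cm (pin m v) (o, y) f = cm m o (fun σ => A (σ ∘ v) * f σ) := by
  simp only [cm, pin, mul_sum]
  rw [sum_comm]
  refine sum_congr rfl fun σ _ => ?_
  rw [sum_eq_single (σ ∘ v)]
  · simp; ring
  · intro y _ hy; simp [hy.symm]
  · simp

lemma mass_eq_cm (o : O) : mass m o = cm m o (fun _ => 1) := by simp [mass, cm]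

lemma sum_mass_pin (v : Fin t → Fin n) (o : O) : ∑ y, mass (pin m v) (o, y) = mass m o := by
  have := sum_cm_pin (m := m) v o (fun _ => 1) (fun _ => 1)
  simpa [mass_eq_cm] using this

lemma sum_pin (v : Fin t → Fin n) (σ : Fin n → Fin q) : ∑ o, pin m v o σ = ∑ o, m o σ := by
  rw [Fintype.sum_prod_type]
  refine sum_congr rfl fun o _ => ?_
  simp [pin]

lemma energy_sub_eq (hm : ∀ o x, 0 ≤ m o x) (v : Fin t → Fin n) (f : (Fin n → Fin q) → ℝ) :
    energy (pin m v) f - energy m f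
      = ∑ oy : O × (Fin t → Fin q),
        (cm (pin m v) oy f - mass (pin m v) oy * gib m oy.1 f) ^ 2 / mass (pin m v) oy := by
  have hp := pin_nonneg hm v
  have h1 : ∀ oy : O × (Fin t → Fin q),
      (cm (pin m v) oy f - mass (pin m v) oy * gib m oy.1 f) ^ 2 / mass (pin m v) oy
      = cm (pin m v) oy f ^ 2 / mass (pin m v) oy - 2 * gib m oy.1 f * cm (pin m v) oy f
        + gib m oy.1 f ^ 2 * mass (pin m v) oy := by
    intro oy
    by_cases h : mass (pin m v) oy = 0
    · simp [h, cm_eq_zero hp h]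
    · field_simp; ring
  simp only [h1, sum_add_distrib, sum_sub_distrib]
  have h2 : ∑ oy : O × (Fin t → Fin q), 2 * gib m oy.1 f * cm (pin m v) oy f
      = 2 * energy m f := by
    rw [Fintype.sum_prod_type, energy, mul_sum]
    refine sum_congr rfl fun o _ => ?_
    change ∑ y, 2 * gib m o f * cm (pin m v) (o, y) f = _
    rw [← mul_sum]
    have := sum_cm_pin (m := m) v o (fun _ => 1) f
    simp only [one_mul] at this
    rw [this, gib]; ring
  have h3 : ∑ oy : O × (Fin t → Fin q), gib m oy.1 f ^ 2 * mass (pin m v) oy = energy m f := by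
    rw [Fintype.sum_prod_type, energy]
    refine sum_congr rfl fun o _ => ?_
    change ∑ y, gib m o f ^ 2 * mass (pin m v) (o, y) = _
    rw [← mul_sum, sum_mass_pin, gib]
    by_cases h : mass m o = 0
    · simp [h]
    · field_simp
  rw [h2, h3]
  unfold energy
  ring

lemma energy_le_pin (hm : ∀ o x, 0 ≤ m o x) (v : Fin t → Fin n) (f : (Fin n → Fin q) → ℝ) :
    0 ≤ energy (pin m v) f - energy m f := by
  rw [energy_sub_eq hm]
  exact sum_nonneg fun oy _ => div_nonneg (sq_nonneg _) (mass_nonneg (pin_nonneg hm v) oy)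

/-- Covariances are controlled by the energy gained by pinning. -/
lemma sum_abs_cov_le (hm : ∀ o x, 0 ≤ m o x) (htot : ∑ o, mass m o ≤ 1) (v : Fin t → Fin n)
    {A : (Fin t → Fin q) → ℝ} {K : ℝ} (hK : 0 ≤ K) (hA : ∀ y, |A y| ≤ K) (f : (Fin n → Fin q) → ℝ) :
    ∑ o, |cm m o (fun σ => A (σ ∘ v) * f σ) - cm m o (fun σ => A (σ ∘ v)) * gib m o f|
      ≤ K * √(energy (pin m v) f - energy m f) := by
  have hp := pin_nonneg hm v
  have h1 : ∀ o, |cm m o (fun σ => A (σ ∘ v) * f σ) - cm m o (fun σ => A (σ ∘ v)) * gib m o f|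
      ≤ ∑ y, K * |cm (pin m v) (o, y) f - mass (pin m v) (o, y) * gib m o f| := by
    intro o
    have e1 : cm m o (fun σ => A (σ ∘ v)) = ∑ y, A y * mass (pin m v) (o, y) := by
      have := sum_cm_pin (m := m) v o A (fun _ => 1)
      simpa [mass_eq_cm] using this.symm
    rw [← sum_cm_pin, e1, sum_mul, ← sum_sub_distrib]
    refine (abs_sum_le_sum_abs _ _).trans (sum_le_sum fun y _ => ?_)
    rw [mul_assoc, ← mul_sub, abs_mul]
    exact mul_le_mul_of_nonneg_right (hA y) (abs_nonneg _)
  refine (sum_le_sum fun o _ => h1 o).trans ?_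
  rw [← Fintype.sum_prod_type' (f := fun o y =>
    K * |cm (pin m v) (o, y) f - mass (pin m v) (o, y) * gib m o f|), ← mul_sum]
  refine mul_le_mul_of_nonneg_left ?_ hK
  rw [energy_sub_eq hm]
  have h2 : ∀ oy : O × (Fin t → Fin q),
      |cm (pin m v) (oy.1, oy.2) f - mass (pin m v) (oy.1, oy.2) * gib m oy.1 f|
      = √(mass (pin m v) oy) *
        √((cm (pin m v) oy f - mass (pin m v) oy * gib m oy.1 f) ^ 2 / mass (pin m v) oy) := by
    intro oy
    by_cases h : mass (pin m v) oy = 0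
    · simp [h, cm_eq_zero hp h]
    · rw [← Real.sqrt_mul (mass_nonneg hp oy), mul_div_cancel₀ _ h, Real.sqrt_sq_eq_abs]
  simp only [h2]
  refine (Real.sum_sqrt_mul_sqrt_le univ (fun oy => mass_nonneg hp oy)
    (fun oy => div_nonneg (sq_nonneg _) (mass_nonneg hp oy))).trans ?_
  refine mul_le_of_le_one_left (Real.sqrt_nonneg _) ?_
  refine Real.sqrt_le_one.2 ?_
  rw [Fintype.sum_prod_type]
  simpa only [sum_mass_pin] using htot

end Gibbs

section Decorrelation

lemma sum_mul_sqrt_le {κ : Type*} (s : Finset κ) {w x : κ → ℝ} {W : ℝ} (hw : ∀ k, 0 ≤ w k)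
    (hx : ∀ k, 0 ≤ x k) (hW : ∑ k ∈ s, w k ≤ W) :
    ∑ k ∈ s, w k * √(x k) ≤ √W * √(∑ k ∈ s, w k * x k) := by
  have h := Real.sum_sqrt_mul_sqrt_le s hw (fun k => mul_nonneg (hw k) (hx k))
  refine le_trans (le_of_eq (sum_congr rfl fun k _ => ?_))
    (h.trans (mul_le_mul_of_nonneg_right (Real.sqrt_le_sqrt hW) (Real.sqrt_nonneg _)))
  rw [Real.sqrt_mul (hw k), ← mul_assoc, Real.mul_self_sqrt (hw k)]

variable {O : Type*} [Fintype O] {q n : ℕ}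

/-- Indicator of the event that `v` has color `τ`. -/
def colInd (v : Fin n) (τ : Fin q) (σ : Fin n → Fin q) : ℝ := if σ v = τ then 1 else 0

lemma colInd_nonneg (v : Fin n) (τ : Fin q) (σ : Fin n → Fin q) : 0 ≤ colInd v τ σ := by
  unfold colInd; split_ifs <;> norm_num

lemma colInd_le_one (v : Fin n) (τ : Fin q) (σ : Fin n → Fin q) : colInd v τ σ ≤ 1 := by
  unfold colInd; split_ifs <;> norm_num

lemma sum_colInd (v : Fin n) (σ : Fin n → Fin q) : ∑ τ, colInd v τ σ = 1 := by
  simp [colInd]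

/-- Average energy of the color indicators. -/
noncomputable def colEnergy (m : O → (Fin n → Fin q) → ℝ) : ℝ :=
  (n : ℝ)⁻¹ * ∑ v, ∑ τ, energy m (colInd v τ)

/-- Average energy of the color indicators after pinning `t` random vertices. -/
noncomputable def pinEnergy (m : O → (Fin n → Fin q) → ℝ) (t : ℕ) : ℝ :=
  ((n : ℝ) ^ t)⁻¹ * ∑ v : Fin t → Fin n, colEnergy (pin m v)

variable {m : O → (Fin n → Fin q) → ℝ}

lemma colEnergy_nonneg (hm : ∀ o x, 0 ≤ m o x) : 0 ≤ colEnergy m :=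
  mul_nonneg (by positivity) (sum_nonneg fun v _ => sum_nonneg fun τ _ => sum_nonneg fun o _ =>
    div_nonneg (sq_nonneg _) (mass_nonneg hm o))

lemma colEnergy_le_one (hm : ∀ o x, 0 ≤ m o x) (htot : ∑ o, mass m o ≤ 1) : colEnergy m ≤ 1 := by
  have h1 : ∀ v : Fin n, ∑ τ, energy m (colInd v τ) ≤ 1 := by
    intro v
    unfold energy
    rw [sum_comm]
    refine le_trans (sum_le_sum fun o _ => ?_) htot
    have h2 : ∑ τ, cm m o (colInd v τ) = mass m o := by
      rw [← cm_sum]; simp only [sum_colInd, cm_const, mul_one]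
    refine le_trans (sum_le_sum fun τ _ => ?_) h2.le
    have h3 : 0 ≤ cm m o (colInd v τ) :=
      sum_nonneg fun x _ => mul_nonneg (hm o x) (colInd_nonneg v τ x)
    have h4 : cm m o (colInd v τ) ≤ mass m o := by
      rw [mass_eq_cm]; exact cm_mono hm o (colInd_le_one v τ)
    refine div_le_of_le_mul₀ (mass_nonneg hm o) h3 ?_
    rw [sq]; exact mul_le_mul_of_nonneg_left h4 h3
  unfold colEnergy
  calc (n : ℝ)⁻¹ * ∑ v, ∑ τ, energy m (colInd v τ) ≤ (n : ℝ)⁻¹ * ∑ _v : Fin n, 1 :=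
        mul_le_mul_of_nonneg_left (sum_le_sum fun v _ => h1 v) (by positivity)
    _ ≤ 1 := by simpa using inv_mul_le_one_of_le₀ le_rfl (Nat.cast_nonneg n)

lemma sum_mass_pin' {t : ℕ} (v : Fin t → Fin n) : ∑ o, mass (pin m v) o = ∑ o, mass m o := by
  rw [Fintype.sum_prod_type]
  exact sum_congr rfl fun o _ => sum_mass_pin v o

lemma pow_inv_mul_card {t : ℕ} (hn : 0 < n) : ((n : ℝ) ^ t)⁻¹ * ∑ _v : Fin t → Fin n, (1 : ℝ) = 1 := by
  have : (n : ℝ) ≠ 0 := by positivity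
  simp [this]

lemma pinEnergy_nonneg (hm : ∀ o x, 0 ≤ m o x) (t : ℕ) : 0 ≤ pinEnergy m t :=
  mul_nonneg (by positivity) (sum_nonneg fun v _ => colEnergy_nonneg (pin_nonneg hm v))

lemma pinEnergy_le_one (hn : 0 < n) (hm : ∀ o x, 0 ≤ m o x) (htot : ∑ o, mass m o ≤ 1) (t : ℕ) :
    pinEnergy m t ≤ 1 := by
  refine le_trans (mul_le_mul_of_nonneg_left (sum_le_sum fun v _ => ?_) (by positivity))
    (pow_inv_mul_card (t := t) hn).le
  exact colEnergy_le_one (pin_nonneg hm v) (by rwa [sum_mass_pin'])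

lemma pinEnergy_sub (hn : 0 < n) (t : ℕ) :
    pinEnergy m t - colEnergy m = ∑ x : (Fin t → Fin n) × Fin n × Fin q,
      (((n : ℝ) ^ t)⁻¹ * (n : ℝ)⁻¹) *
        (energy (pin m x.1) (colInd x.2.1 x.2.2) - energy m (colInd x.2.1 x.2.2)) := by
  have h := pow_inv_mul_card (t := t) hn
  rw [Fintype.sum_prod_type]
  simp only [Fintype.sum_prod_type]
  simp only [← mul_sum, sum_sub_distrib]
  unfold pinEnergy colEnergy
  simp only [← mul_sum]
  have h2 : ((n : ℝ) ^ t)⁻¹ * ∑ _v : Fin t → Fin n, (∑ v, ∑ τ, energy m (colInd v τ))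
      = ∑ v, ∑ τ, energy m (colInd v τ) := by
    rw [show (∑ _v : Fin t → Fin n, (∑ v, ∑ τ, energy m (colInd v τ)))
      = (∑ _v : Fin t → Fin n, (1 : ℝ)) * (∑ v, ∑ τ, energy m (colInd v τ)) by
        rw [sum_mul]; simp, ← mul_assoc, h, one_mul]
  linear_combination ((n : ℝ)⁻¹) * h2

lemma pinEnergy_sub_nonneg (hn : 0 < n) (hm : ∀ o x, 0 ≤ m o x) (t : ℕ) :
    0 ≤ pinEnergy m t - colEnergy m := by
  rw [pinEnergy_sub hn]
  exact sum_nonneg fun x _ => mul_nonneg (by positivity) (energy_le_pin hm _ _)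

/-- On average over the vertices, functions of few vertices decorrelate from the color of another
vertex, up to the energy gained by pinning. -/
lemma avg_cov_le (hn : 0 < n) (hm : ∀ o x, 0 ≤ m o x) (htot : ∑ o, mass m o ≤ 1) {t : ℕ}
    {A : Fin q → (Fin t → Fin q) → ℝ} {K : ℝ} (hK : 0 ≤ K) (hA : ∀ τ y, |A τ y| ≤ K) :
    ∑ x : (Fin t → Fin n) × Fin n × Fin q, (((n : ℝ) ^ t)⁻¹ * (n : ℝ)⁻¹) *
      ∑ o, |cm m o (fun σ => A x.2.2 (σ ∘ x.1) * colInd x.2.1 x.2.2 σ)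
        - cm m o (fun σ => A x.2.2 (σ ∘ x.1)) * gib m o (colInd x.2.1 x.2.2)|
      ≤ K * (√q * √(pinEnergy m t - colEnergy m)) := by
  have h1 : ∑ x : (Fin t → Fin n) × Fin n × Fin q, (((n : ℝ) ^ t)⁻¹ * (n : ℝ)⁻¹) ≤ q := by
    have hn' : (n : ℝ) ≠ 0 := by positivity
    simp
    rw [show (n : ℝ) ^ t * (n * q) * (((n : ℝ) ^ t)⁻¹ * (n : ℝ)⁻¹) = q by field_simp]
  rw [pinEnergy_sub hn]
  refine le_trans ?_ (mul_le_mul_of_nonneg_left (sum_mul_sqrt_le univ (fun _ => by positivity)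
    (fun x => energy_le_pin hm x.1 (colInd x.2.1 x.2.2)) h1) hK)
  rw [mul_sum]
  refine sum_le_sum fun x _ => ?_
  rw [mul_left_comm]
  exact mul_le_mul_of_nonneg_left (sum_abs_cov_le hm htot x.1 hK (hA x.2.2) _) (by positivity)

/-- The factor of an edge to a vertex of color `τ`. -/
def edgeFac (q : ℕ) (lam : ℝ) (τ c : Fin q) : ℝ := 1 + lam * ker q τ c

/-- The average deviation of the joint conditional law of `γ` random vertices from a product. -/
noncomputable def decorr (lam : ℝ) (m : O → (Fin n → Fin q) → ℝ) (γ : ℕ) : ℝ :=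
  ((n : ℝ) ^ γ)⁻¹ * ∑ v : Fin γ → Fin n, ∑ τ, ∑ o,
    |cm m o (fun σ => ∏ i, edgeFac q lam τ (σ (v i)))
      - mass m o * ∏ i, gib m o (fun σ => edgeFac q lam τ (σ (v i)))|

lemma edgeFac_bounds {lam : ℝ} (hP : PottsPar q lam) (τ c : Fin q) :
    minRatio q lam ≤ edgeFac q lam τ c ∧ edgeFac q lam τ c ≤ 3 / 2 := by
  have := lam_ker_bounds hP τ c
  unfold edgeFac
  constructor <;> linarith [this.1, this.2]

lemma edgeFac_eq {lam : ℝ} (τ : Fin q) (v : Fin n) (σ : Fin n → Fin q) :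
    edgeFac q lam τ (σ v) = (1 - lam) + (lam * q) * colInd v τ σ := by
  unfold edgeFac ker colInd
  simp only [eq_comm (a := τ)]
  ring

lemma abs_lam_mul_q_le {lam : ℝ} (hP : PottsPar q lam) : |lam * q| ≤ 2 := by
  have h2 := hP.q_pos
  have h3 := hP.2.1
  have h4 := hP.2.2
  rw [abs_le]; constructor <;> nlinarith

lemma cov_edgeFac {lam : ℝ} (hm : ∀ o x, 0 ≤ m o x) (o : O) (F : (Fin n → Fin q) → ℝ) (τ : Fin q)
    (v : Fin n) :
    cm m o (fun σ => F σ * edgeFac q lam τ (σ v)) - cm m o F * gib m o (fun σ => edgeFac q lam τ (σ v))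
      = (lam * q) * (cm m o (fun σ => F σ * colInd v τ σ) - cm m o F * gib m o (colInd v τ)) := by
  by_cases h : mass m o = 0
  · simp [cm_eq_zero hm h]
  · have h1 : (fun σ : Fin n → Fin q => edgeFac q lam τ (σ v))
        = fun σ => (1 - lam) + (lam * q) * colInd v τ σ := funext fun σ => edgeFac_eq τ v σ
    have h2 : cm m o (fun σ => F σ * edgeFac q lam τ (σ v))
        = (1 - lam) * cm m o F + (lam * q) * cm m o (fun σ => F σ * colInd v τ σ) := by
      rw [← cm_mul, ← cm_mul, ← cm_add]
      congr 1; funext σ; rw [edgeFac_eq]; ring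
    rw [h1, gib_affine h, h2]; ring

lemma decorr_succ_le {lam : ℝ} (hP : PottsPar q lam) (hn : 0 < n) (hm : ∀ o x, 0 ≤ m o x)
    (htot : ∑ o, mass m o ≤ 1) (γ : ℕ) :
    decorr lam m (γ + 1) ≤ 3 / 2 * decorr lam m γ
      + 2 * (3 / 2) ^ γ * (√q * √(pinEnergy m γ - colEnergy m)) := by
  have hn' : (n : ℝ) ≠ 0 := by positivity
  have hc0 := hP.minRatio_pos
  have key : ∀ (v : Fin γ → Fin n) (w : Fin n) (τ : Fin q) (o : O),
      |cm m o (fun σ => ∏ i : Fin (γ + 1), edgeFac q lam τ (σ ((Fin.cons w v : Fin (γ + 1) → Fin n) i)))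
        - mass m o * ∏ i : Fin (γ + 1),
          gib m o (fun σ => edgeFac q lam τ (σ ((Fin.cons w v : Fin (γ + 1) → Fin n) i)))|
      ≤ 2 * |cm m o (fun σ => (∏ i, edgeFac q lam τ ((σ ∘ v) i)) * colInd w τ σ)
          - cm m o (fun σ => ∏ i, edgeFac q lam τ ((σ ∘ v) i)) * gib m o (colInd w τ)|
        + 3 / 2 * |cm m o (fun σ => ∏ i, edgeFac q lam τ (σ (v i)))
          - mass m o * ∏ i, gib m o (fun σ => edgeFac q lam τ (σ (v i)))| := by
    intro v w τ o
    simp only [Fin.prod_univ_succ, Fin.cons_zero, Fin.cons_succ, Function.comp]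
    have h1 := cov_edgeFac (lam := lam) hm o (fun σ => ∏ i, edgeFac q lam τ (σ (v i))) τ w
    have h2 : |gib m o (fun σ => edgeFac q lam τ (σ w))| ≤ 3 / 2 := by
      refine abs_gib_le hm o (by norm_num) fun σ => ?_
      have := edgeFac_bounds hP τ (σ w)
      rw [abs_le]; constructor <;> linarith [this.1, this.2]
    have h3 := abs_lam_mul_q_le hP
    have h4 : cm m o (fun σ => edgeFac q lam τ (σ w) * ∏ i, edgeFac q lam τ (σ (v i)))
        = cm m o (fun σ => (∏ i, edgeFac q lam τ (σ (v i))) * edgeFac q lam τ (σ w)) := by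
      congr 1; funext σ; ring
    rw [h4, show cm m o (fun σ => (∏ i, edgeFac q lam τ (σ (v i))) * edgeFac q lam τ (σ w))
        - mass m o * (gib m o (fun σ => edgeFac q lam τ (σ w))
          * ∏ i, gib m o (fun σ => edgeFac q lam τ (σ (v i))))
        = (lam * q) * (cm m o (fun σ => (∏ i, edgeFac q lam τ (σ (v i))) * colInd w τ σ)
          - cm m o (fun σ => ∏ i, edgeFac q lam τ (σ (v i))) * gib m o (colInd w τ))
        + gib m o (fun σ => edgeFac q lam τ (σ w)) *
          (cm m o (fun σ => ∏ i, edgeFac q lam τ (σ (v i)))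
          - mass m o * ∏ i, gib m o (fun σ => edgeFac q lam τ (σ (v i)))) by rw [← h1]; ring]
    refine (abs_add_le _ _).trans (add_le_add ?_ ?_)
    · rw [abs_mul]; exact mul_le_mul_of_nonneg_right h3 (abs_nonneg _)
    · rw [abs_mul]; exact mul_le_mul_of_nonneg_right h2 (abs_nonneg _)
  have hcov := avg_cov_le (t := γ) (A := fun τ y => ∏ i, edgeFac q lam τ (y i)) (K := (3 / 2) ^ γ)
    hn hm htot (by positivity) (by
      intro τ y
      rw [abs_of_nonneg (prod_nonneg fun i _ => hc0.le.trans (edgeFac_bounds hP τ (y i)).1)]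
      refine (prod_le_prod (fun i _ => hc0.le.trans (edgeFac_bounds hP τ (y i)).1)
        (fun i _ => (edgeFac_bounds hP τ (y i)).2)).trans (by rw [prod_const, card_univ, Fintype.card_fin]))
  have h5 : decorr lam m (γ + 1) ≤ ((n : ℝ) ^ (γ + 1))⁻¹ * ∑ x : Fin n × (Fin γ → Fin n), ∑ τ, ∑ o,
      (2 * |cm m o (fun σ => (∏ i, edgeFac q lam τ ((σ ∘ x.2) i)) * colInd x.1 τ σ)
          - cm m o (fun σ => ∏ i, edgeFac q lam τ ((σ ∘ x.2) i)) * gib m o (colInd x.1 τ)|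
        + 3 / 2 * |cm m o (fun σ => ∏ i, edgeFac q lam τ (σ (x.2 i)))
          - mass m o * ∏ i, gib m o (fun σ => edgeFac q lam τ (σ (x.2 i)))|) := by
    unfold decorr
    rw [← (Fin.consEquiv fun _ : Fin (γ + 1) => Fin n).sum_comp]
    refine mul_le_mul_of_nonneg_left (sum_le_sum fun x _ => sum_le_sum fun τ _ =>
      sum_le_sum fun o _ => ?_) (by positivity)
    exact key x.2 x.1 τ o
  refine h5.trans ?_
  simp only [sum_add_distrib, mul_add, ← mul_sum]
  rw [add_comm]
  refine add_le_add (le_of_eq ?_) ?_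
  · rw [Fintype.sum_prod_type]
    simp only [sum_const, card_univ, Fintype.card_fin, nsmul_eq_mul, decorr]
    rw [pow_succ]
    field_simp
  · rw [mul_assoc 2]
    refine le_trans (le_of_eq ?_) (mul_le_mul_of_nonneg_left hcov (by norm_num))
    rw [← mul_sum, Fintype.sum_prod_type, Fintype.sum_prod_type, sum_comm]
    simp only [Fintype.sum_prod_type]
    rw [pow_succ, mul_inv]; ring

lemma decorr_le {lam : ℝ} (hP : PottsPar q lam) (hn : 0 < n) (hm : ∀ o x, 0 ≤ m o x)
    (htot : ∑ o, mass m o ≤ 1) (γ : ℕ) :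
    decorr lam m γ ≤ 2 * (3 / 2) ^ γ * √q * ∑ i ∈ range γ, √(pinEnergy m i - colEnergy m) := by
  induction γ with
  | zero => simp [decorr, cm_const]
  | succ γ ih =>
    refine (decorr_succ_le hP hn hm htot γ).trans ?_
    rw [sum_range_succ, pow_succ]
    have : 0 ≤ (3 / 2 : ℝ) ^ γ * √q * √(pinEnergy m γ - colEnergy m) := by positivity
    linarith

end Decorrelation

section PinTwice

variable {O : Type*} [Fintype O] {q n : ℕ} {m : O → (Fin n → Fin q) → ℝ}

lemma pin_pin {s t : ℕ} (u : Fin s → Fin n) (v : Fin t → Fin n) (o : O) (y : Fin s → Fin q)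
    (z : Fin t → Fin q) (σ : Fin n → Fin q) :
    pin (pin m u) v ((o, y), z) σ = pin m (Fin.append u v) (o, Fin.append y z) σ := by
  unfold pin
  have h : σ ∘ Fin.append u v = Fin.append y z ↔ σ ∘ v = z ∧ σ ∘ u = y := by
    rw [show σ ∘ Fin.append u v = Fin.append (σ ∘ u) (σ ∘ v) from
      funext fun i => by refine Fin.addCases (fun j => ?_) (fun j => ?_) i <;> simp]
    constructor
    · intro h
      have := (Fin.appendEquiv s t).injective (a₁ := (σ ∘ u, σ ∘ v)) (a₂ := (y, z)) h
      simpa [and_comm] using this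
    · rintro ⟨rfl, rfl⟩; rfl
  simp only [h, ite_and]

lemma energy_pin_pin {s t : ℕ} (u : Fin s → Fin n) (v : Fin t → Fin n) (f : (Fin n → Fin q) → ℝ) :
    energy (pin (pin m u) v) f = energy (pin m (Fin.append u v)) f := by
  unfold energy
  rw [Fintype.sum_prod_type, Fintype.sum_prod_type, Fintype.sum_prod_type]
  refine sum_congr rfl fun o _ => ?_
  rw [← (Fin.appendEquiv s t).sum_comp, Fintype.sum_prod_type]
  refine sum_congr rfl fun y _ => sum_congr rfl fun z _ => ?_
  simp only [cm, mass, pin_pin, Fin.appendEquiv, Equiv.coe_fn_mk]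

lemma avg_pinEnergy_pin (s t : ℕ) :
    ((n : ℝ) ^ s)⁻¹ * ∑ u : Fin s → Fin n, pinEnergy (pin m u) t = pinEnergy m (s + t) := by
  unfold pinEnergy
  rw [← (Fin.appendEquiv s t).sum_comp, Fintype.sum_prod_type, pow_add, mul_inv, mul_assoc]
  congr 1
  rw [mul_sum]
  refine sum_congr rfl fun u _ => ?_
  congr 1
  refine sum_congr rfl fun v _ => ?_
  simp only [colEnergy, energy_pin_pin, Fin.appendEquiv, Equiv.coe_fn_mk]

lemma sum_shift_sub_le {h : ℕ → ℝ} (h0 : ∀ i, 0 ≤ h i) (h1 : ∀ i, h i ≤ 1) (S t : ℕ) :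
    ∑ s ∈ range S, (h (s + t) - h s) ≤ t := by
  have e1 := sum_range_add h S t
  have e2 := sum_range_add h t S
  rw [add_comm t S] at e2
  have e3 : ∑ x ∈ range t, h (S + x) ≤ t := by
    refine (sum_le_sum fun x _ => h1 _).trans (by simp)
  have e4 : 0 ≤ ∑ x ∈ range t, h x := sum_nonneg fun x _ => h0 x
  rw [sum_sub_distrib]
  simp only [add_comm _ t]
  linarith

/-- After pinning a random number of random vertices, further pinning gains little energy. -/
lemma avg_sqrt_pinEnergy_le (hn : 0 < n) (hm : ∀ o x, 0 ≤ m o x) (htot : ∑ o, mass m o ≤ 1)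
    {S : ℕ} (hS : 0 < S) (t : ℕ) :
    (S : ℝ)⁻¹ * ∑ s ∈ range S, ((n : ℝ) ^ s)⁻¹ * ∑ u : Fin s → Fin n,
      √(pinEnergy (pin m u) t - colEnergy (pin m u)) ≤ √(t / S) := by
  have h1 : ∀ s, ((n : ℝ) ^ s)⁻¹ * ∑ u : Fin s → Fin n,
      √(pinEnergy (pin m u) t - colEnergy (pin m u)) ≤ √(pinEnergy m (s + t) - pinEnergy m s) := by
    intro s
    have h2 := sum_mul_sqrt_le (univ : Finset (Fin s → Fin n)) (w := fun _ => ((n : ℝ) ^ s)⁻¹)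
      (x := fun u => pinEnergy (pin m u) t - colEnergy (pin m u)) (W := 1) (fun _ => by positivity)
      (fun u => pinEnergy_sub_nonneg hn (pin_nonneg hm u) t)
      (by rw [← pow_inv_mul_card (t := s) hn, mul_sum]; simp)
    rw [Real.sqrt_one, one_mul, ← mul_sum, ← mul_sum, sum_sub_distrib, mul_sub,
      avg_pinEnergy_pin] at h2
    exact h2
  have hS' : (0 : ℝ) < S := by exact_mod_cast hS
  have h3 : ∀ s, 0 ≤ pinEnergy m (s + t) - pinEnergy m s := by
    intro s
    rw [← avg_pinEnergy_pin, pinEnergy, ← mul_sub, ← sum_sub_distrib]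
    exact mul_nonneg (by positivity)
      (sum_nonneg fun u _ => pinEnergy_sub_nonneg hn (pin_nonneg hm u) t)
  have h4 := sum_mul_sqrt_le (range S) (w := fun _ => (S : ℝ)⁻¹)
      (x := fun s => pinEnergy m (s + t) - pinEnergy m s) (W := 1) (fun _ => by positivity) h3
      (by simp [hS'.ne'])
  rw [Real.sqrt_one, one_mul, ← mul_sum, ← mul_sum] at h4
  refine (mul_le_mul_of_nonneg_left (sum_le_sum fun s _ => h1 s) (by positivity)).trans
    (h4.trans (Real.sqrt_le_sqrt ?_))
  rw [inv_mul_eq_div]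
  gcongr
  exact sum_shift_sub_le (fun i => pinEnergy_nonneg hm i) (fun i => pinEnergy_le_one hn hm htot i) S t

end PinTwice

section Barycenter

lemma neg_one_le_LamFn {x : ℝ} (hx : 0 ≤ x) : -1 ≤ LamFn x := by
  unfold LamFn
  rcases hx.eq_or_lt with rfl | h
  · simp
  · have h3 := mul_le_mul_of_nonneg_left (Real.one_sub_inv_le_log_of_pos h) hx
    rw [mul_sub, mul_one, mul_inv_cancel₀ h.ne'] at h3
    linarith

variable {V : Type*} [Fintype V] {q : ℕ} {w : V → ℝ} {ρ : V → Fin q → ℝ} {lam : ℝ}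

lemma abs_vertexEnt_le (hP : PottsPar q lam) (hw : ∀ v, 0 ≤ w v) (hw1 : ∑ v, w v = 1)
    (hρ : ∀ v, ρ v ∈ stdSimplex ℝ (Fin q)) (γ : ℕ) : |vertexEnt q lam w ρ γ| ≤ (9 / 4) ^ γ := by
  have hs : ∑ f : Fin γ → V, ∏ i, w (f i) = 1 := by rw [← Fintype.sum_pow, hw1, one_pow]
  have : ((9 : ℝ) / 4) ^ γ = ∑ f : Fin γ → V, (∏ i, w (f i)) * (9 / 4) ^ γ := by
    rw [← sum_mul, hs, one_mul]
  rw [this]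
  refine (abs_sum_le_sum_abs _ _).trans (sum_le_sum fun f _ => ?_)
  have h0 : 0 ≤ ∏ i, w (f i) := prod_nonneg fun i _ => hw _
  rw [abs_mul, abs_of_nonneg h0]
  refine mul_le_mul_of_nonneg_left ?_ h0
  obtain ⟨h1, h2⟩ := vertexZ_bounds hP (r := fun i => ρ (f i)) fun i => hρ _
  refine (abs_LamFn_le h1 h2 (one_le_pow₀ (by norm_num))).trans (le_of_eq ?_)
  rw [← pow_mul, mul_comm γ 2, pow_mul]; norm_num

lemma abs_LamFn_edgeZ_le (hP : PottsPar q lam) {a b : Fin q → ℝ} (ha : a ∈ stdSimplex ℝ (Fin q))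
    (hb : b ∈ stdSimplex ℝ (Fin q)) : |LamFn (edgeZ q lam a b)| ≤ 9 / 4 := by
  obtain ⟨h1, h2⟩ := edgeZ_bounds hP ha hb
  exact (abs_LamFn_le (hP.minRatio_pos.trans_le h1) h2 (by norm_num)).trans (by norm_num)

lemma abs_edgeEnt_le (hP : PottsPar q lam) (hw : ∀ v, 0 ≤ w v) (hw1 : ∑ v, w v = 1)
    (hρ : ∀ v, ρ v ∈ stdSimplex ℝ (Fin q)) : |edgeEnt q lam w ρ| ≤ 9 / 4 := by
  have : (9 : ℝ) / 4 = ∑ v, ∑ v', w v * w v' * (9 / 4) := by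
    simp only [← sum_mul, ← mul_sum, hw1]; norm_num
  rw [this]
  refine (abs_sum_le_sum_abs _ _).trans (sum_le_sum fun v _ =>
    (abs_sum_le_sum_abs _ _).trans (sum_le_sum fun v' _ => ?_))
  have h0 : 0 ≤ w v * w v' := mul_nonneg (hw _) (hw _)
  rw [abs_mul, abs_of_nonneg h0]
  exact mul_le_mul_of_nonneg_left (abs_LamFn_edgeZ_le hP (hρ v) (hρ v')) h0

/-- Adding a point of weight `η`. -/
def optWt (w : V → ℝ) (η : ℝ) : Option V → ℝ := fun o => o.elim η fun v => (1 - η) * w v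

/-- Adding a point that moves the barycenter to the uniform distribution. -/
noncomputable def optPt (w : V → ℝ) (ρ : V → Fin q → ℝ) (η : ℝ) : Option V → Fin q → ℝ :=
  fun o => o.elim (fun τ => ((q : ℝ)⁻¹ - (1 - η) * ∑ v, w v * ρ v τ) / η) ρ

lemma isMixture_opt (hP : PottsPar q lam) (hw : ∀ v, 0 ≤ w v) (hw1 : ∑ v, w v = 1)
    (hρ : ∀ v, ρ v ∈ stdSimplex ℝ (Fin q)) {η : ℝ} (h0 : 0 < η) (h1 : η ≤ 1)
    (hη : ∀ τ, |q * (∑ v, w v * ρ v τ) - 1| ≤ η) :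
    IsMixture q (optWt w η) (optPt w ρ η) := by
  have hq := hP.q_pos
  have hq0 : (q : ℝ) ≠ 0 := by positivity
  refine ⟨?_, ?_, ?_, ?_⟩
  · rintro (_ | v)
    · exact h0.le
    · exact mul_nonneg (by linarith) (hw v)
  · rw [Fintype.sum_option]
    simp [optWt, ← mul_sum, hw1]
  · rintro (_ | v)
    · refine ⟨fun τ => ?_, ?_⟩
      · refine div_nonneg ?_ h0.le
        have h2 := (abs_le.1 (hη τ)).2
        have h3 : ∑ v, w v * ρ v τ ≤ (1 + η) * (q : ℝ)⁻¹ := by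
          rw [← div_eq_mul_inv, le_div_iff₀ (by positivity)]; linarith
        have h4 := mul_le_mul_of_nonneg_left h3 (show 0 ≤ 1 - η by linarith)
        have h5 : 0 < (q : ℝ)⁻¹ := by positivity
        nlinarith [mul_nonneg (sq_nonneg η) h5.le]
      · simp only [optPt, Option.elim]
        rw [← sum_div, sum_sub_distrib, ← mul_sum, sum_comm]
        have : ∀ v, ∑ τ, w v * ρ v τ = w v := fun v => by rw [← mul_sum, (hρ v).2, mul_one]
        simp only [this, hw1]
        simp [hq0, h0.ne']
    · exact hρ v
  · intro s
    rw [Fintype.sum_option]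
    simp only [optWt, optPt, Option.elim, mul_assoc, ← mul_sum]
    field_simp
    ring

lemma vertexEnt_le_opt (hP : PottsPar q lam) (hw : ∀ v, 0 ≤ w v) (hw1 : ∑ v, w v = 1)
    (hρ : ∀ v, ρ v ∈ stdSimplex ℝ (Fin q)) {η : ℝ} (h0 : 0 < η) (h1 : η ≤ 1)
    (hη : ∀ τ, |q * (∑ v, w v * ρ v τ) - 1| ≤ η) (γ : ℕ) :
    vertexEnt q lam w ρ γ ≤ vertexEnt q lam (optWt w η) (optPt w ρ η) γ
      + γ * (1 + (9 / 4) ^ γ) * η := by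
  have hM := isMixture_opt hP hw hw1 hρ h0 h1 hη
  have hs : ∑ f : Fin γ → V, ∏ i, w (f i) = 1 := by rw [← Fintype.sum_pow, hw1, one_pow]
  have hinj : Function.Injective fun g : Fin γ → V => fun i => some (g i) := by
    intro a b h; funext i; exact Option.some.inj (congrFun h i)
  have h2 := sum_le_univ_sum_of_nonneg (s := univ.map ⟨_, hinj⟩)
    (f := fun f : Fin γ → Option V => (∏ i, optWt w η (f i)) *
      (LamFn (vertexZ q lam fun i => optPt w ρ η (f i)) + 1)) (fun f => by
      refine mul_nonneg (prod_nonneg fun i _ => hM.nonneg _) ?_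
      have := neg_one_le_LamFn (vertexZ_bounds hP (r := fun i => optPt w ρ η (f i))
        fun i => hM.mem _).1.le
      linarith)
  rw [sum_map] at h2
  simp only [Function.Embedding.coeFn_mk, optWt, optPt, Option.elim, prod_mul_distrib, prod_const,
    card_univ, Fintype.card_fin] at h2
  simp only [mul_add, mul_one, sum_add_distrib, mul_assoc, ← mul_sum, hs] at h2
  have h3 := hM.sum_prod γ
  have h4 : (1 - η) ^ γ * vertexEnt q lam w ρ γ + (1 - η) ^ γ
      ≤ vertexEnt q lam (optWt w η) (optPt w ρ η) γ + 1 :=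
    h2.trans_eq (congrArg (vertexEnt q lam (optWt w η) (optPt w ρ η) γ + ·) h3)
  have h5 := one_add_mul_le_pow (show -2 ≤ -η by linarith) γ
  rw [← sub_eq_add_neg] at h5
  have h6 := abs_le.1 (abs_vertexEnt_le hP hw hw1 hρ γ)
  have h7 : (1 - η) ^ γ ≤ 1 := pow_le_one₀ (by linarith) (by linarith)
  have h8 : (1 - (1 - η) ^ γ) * vertexEnt q lam w ρ γ ≤ (1 - (1 - η) ^ γ) * (9 / 4) ^ γ :=
    mul_le_mul_of_nonneg_left h6.2 (by linarith)
  have h9 : (1 - (1 - η) ^ γ) * (1 + (9 / 4) ^ γ) ≤ γ * η * (1 + (9 / 4) ^ γ) :=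
    mul_le_mul_of_nonneg_right (by linarith) (by positivity)
  linarith

lemma edgeEnt_opt_le (hP : PottsPar q lam) (hw : ∀ v, 0 ≤ w v) (hw1 : ∑ v, w v = 1)
    (hρ : ∀ v, ρ v ∈ stdSimplex ℝ (Fin q)) {η : ℝ} (h0 : 0 < η) (h1 : η ≤ 1)
    (hη : ∀ τ, |q * (∑ v, w v * ρ v τ) - 1| ≤ η) :
    edgeEnt q lam (optWt w η) (optPt w ρ η) ≤ edgeEnt q lam w ρ + 12 * η := by
  have hM := isMixture_opt hP hw hw1 hρ h0 h1 hη
  have hb := fun a b => (abs_le.1 (abs_LamFn_edgeZ_le hP (hM.mem a) (hM.mem b))).2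
  have hE := abs_le.1 (abs_edgeEnt_le hP hw hw1 hρ)
  have e1 : edgeEnt q lam (optWt w η) (optPt w ρ η)
      = η * η * LamFn (edgeZ q lam (optPt w ρ η none) (optPt w ρ η none))
        + ∑ v, η * ((1 - η) * w v) * LamFn (edgeZ q lam (optPt w ρ η none) (optPt w ρ η (some v)))
        + (∑ v, (1 - η) * w v * η * LamFn (edgeZ q lam (optPt w ρ η (some v)) (optPt w ρ η none))
        + (1 - η) ^ 2 * edgeEnt q lam w ρ) := by
    unfold edgeEnt
    rw [Fintype.sum_option]
    simp only [Fintype.sum_option, sum_add_distrib, optWt, Option.elim]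
    congr 2
    rw [mul_sum]
    refine sum_congr rfl fun v _ => ?_
    rw [mul_sum]
    refine sum_congr rfl fun v' _ => ?_
    simp only [optPt, Option.elim]
    ring
  have hc : 0 ≤ η * (1 - η) := mul_nonneg h0.le (by linarith)
  have e2 : ∑ v, η * ((1 - η) * w v) * LamFn (edgeZ q lam (optPt w ρ η none) (optPt w ρ η (some v)))
      ≤ η * (1 - η) * (9 / 4) := by
    rw [show η * (1 - η) * (9 / 4) = ∑ v, η * ((1 - η) * w v) * (9 / 4) by
      rw [← sum_mul, ← mul_sum, ← mul_sum, hw1]; ring]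
    exact sum_le_sum fun v _ => mul_le_mul_of_nonneg_left (hb _ _)
      (by rw [← mul_assoc]; exact mul_nonneg hc (hw v))
  have e3 : ∑ v, (1 - η) * w v * η * LamFn (edgeZ q lam (optPt w ρ η (some v)) (optPt w ρ η none))
      ≤ η * (1 - η) * (9 / 4) := by
    rw [show η * (1 - η) * (9 / 4) = ∑ v, (1 - η) * w v * η * (9 / 4) by
      rw [← sum_mul, ← sum_mul, ← mul_sum, hw1]; ring]
    exact sum_le_sum fun v _ => mul_le_mul_of_nonneg_left (hb _ _)
      (by rw [show (1 - η) * w v * η = η * (1 - η) * w v by ring]; exact mul_nonneg hc (hw v))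
  have e4 : η * η * LamFn (edgeZ q lam (optPt w ρ η none) (optPt w ρ η none)) ≤ η * η * (9 / 4) :=
    mul_le_mul_of_nonneg_left (hb _ _) (by positivity)
  have e5 : (1 - η) ^ 2 * edgeEnt q lam w ρ ≤ edgeEnt q lam w ρ + (2 * η - η ^ 2) * (9 / 4) := by
    nlinarith [hE.1, mul_nonneg h0.le (show 0 ≤ 2 - η by linarith)]
  rw [e1]
  nlinarith

/-- Below the condensation threshold the Bethe functional is at most linear in the distance of the
barycenter from the uniform distribution. -/
lemma bethe_le_add (hq : 3 ≤ q) {β d : ℝ} (hβ : 0 < β) (hd : 0 < d) (hdc : d < dcond q β)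
    (Γ : ℕ) : ∃ C, 0 ≤ C ∧ ∀ {V : Type} [Fintype V] {w : V → ℝ} {ρ : V → Fin q → ℝ},
      (∀ v, 0 ≤ w v) → ∑ v, w v = 1 → (∀ v, ρ v ∈ stdSimplex ℝ (Fin q)) →
      ∀ {η : ℝ}, 0 ≤ η → (∀ τ, |q * (∑ v, w v * ρ v τ) - 1| ≤ η) →
      ∑ γ ∈ range Γ, poisWt d γ * vertexEnt q (pottsLam q β) w ρ γ
        ≤ d / 2 * edgeEnt q (pottsLam q β) w ρ + C * η := by
  have hP := pottsPar_pottsLam hq hβ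
  set A := ∑ γ ∈ range Γ, poisWt d γ * (γ * (1 + (9 / 4) ^ γ)) with hA
  set B := ∑ γ ∈ range Γ, poisWt d γ * (9 / 4) ^ γ with hB
  have hA0 : 0 ≤ A := sum_nonneg fun γ _ => mul_nonneg (poisWt_nonneg hd.le γ) (by positivity)
  have hB0 : 0 ≤ B := sum_nonneg fun γ _ => mul_nonneg (poisWt_nonneg hd.le γ) (by positivity)
  refine ⟨A + B + 6 * d, by positivity, ?_⟩
  intro V _ w ρ hw hw1 hρ η h0 hη
  rcases h0.eq_or_lt with rfl | h0'
  · rw [mul_zero, add_zero]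
    refine bethe_le hq hβ hd hdc ⟨hw, hw1, hρ, fun s => ?_⟩ Γ
    have := abs_nonpos_iff.1 (hη s)
    have hq' := hP.q_pos
    exact eq_inv_of_mul_eq_one_left (by linarith)
  · rcases le_total η 1 with h1 | h1
    · have e1 := bethe_le hq hβ hd hdc (isMixture_opt hP hw hw1 hρ h0' h1 hη) Γ
      have e2 := edgeEnt_opt_le hP hw hw1 hρ h0' h1 hη
      have e3 : ∑ γ ∈ range Γ, poisWt d γ * vertexEnt q (pottsLam q β) w ρ γ
          ≤ ∑ γ ∈ range Γ, poisWt d γ * vertexEnt q (pottsLam q β) (optWt w η) (optPt w ρ η) γ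
            + A * η := by
        rw [hA, sum_mul, ← sum_add_distrib]
        refine sum_le_sum fun γ _ => ?_
        have := mul_le_mul_of_nonneg_left (vertexEnt_le_opt hP hw hw1 hρ h0' h1 hη γ)
          (poisWt_nonneg hd.le γ)
        linarith
      have e4 := mul_le_mul_of_nonneg_left e2 (show 0 ≤ d / 2 by positivity)
      have e5 : 0 ≤ B * η := by positivity
      linarith
    · have e1 : ∑ γ ∈ range Γ, poisWt d γ * vertexEnt q (pottsLam q β) w ρ γ ≤ B :=
        sum_le_sum fun γ _ => mul_le_mul_of_nonneg_left
          (abs_le.1 (abs_vertexEnt_le hP hw hw1 hρ γ)).2 (poisWt_nonneg hd.le γ)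
      have e2 := mul_le_mul_of_nonneg_left (abs_le.1 (abs_edgeEnt_le hP hw hw1 hρ)).1
        (show 0 ≤ d / 2 by positivity)
      have e3 : A + B + 6 * d ≤ (A + B + 6 * d) * η := le_mul_of_one_le_right (by positivity) h1
      linarith

end Barycenter

section Observed

/-- The expected imbalance of a uniformly random coloring. -/
noncomputable def imbal (q n : ℕ) : ℝ :=
  ((q : ℝ) ^ n)⁻¹ * ∑ σ : Fin n → Fin q, ∑ τ, |(n : ℝ)⁻¹ * ∑ v, ker q τ (σ v)|

lemma sum_sq_additive {q : ℕ} {k : Fin q → ℝ} (hk : ∑ c, k c = 0) (n : ℕ) :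
    (∑ σ : Fin n → Fin q, (∑ v, k (σ v)) ^ 2) * q = n * (q : ℝ) ^ n * ∑ c, k c ^ 2 := by
  induction n with
  | zero => simp
  | succ n ih =>
    rw [← (Fin.consEquiv fun _ : Fin (n + 1) => Fin q).sum_comp, Fintype.sum_prod_type]
    simp only [Fin.consEquiv, Equiv.coe_fn_mk, Fin.sum_univ_succ, Fin.cons_zero, Fin.cons_succ,
      add_sq, sum_add_distrib, sum_const, card_univ, Fintype.card_fin, Fintype.card_fun,
      nsmul_eq_mul, ← mul_sum, ← sum_mul, hk]
    push_cast
    rw [pow_succ]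
    linear_combination (q : ℝ) * ih

lemma imbal_nonneg (q n : ℕ) : 0 ≤ imbal q n := by unfold imbal; positivity

lemma imbal_le {q n : ℕ} (hq : 0 < q) (hn : 0 < n) : imbal q n ≤ q * √(q / n) := by
  have hq' : (0 : ℝ) < q := by exact_mod_cast hq
  have hn' : (0 : ℝ) < n := by exact_mod_cast hn
  unfold imbal
  rw [sum_comm, mul_sum]
  have h1 : ∀ τ : Fin q, ((q : ℝ) ^ n)⁻¹ * ∑ σ : Fin n → Fin q, |(n : ℝ)⁻¹ * ∑ v, ker q τ (σ v)|
      ≤ √(q / n) := by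
    intro τ
    have h2 := sum_mul_sqrt_le (univ : Finset (Fin n → Fin q)) (w := fun _ => ((q : ℝ) ^ n)⁻¹)
      (x := fun σ => ((n : ℝ)⁻¹ * ∑ v, ker q τ (σ v)) ^ 2) (W := 1) (fun _ => by positivity)
      (fun σ => sq_nonneg _) (by simp [hq'.ne'])
    simp only [Real.sqrt_sq_eq_abs, Real.sqrt_one, one_mul, ← mul_sum] at h2
    refine h2.trans (Real.sqrt_le_sqrt ?_)
    have h3 := sum_sq_additive (k := ker q τ) (sum_ker τ) n
    have h4 : ∑ c, ker q τ c ^ 2 ≤ (q : ℝ) ^ 2 := by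
      have := sum_ker_mul_ker τ τ
      simp only [← sq, ker_symm _ τ] at this
      rw [this]; unfold ker; simp; nlinarith
    simp only [mul_pow, ← mul_sum]
    have h5 : ∑ σ : Fin n → Fin q, (∑ v, ker q τ (σ v)) ^ 2 ≤ n * (q : ℝ) ^ n * q := by
      refine le_of_mul_le_mul_right ?_ hq'
      rw [h3, mul_assoc _ (q : ℝ), ← sq]
      exact mul_le_mul_of_nonneg_left h4 (by positivity)
    calc ((q : ℝ) ^ n)⁻¹ * ((n : ℝ)⁻¹ ^ 2 * ∑ σ : Fin n → Fin q, (∑ v, ker q τ (σ v)) ^ 2)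
        ≤ ((q : ℝ) ^ n)⁻¹ * ((n : ℝ)⁻¹ ^ 2 * (n * (q : ℝ) ^ n * q)) := by gcongr
      _ = (q : ℝ) / n := by field_simp
  refine (sum_le_sum fun τ _ => h1 τ).trans (by simp)

lemma tendsto_imbal {q : ℕ} (hq : 0 < q) : Filter.Tendsto (imbal q) Filter.atTop (nhds 0) := by
  have h1 : Filter.Tendsto (fun n : ℕ => (q : ℝ) * √(q / n)) Filter.atTop (nhds 0) := by
    have := (tendsto_const_div_atTop_nhds_zero_nat (q : ℝ)).sqrt.const_mul (q : ℝ)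
    simpa using this
  refine tendsto_of_tendsto_of_tendsto_of_le_of_le' tendsto_const_nhds h1
    (Filter.Eventually.of_forall fun n => imbal_nonneg q n) ?_
  filter_upwards [Filter.eventually_gt_atTop 0] with n hn using imbal_le hq hn

variable {O : Type*} [Fintype O] {q n : ℕ}

/-- A joint law of a uniformly random coloring and an observation. -/
structure IsJoint (m : O → (Fin n → Fin q) → ℝ) : Prop where
  nonneg : ∀ o σ, 0 ≤ m o σ
  marginal : ∀ σ, ∑ o, m o σ = ((q : ℝ) ^ n)⁻¹

variable {m : O → (Fin n → Fin q) → ℝ}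

lemma IsJoint.sum_cm (h : IsJoint m) (f : (Fin n → Fin q) → ℝ) :
    ∑ o, cm m o f = ((q : ℝ) ^ n)⁻¹ * ∑ σ, f σ := by
  simp only [cm]
  rw [sum_comm, mul_sum]
  exact sum_congr rfl fun σ _ => by rw [← sum_mul, h.marginal]

lemma IsJoint.sum_mass (h : IsJoint m) (hq : 0 < q) : ∑ o, mass m o = 1 := by
  have hq' : (q : ℝ) ≠ 0 := by positivity
  simp only [mass_eq_cm, h.sum_cm]
  simp [hq']

lemma IsJoint.pin (h : IsJoint m) {t : ℕ} (v : Fin t → Fin n) : IsJoint (pin m v) :=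
  ⟨pin_nonneg h.nonneg v, fun σ => by rw [sum_pin, h.marginal]⟩

/-- The conditional marginal law of the color of a vertex. -/
noncomputable def marg (m : O → (Fin n → Fin q) → ℝ) (o : O) (v : Fin n) (τ : Fin q) : ℝ :=
  gib m o (colInd v τ)

lemma gib_sum {κ : Type*} (s : Finset κ) (o : O) (f : κ → (Fin n → Fin q) → ℝ) :
    gib m o (fun x => ∑ k ∈ s, f k x) = ∑ k ∈ s, gib m o (f k) := by
  simp only [gib, cm_sum, sum_div]

lemma gib_const {o : O} (ho : mass m o ≠ 0) (a : ℝ) : gib m o (fun _ => a) = a := by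
  rw [gib, cm_const]; field_simp

lemma gib_mul (o : O) (a : ℝ) (f : (Fin n → Fin q) → ℝ) :
    gib m o (fun x => a * f x) = a * gib m o f := by
  rw [gib, cm_mul, gib, mul_div_assoc]

lemma marg_mem (hm : ∀ o x, 0 ≤ m o x) {o : O} (ho : mass m o ≠ 0) (v : Fin n) :
    marg m o v ∈ stdSimplex ℝ (Fin q) := by
  refine ⟨fun τ => le_gib hm ho (colInd_nonneg v τ), ?_⟩
  unfold marg
  rw [← gib_sum]; simp only [sum_colInd, gib_const ho]

/-- Vertex part of the Bethe functional, averaged over the observation. -/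
noncomputable def vertexObs (lam : ℝ) (m : O → (Fin n → Fin q) → ℝ) (γ : ℕ) : ℝ :=
  ∑ o, mass m o * vertexEnt q lam (fun _ => (n : ℝ)⁻¹) (marg m o) γ

/-- Edge part of the Bethe functional, averaged over the observation. -/
noncomputable def edgeObs (lam : ℝ) (m : O → (Fin n → Fin q) → ℝ) : ℝ :=
  ∑ o, mass m o * edgeEnt q lam (fun _ => (n : ℝ)⁻¹) (marg m o)

lemma bary_marg (hn : 0 < n) {o : O} (ho : mass m o ≠ 0) (τ : Fin q) :
    q * (∑ v, (n : ℝ)⁻¹ * marg m o v τ) - 1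
      = gib m o (fun σ => (n : ℝ)⁻¹ * ∑ v, ker q τ (σ v)) := by
  have hn' : (n : ℝ) ≠ 0 := by positivity
  rw [gib_mul, gib_sum]
  have h1 : ∀ v : Fin n, gib m o (fun σ => ker q τ (σ v)) = q * marg m o v τ - 1 := by
    intro v
    have h2 := gib_affine ho (-1) (q : ℝ) (colInd v τ)
    rw [marg, sub_eq_neg_add, ← h2]
    congr 1; funext σ
    simp only [ker, colInd, eq_comm (a := τ)]; ring
  simp only [h1, sum_sub_distrib, ← mul_sum]
  simp
  field_simp

lemma bethe_obs_le (hq : 3 ≤ q) {β d : ℝ} (hβ : 0 < β) (hd : 0 < d) (hdc : d < dcond q β)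
    (Γ : ℕ) : ∃ C, 0 ≤ C ∧ ∀ {n : ℕ} {O : Type} [Fintype O] {m : O → (Fin n → Fin q) → ℝ},
      0 < n → IsJoint m →
      ∑ γ ∈ range Γ, poisWt d γ * vertexObs (pottsLam q β) m γ
        ≤ d / 2 * edgeObs (pottsLam q β) m + C * imbal q n := by
  obtain ⟨C, hC, hCle⟩ := bethe_le_add hq hβ hd hdc Γ
  refine ⟨C, hC, ?_⟩
  intro n O _ m hn hm
  have hn' : (n : ℝ) ≠ 0 := by positivity
  set η : O → ℝ := fun o => ∑ τ, |gib m o (fun σ => (n : ℝ)⁻¹ * ∑ v, ker q τ (σ v))| with hη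
  have h1 : ∀ o, mass m o * ∑ γ ∈ range Γ, poisWt d γ *
      vertexEnt q (pottsLam q β) (fun _ => (n : ℝ)⁻¹) (marg m o) γ
      ≤ mass m o * (d / 2 * edgeEnt q (pottsLam q β) (fun _ => (n : ℝ)⁻¹) (marg m o) + C * η o) := by
    intro o
    by_cases ho : mass m o = 0
    · simp [ho]
    · refine mul_le_mul_of_nonneg_left (hCle (fun _ => by positivity) (by simp [hn'])
        (marg_mem hm.nonneg ho) (by positivity) fun τ => ?_) (mass_nonneg hm.nonneg o)
      rw [bary_marg hn ho]
      exact single_le_sum (f := fun τ => |gib m o (fun σ => (n : ℝ)⁻¹ * ∑ v, ker q τ (σ v))|)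
        (fun _ _ => abs_nonneg _) (mem_univ τ)
  have h2 : ∑ o, mass m o * η o ≤ imbal q n := by
    unfold imbal
    rw [← hm.sum_cm]
    refine sum_le_sum fun o _ => ?_
    rw [cm_sum, hη, mul_sum]
    refine sum_le_sum fun τ _ => ?_
    rw [← abs_of_nonneg (mass_nonneg hm.nonneg o), ← abs_mul,
      mass_mul_gib hm.nonneg]
    exact abs_cm_le hm.nonneg o _
  have h3 := sum_le_sum fun o (_ : o ∈ univ) => h1 o
  have h4 : ∑ γ ∈ range Γ, poisWt d γ * vertexObs (pottsLam q β) m γ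
      = ∑ o, mass m o * ∑ γ ∈ range Γ, poisWt d γ *
      vertexEnt q (pottsLam q β) (fun _ => (n : ℝ)⁻¹) (marg m o) γ := by
    unfold vertexObs
    simp only [mul_sum]
    rw [sum_comm]
    exact sum_congr rfl fun o _ => sum_congr rfl fun γ _ => by ring
  have h5 : ∑ o, mass m o * (d / 2 * edgeEnt q (pottsLam q β) (fun _ => (n : ℝ)⁻¹) (marg m o)
      + C * η o) = d / 2 * edgeObs (pottsLam q β) m + C * ∑ o, mass m o * η o := by
    unfold edgeObs
    rw [mul_sum, mul_sum, ← sum_add_distrib]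
    exact sum_congr rfl fun o _ => by ring
  rw [h4]
  rw [h5] at h3
  have h6 := mul_le_mul_of_nonneg_left h2 hC
  linarith

end Observed

section Elementary

lemma LamFn_sub_le {a b : ℝ} (ha : 0 < a) (hb : 0 < b) :
    LamFn a - LamFn b ≤ (1 + Real.log a) * (a - b) := by
  unfold LamFn
  have h := Real.log_le_sub_one_of_pos (div_pos ha hb)
  rw [Real.log_div ha.ne' hb.ne'] at h
  have h2 := mul_le_mul_of_nonneg_left h hb.le
  rw [mul_sub, mul_sub, mul_div_cancel₀ _ hb.ne'] at h2
  linarith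

lemma abs_log_le {lo hi x : ℝ} (hlo : 0 < lo) (h1 : lo ≤ x) (h2 : x ≤ hi) :
    |Real.log x| ≤ |Real.log lo| + |Real.log hi| := by
  have h3 := Real.log_le_log hlo h1
  have h4 := Real.log_le_log (hlo.trans_le h1) h2
  have h5 := neg_abs_le (Real.log lo)
  have h6 := le_abs_self (Real.log hi)
  rw [abs_le]
  constructor <;> linarith [abs_nonneg (Real.log lo), abs_nonneg (Real.log hi)]

lemma abs_LamFn_sub_le {lo hi a b : ℝ} (hlo : 0 < lo) (ha : lo ≤ a) (ha' : a ≤ hi) (hb : lo ≤ b)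
    (hb' : b ≤ hi) : |LamFn a - LamFn b| ≤ (1 + |Real.log lo| + |Real.log hi|) * |a - b| := by
  have key : ∀ {a b : ℝ}, lo ≤ a → a ≤ hi → lo ≤ b → b ≤ hi →
      LamFn a - LamFn b ≤ (1 + |Real.log lo| + |Real.log hi|) * |a - b| := by
    intro a b ha ha' hb hb'
    refine (LamFn_sub_le (hlo.trans_le ha) (hlo.trans_le hb)).trans ((le_abs_self _).trans ?_)
    rw [abs_mul]
    refine mul_le_mul_of_nonneg_right ((abs_add_le _ _).trans ?_) (abs_nonneg _)
    rw [abs_one, add_assoc]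
    exact add_le_add le_rfl (abs_log_le hlo ha ha')
  rw [abs_le]
  have h1 := key ha ha' hb hb'
  have h2 := key hb hb' ha ha'
  rw [abs_sub_comm] at h2
  constructor <;> linarith

lemma abs_log_one_add_sub_le {x : ℝ} (hx : |x| ≤ 1 / 2) : |Real.log (1 + x) - x| ≤ 2 * x ^ 2 := by
  have h := Real.abs_log_sub_add_sum_range_le (x := -x) (by rw [abs_neg]; linarith) 1
  simp only [sum_range_one, sub_neg_eq_add, abs_neg] at h
  norm_num at h
  rw [sub_eq_neg_add]
  refine h.trans ?_
  rw [div_le_iff₀ (by linarith)]; nlinarith [sq_nonneg x]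

lemma abs_exp_sub_one_le_mul (t : ℝ) : |Real.exp t - 1| ≤ Real.exp |t| * |t| := by
  have h1 := Real.add_one_le_exp t
  have h2 := Real.add_one_le_exp (-t)
  have h3 : Real.exp t * Real.exp (-t) = 1 := by rw [← Real.exp_add]; simp
  have h4 := mul_le_mul_of_nonneg_left h2 (Real.exp_pos t).le
  have h5 := Real.exp_le_exp.2 (le_abs_self t)
  have h6 := Real.one_le_exp (abs_nonneg t)
  have h7 := abs_nonneg t
  have h8 := le_abs_self t
  have h9 := neg_abs_le t
  rw [abs_le]
  constructor
  · nlinarith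
  · have : Real.exp t * t ≤ Real.exp |t| * |t| :=
      (mul_le_mul_of_nonneg_left h8 (Real.exp_pos t).le).trans
        (mul_le_mul_of_nonneg_right h5 h7)
    nlinarith

lemma abs_log_prod_le {κ : Type*} (s : Finset κ) {x : κ → ℝ} {r : ℝ} (hr : r ≤ 1 / 2)
    (hx : ∀ k ∈ s, |x k| ≤ r) :
    |Real.log (∏ k ∈ s, (1 + x k))| ≤ |∑ k ∈ s, x k| + 2 * #s * r ^ 2 ∧
    |Real.log (∏ k ∈ s, (1 + x k))| ≤ 2 * #s * r := by
  have h0 : ∀ k ∈ s, 1 + x k ≠ 0 := fun k hk => by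
    have := (abs_le.1 ((hx k hk).trans hr)).1; linarith
  rw [Real.log_prod h0]
  have h1 : |∑ k ∈ s, Real.log (1 + x k) - ∑ k ∈ s, x k| ≤ 2 * #s * r ^ 2 := by
    rw [← sum_sub_distrib]
    refine (abs_sum_le_sum_abs _ _).trans ((sum_le_sum (g := fun _ => 2 * r ^ 2)
      fun k hk => (abs_log_one_add_sub_le ((hx k hk).trans hr)).trans ?_).trans (by simp; linarith))
    have := sq_le_sq' (by linarith [abs_nonneg (x k), hx k hk]) (hx k hk)
    rw [sq_abs] at this; linarith
  have h2 : |∑ k ∈ s, x k| ≤ #s * r :=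
    (abs_sum_le_sum_abs _ _).trans ((sum_le_sum fun k hk => hx k hk).trans (by simp))
  have h3 : |∑ k ∈ s, Real.log (1 + x k)| ≤ |∑ k ∈ s, x k| + 2 * #s * r ^ 2 := by
    have := abs_sub_abs_le_abs_sub (∑ k ∈ s, Real.log (1 + x k)) (∑ k ∈ s, x k)
    linarith
  refine ⟨h3, h3.trans ?_⟩
  rcases s.eq_empty_or_nonempty with rfl | ⟨k, hk⟩
  · simp
  · have hr0 : 0 ≤ r := (abs_nonneg _).trans (hx k hk)
    have : (0 : ℝ) ≤ #s := by positivity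
    nlinarith [mul_nonneg this (mul_nonneg hr0 (show 0 ≤ 1 - 2 * r by linarith))]

/-- A product of factors close to one is close to one if their deviations cancel. -/
lemma abs_prod_sub_one_le {κ : Type*} (s : Finset κ) {x : κ → ℝ} {r : ℝ} (hr : r ≤ 1 / 2)
    (hx : ∀ k ∈ s, |x k| ≤ r) :
    |∏ k ∈ s, (1 + x k) - 1| ≤ Real.exp (2 * #s * r) * (|∑ k ∈ s, x k| + 2 * #s * r ^ 2) := by
  obtain ⟨h1, h2⟩ := abs_log_prod_le s hr hx
  have h0 : 0 < ∏ k ∈ s, (1 + x k) := prod_pos fun k hk => by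
    have := (abs_le.1 ((hx k hk).trans hr)).1; linarith
  have h3 := abs_exp_sub_one_le_mul (Real.log (∏ k ∈ s, (1 + x k)))
  rw [Real.exp_log h0] at h3
  exact h3.trans (mul_le_mul (Real.exp_le_exp.2 h2) h1 (abs_nonneg _) (Real.exp_pos _).le)

lemma prod_bounds {κ : Type*} (s : Finset κ) {x : κ → ℝ} {r : ℝ} (hr : r ≤ 1 / 2)
    (hx : ∀ k ∈ s, |x k| ≤ r) :
    Real.exp (-(2 * #s * r)) ≤ ∏ k ∈ s, (1 + x k) ∧ ∏ k ∈ s, (1 + x k) ≤ Real.exp (2 * #s * r) := by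
  have h0 : 0 < ∏ k ∈ s, (1 + x k) := prod_pos fun k hk => by
    have := (abs_le.1 ((hx k hk).trans hr)).1; linarith
  have h2 := abs_le.1 (abs_log_prod_le s hr hx).2
  exact ⟨(Real.le_log_iff_exp_le h0).1 h2.1, (Real.log_le_iff_le_exp h0).1 h2.2⟩

end Elementary

section EdgeObserved

variable {O : Type*} [Fintype O] {q n : ℕ} {m : O → (Fin n → Fin q) → ℝ}

/-- The entropy of an edge between two random vertices, given the observation. -/
noncomputable def edgeTrue (lam : ℝ) (m : O → (Fin n → Fin q) → ℝ) : ℝ :=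
  ∑ o, mass m o * (((n : ℝ) ^ 2)⁻¹ * ∑ v, ∑ v',
    LamFn (1 + gib m o (fun σ => lam * ker q (σ v) (σ v'))))

lemma ker_eq_sum_colInd (v v' : Fin n) (σ : Fin n → Fin q) :
    ker q (σ v) (σ v') = q * (∑ τ, colInd v τ σ * colInd v' τ σ) - 1 := by
  unfold ker colInd
  simp only [mul_ite, mul_one, mul_zero, sum_ite_eq, mem_univ, if_true]

lemma gib_lam_ker {lam : ℝ} {o : O} (ho : mass m o ≠ 0) (v v' : Fin n) :
    1 + gib m o (fun σ => lam * ker q (σ v) (σ v'))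
      = 1 + lam * (q * (∑ τ, gib m o (fun σ => colInd v τ σ * colInd v' τ σ)) - 1) := by
  rw [gib_mul, ← gib_sum]
  congr 2
  have := gib_affine ho (-1) (q : ℝ) (fun σ => ∑ τ, colInd v τ σ * colInd v' τ σ)
  rw [sub_eq_neg_add, ← this]
  congr 1; funext σ; rw [ker_eq_sum_colInd]; ring

lemma edgeObs_le {lam : ℝ} (hP : PottsPar q lam) (hn : 0 < n) (hm : IsJoint m) :
    edgeObs lam m ≤ edgeTrue lam m + (1 + |Real.log (minRatio q lam)| + |Real.log (3 / 2)|)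
      * (2 * (√q * √(pinEnergy m 1 - colEnergy m))) := by
  have hq0 : 0 < q := by have := hP.1; omega
  set L := 1 + |Real.log (minRatio q lam)| + |Real.log (3 / 2)| with hL
  have hL0 : 0 ≤ L := by positivity
  have key : ∀ o v v', mass m o * LamFn (edgeZ q lam (marg m o v) (marg m o v'))
      ≤ mass m o * LamFn (1 + gib m o (fun σ => lam * ker q (σ v) (σ v'))) + L * (2 * ∑ τ,
        |cm m o (fun σ => colInd v τ σ * colInd v' τ σ)
          - cm m o (colInd v τ) * gib m o (colInd v' τ)|) := by
    intro o v v'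
    by_cases ho : mass m o = 0
    · rw [ho, zero_mul, zero_mul, zero_add]; positivity
    have h1 := edgeZ_bounds hP (marg_mem hm.nonneg ho v) (marg_mem hm.nonneg ho v')
    have hk := fun σ : Fin n → Fin q => lam_ker_bounds hP (σ v) (σ v')
    have h2 : minRatio q lam - 1 ≤ gib m o (fun σ => lam * ker q (σ v) (σ v')) :=
      le_gib hm.nonneg ho fun σ => (hk σ).1
    have h3 : gib m o (fun σ => lam * ker q (σ v) (σ v')) ≤ 1 / 2 :=
      gib_le hm.nonneg o (by norm_num) fun σ => (hk σ).2
    have h4 := abs_LamFn_sub_le hP.minRatio_pos h1.1 h1.2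
      (show minRatio q lam ≤ 1 + gib m o (fun σ => lam * ker q (σ v) (σ v')) by linarith)
      (show 1 + gib m o (fun σ => lam * ker q (σ v) (σ v')) ≤ 3 / 2 by linarith)
    have h5 : mass m o * |edgeZ q lam (marg m o v) (marg m o v')
        - (1 + gib m o (fun σ => lam * ker q (σ v) (σ v')))| ≤ 2 * ∑ τ,
        |cm m o (fun σ => colInd v τ σ * colInd v' τ σ)
          - cm m o (colInd v τ) * gib m o (colInd v' τ)| := by
      have h6 : mass m o * (edgeZ q lam (marg m o v) (marg m o v')
          - (1 + gib m o (fun σ => lam * ker q (σ v) (σ v'))))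
          = -(lam * q) * ∑ τ, (cm m o (fun σ => colInd v τ σ * colInd v' τ σ)
            - cm m o (colInd v τ) * gib m o (colInd v' τ)) := by
        rw [gib_lam_ker ho, edgeZ, sum_sub_distrib]
        have e1 : ∀ τ, cm m o (fun σ => colInd v τ σ * colInd v' τ σ)
            = mass m o * gib m o (fun σ => colInd v τ σ * colInd v' τ σ) :=
          fun τ => (mass_mul_gib hm.nonneg o _).symm
        have e2 : ∀ τ, cm m o (colInd v τ) * gib m o (colInd v' τ)
            = mass m o * (marg m o v τ * marg m o v' τ) := fun τ => by
          rw [← mass_mul_gib hm.nonneg o (colInd v τ), marg, marg]; ring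
        simp only [e1, e2, ← mul_sum]
        ring
      rw [← abs_of_nonneg (mass_nonneg hm.nonneg o), ← abs_mul, h6, abs_mul, abs_neg]
      exact mul_le_mul (abs_lam_mul_q_le hP) (abs_sum_le_sum_abs _ _) (abs_nonneg _) (by norm_num)
    have h7 := mul_le_mul_of_nonneg_left ((le_abs_self _).trans h4) (mass_nonneg hm.nonneg o)
    have h8 := mul_le_mul_of_nonneg_left h5 hL0
    rw [mul_left_comm] at h7
    linarith
  have hcov := avg_cov_le (t := 1) (A := fun τ y => if y 0 = τ then 1 else 0) (K := 1)
    hn hm.nonneg (hm.sum_mass hq0).le zero_le_one (by intro τ y; split_ifs <;> simp)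
  have h9 : ∑ x : (Fin 1 → Fin n) × Fin n × Fin q, (((n : ℝ) ^ 1)⁻¹ * (n : ℝ)⁻¹) *
      ∑ o, |cm m o (fun σ => (if (σ ∘ x.1) 0 = x.2.2 then 1 else 0) * colInd x.2.1 x.2.2 σ)
        - cm m o (fun σ => if (σ ∘ x.1) 0 = x.2.2 then 1 else 0) * gib m o (colInd x.2.1 x.2.2)|
      = ∑ o, ((n : ℝ) ^ 2)⁻¹ * ∑ v, ∑ v', ∑ τ,
        |cm m o (fun σ => colInd v τ σ * colInd v' τ σ)
          - cm m o (colInd v τ) * gib m o (colInd v' τ)| := by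
    rw [← mul_sum, ← mul_sum, sum_comm]
    congr 1
    · rw [pow_one, ← mul_inv, sq]
    · refine sum_congr rfl fun o _ => ?_
      rw [Fintype.sum_prod_type, ← (Equiv.funUnique (Fin 1) (Fin n)).symm.sum_comp]
      refine sum_congr rfl fun v _ => ?_
      rw [Fintype.sum_prod_type]
      rfl
  rw [h9, one_mul] at hcov
  unfold edgeObs edgeTrue edgeEnt
  have h10 := sum_le_sum fun o (_ : o ∈ univ) => mul_le_mul_of_nonneg_left
    (sum_le_sum fun v (_ : v ∈ univ) => sum_le_sum fun v' (_ : v' ∈ univ) => key o v v')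
    (show 0 ≤ ((n : ℝ) ^ 2)⁻¹ by positivity)
  have h11 := mul_le_mul_of_nonneg_left (mul_le_mul_of_nonneg_left hcov zero_le_two) hL0
  have h12 : ∀ o, mass m o * ∑ v, ∑ v', (n : ℝ)⁻¹ * (n : ℝ)⁻¹ *
      LamFn (edgeZ q lam (marg m o v) (marg m o v')) = ((n : ℝ) ^ 2)⁻¹ * ∑ v, ∑ v', mass m o *
        LamFn (edgeZ q lam (marg m o v) (marg m o v')) := fun o => by
    simp only [← mul_sum]
    rw [sq, mul_inv]; ring
  simp only [h12]
  refine h10.trans (le_of_eq_of_le ?_ (add_le_add le_rfl h11))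
  simp only [mul_sum, ← sum_add_distrib]
  refine sum_congr rfl fun o _ => sum_congr rfl fun v _ => sum_congr rfl fun v' _ => ?_
  rw [mul_add, mul_sum]
  congr 1
  · ring
  · exact sum_congr rfl fun τ _ => by ring

end EdgeObserved

section Star

variable {O : Type*} [Fintype O] {q n : ℕ} {m : O → (Fin n → Fin q) → ℝ}

/-- Likelihood contribution of the non-neighbours of a new vertex of color `τ`. -/
noncomputable def offFac (p lam : ℝ) (τ : Fin q) (T : Finset (Fin n)) (σ : Fin n → Fin q) : ℝ :=
  ∏ v ∈ Tᶜ, (1 + -(p * (lam * ker q τ (σ v)) / (1 - p)))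

/-- Likelihood of the neighbourhood `T` of a new vertex of color `τ`. -/
noncomputable def starLik (p lam : ℝ) (τ : Fin q) (T : Finset (Fin n)) (σ : Fin n → Fin q) : ℝ :=
  (∏ v ∈ T, edgeFac q lam τ (σ v)) * offFac p lam τ T σ

/-- Posterior likelihood ratio of the neighbourhood `T` of a new vertex. -/
noncomputable def starW (p lam : ℝ) (m : O → (Fin n → Fin q) → ℝ) (o : O) (T : Finset (Fin n)) : ℝ :=
  (q : ℝ)⁻¹ * ∑ τ, gib m o (starLik p lam τ T)

/-- The probability that a new vertex has neighbourhood `T`. -/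
noncomputable def nbWt (n : ℕ) (p : ℝ) (T : Finset (Fin n)) : ℝ := p ^ #T * (1 - p) ^ (n - #T)

/-- The conditional entropy of the neighbourhood of a new vertex. -/
noncomputable def starTrue (p lam : ℝ) (m : O → (Fin n → Fin q) → ℝ) : ℝ :=
  ∑ o, mass m o * ∑ T, nbWt n p T * LamFn (starW p lam m o T)

lemma sum_nbWt_mul_pow (n : ℕ) (p a : ℝ) :
    ∑ T : Finset (Fin n), nbWt n p T * a ^ #T = (p * a + (1 - p)) ^ n := by
  have h := Finset.sum_pow_mul_eq_add_pow (p * a) (1 - p) (univ : Finset (Fin n))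
  rw [powerset_univ, card_univ, Fintype.card_fin] at h
  rw [← h]
  exact sum_congr rfl fun T _ => by rw [nbWt, mul_pow]; ring

lemma sum_nbWt (n : ℕ) (p : ℝ) : ∑ T : Finset (Fin n), nbWt n p T = 1 := by
  have h := sum_nbWt_mul_pow n p 1
  simpa using h

lemma nbWt_nonneg {p : ℝ} (h0 : 0 ≤ p) (h1 : p ≤ 1) (T : Finset (Fin n)) : 0 ≤ nbWt n p T :=
  mul_nonneg (pow_nonneg h0 _) (pow_nonneg (by linarith) _)

lemma abs_off_le {lam p : ℝ} (hP : PottsPar q lam) (h0 : 0 ≤ p) (h1 : p ≤ 1 / 4) (i j : Fin q) :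
    |-(p * (lam * ker q i j) / (1 - p))| ≤ 2 * p := by
  rw [abs_neg, abs_div, abs_mul, abs_of_nonneg h0, abs_of_pos (show 0 < 1 - p by linarith),
    div_le_iff₀ (by linarith)]
  nlinarith [abs_tilt_le hP i j]

lemma offFac_bounds {lam p d : ℝ} (hP : PottsPar q lam) (h0 : 0 ≤ p) (h1 : p ≤ 1 / 4)
    (hnp : n * p ≤ d) (τ : Fin q) (T : Finset (Fin n)) (σ : Fin n → Fin q) :
    Real.exp (-(4 * d)) ≤ offFac p lam τ T σ ∧ offFac p lam τ T σ ≤ Real.exp (4 * d) := by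
  have h := prod_bounds Tᶜ (r := 2 * p) (by linarith)
    (fun v _ => abs_off_le hP h0 h1 τ (σ v))
  have hc : (#Tᶜ : ℝ) ≤ n := by exact_mod_cast (card_le_univ Tᶜ).trans (by simp)
  have h2 : 2 * (#Tᶜ : ℝ) * (2 * p) ≤ 4 * d := by nlinarith [mul_le_mul_of_nonneg_right hc h0]
  exact ⟨(Real.exp_le_exp.2 (neg_le_neg h2)).trans h.1, h.2.trans (Real.exp_le_exp.2 h2)⟩

lemma abs_offFac_sub_one_le {lam p d : ℝ} (hP : PottsPar q lam) (hn : 0 < n) (h0 : 0 ≤ p)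
    (h1 : p ≤ 1 / 4) (hnp : n * p ≤ d) (τ : Fin q) (T : Finset (Fin n)) (σ : Fin n → Fin q) :
    |offFac p lam τ T σ - 1| ≤ Real.exp (4 * d) *
      (2 * d * |(n : ℝ)⁻¹ * ∑ v, ker q τ (σ v)| + p * (2 * #T + 8 * d)) := by
  have h := abs_prod_sub_one_le Tᶜ (r := 2 * p) (by linarith)
    (fun v _ => abs_off_le hP h0 h1 τ (σ v))
  have hn' : (n : ℝ) ≠ 0 := by positivity
  have hc : (#Tᶜ : ℝ) ≤ n := by exact_mod_cast (card_le_univ Tᶜ).trans (by simp)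
  have hcp := mul_le_mul_of_nonneg_right hc h0
  have h2 : 2 * (#Tᶜ : ℝ) * (2 * p) ≤ 4 * d := by nlinarith
  refine h.trans (mul_le_mul (Real.exp_le_exp.2 h2) ?_ (by positivity) (Real.exp_pos _).le)
  have h3 := sum_add_sum_compl T (fun v => -(p * (lam * ker q τ (σ v)) / (1 - p)))
  have h4 : ∑ v, -(p * (lam * ker q τ (σ v)) / (1 - p))
      = -(lam / (1 - p)) * (n * p) * ((n : ℝ)⁻¹ * ∑ v, ker q τ (σ v)) := by
    rw [mul_sum, mul_sum]
    exact sum_congr rfl fun v _ => by field_simp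
  have h5 : |∑ v ∈ T, -(p * (lam * ker q τ (σ v)) / (1 - p))| ≤ #T * (2 * p) :=
    (abs_sum_le_sum_abs _ _).trans ((sum_le_sum fun v _ => abs_off_le hP h0 h1 τ (σ v)).trans
      (by simp))
  have h6 : |∑ v, -(p * (lam * ker q τ (σ v)) / (1 - p))|
      ≤ 2 * d * |(n : ℝ)⁻¹ * ∑ v, ker q τ (σ v)| := by
    rw [h4, abs_mul]
    refine mul_le_mul_of_nonneg_right ?_ (abs_nonneg _)
    rw [abs_mul, abs_neg, abs_div, abs_of_pos (show 0 < 1 - p by linarith),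
      abs_of_nonneg (show 0 ≤ n * p by positivity)]
    have h7 : |lam| / (1 - p) ≤ 2 := by
      rw [div_le_iff₀ (by linarith), abs_of_neg hP.2.1]
      linarith [hP.neg_half_lt]
    exact mul_le_mul h7 hnp (by positivity) (by norm_num)
  have h8 : |∑ v ∈ Tᶜ, -(p * (lam * ker q τ (σ v)) / (1 - p))|
      ≤ |∑ v, -(p * (lam * ker q τ (σ v)) / (1 - p))|
        + |∑ v ∈ T, -(p * (lam * ker q τ (σ v)) / (1 - p))| := by
    rw [← h3]
    exact (abs_le.2 ⟨by linarith [neg_abs_le (∑ v ∈ T, -(p * (lam * ker q τ (σ v)) / (1 - p)) +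
      ∑ v ∈ Tᶜ, -(p * (lam * ker q τ (σ v)) / (1 - p))), le_abs_self (∑ v ∈ T, -(p * (lam * ker q τ (σ v)) / (1 - p)))], by
      linarith [le_abs_self (∑ v ∈ T, -(p * (lam * ker q τ (σ v)) / (1 - p)) +
      ∑ v ∈ Tᶜ, -(p * (lam * ker q τ (σ v)) / (1 - p))), neg_abs_le (∑ v ∈ T, -(p * (lam * ker q τ (σ v)) / (1 - p)))]⟩)
  have h9 : 2 * (#Tᶜ : ℝ) * (2 * p) ^ 2 ≤ p * (8 * d) := by nlinarith
  linarith

lemma edgeFac_prod_bounds {lam : ℝ} (hP : PottsPar q lam) (τ : Fin q) (T : Finset (Fin n))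
    (σ : Fin n → Fin q) : minRatio q lam ^ #T ≤ ∏ v ∈ T, edgeFac q lam τ (σ v) ∧
      ∏ v ∈ T, edgeFac q lam τ (σ v) ≤ (3 / 2) ^ #T := by
  have hc0 := hP.minRatio_pos
  constructor
  · rw [← prod_const]
    exact prod_le_prod (fun _ _ => hc0.le) fun v _ => (edgeFac_bounds hP τ (σ v)).1
  · rw [← prod_const]
    exact prod_le_prod (fun v _ => hc0.le.trans (edgeFac_bounds hP τ (σ v)).1)
      fun v _ => (edgeFac_bounds hP τ (σ v)).2

lemma starLik_bounds {lam p d : ℝ} (hP : PottsPar q lam) (h0 : 0 ≤ p) (h1 : p ≤ 1 / 4)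
    (hnp : n * p ≤ d) (τ : Fin q) (T : Finset (Fin n)) (σ : Fin n → Fin q) :
    minRatio q lam ^ #T * Real.exp (-(4 * d)) ≤ starLik p lam τ T σ ∧
      starLik p lam τ T σ ≤ (3 / 2) ^ #T * Real.exp (4 * d) := by
  have ha := edgeFac_prod_bounds hP τ T σ
  have hb := offFac_bounds hP h0 h1 hnp τ T σ
  have hc0 := hP.minRatio_pos
  exact ⟨mul_le_mul ha.1 hb.1 (Real.exp_pos _).le ((pow_pos hc0 _).le.trans ha.1),
    mul_le_mul ha.2 hb.2 ((Real.exp_pos _).le.trans hb.1) (by positivity)⟩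

lemma avg_color_bounds {a b : ℝ} (hq : 0 < q) {f : Fin q → ℝ} (h : ∀ τ, a ≤ f τ ∧ f τ ≤ b) :
    a ≤ (q : ℝ)⁻¹ * ∑ τ, f τ ∧ (q : ℝ)⁻¹ * ∑ τ, f τ ≤ b := by
  have hq' : (0 : ℝ) < q := by positivity
  rw [inv_mul_eq_div, le_div_iff₀ hq', div_le_iff₀ hq']
  constructor
  · refine le_trans (by simp [mul_comm]) (sum_le_sum (f := fun _ => a) fun τ _ => (h τ).1)
  · refine le_trans (sum_le_sum (g := fun _ => b) fun τ _ => (h τ).2) (by simp [mul_comm])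

lemma starW_bounds {lam p d : ℝ} (hP : PottsPar q lam) (h0 : 0 ≤ p) (h1 : p ≤ 1 / 4)
    (hnp : n * p ≤ d) (hm : IsJoint m) {o : O} (ho : mass m o ≠ 0) (T : Finset (Fin n)) :
    minRatio q lam ^ #T * Real.exp (-(4 * d)) ≤ starW p lam m o T ∧
      starW p lam m o T ≤ (3 / 2) ^ #T * Real.exp (4 * d) := by
  refine avg_color_bounds (by have := hP.1; omega) fun τ => ⟨?_, ?_⟩
  · exact le_gib hm.nonneg ho fun σ => (starLik_bounds hP h0 h1 hnp τ T σ).1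
  · exact gib_le hm.nonneg o (by positivity) fun σ => (starLik_bounds hP h0 h1 hnp τ T σ).2

/-- The averaged shifted entropy of a neighbourhood. -/
noncomputable def starA (p lam : ℝ) (m : O → (Fin n → Fin q) → ℝ) (T : Finset (Fin n)) : ℝ :=
  ∑ o, mass m o * (LamFn (starW p lam m o T) + 1)

lemma starTrue_add_one (hq : 0 < q) (p lam : ℝ) (hm : IsJoint m) :
    starTrue p lam m + 1 = ∑ T, nbWt n p T * starA p lam m T := by
  unfold starTrue starA
  simp only [mul_sum]
  rw [sum_comm]
  simp only [mul_add, mul_one, sum_add_distrib]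
  rw [sum_comm (f := fun T o => nbWt n p T * mass m o)]
  congr 1
  · exact sum_congr rfl fun o _ => sum_congr rfl fun T _ => by ring
  · simp only [← sum_mul, sum_nbWt, one_mul, hm.sum_mass hq]

lemma starA_le_tail {lam p d : ℝ} (hP : PottsPar q lam) (h0 : 0 ≤ p) (h1 : p ≤ 1 / 4)
    (hnp : n * p ≤ d) (hd : 0 ≤ d) (hm : IsJoint m) (T : Finset (Fin n)) :
    starA p lam m T ≤ 2 * Real.exp (8 * d) * (9 / 4) ^ #T := by
  have hq : 0 < q := by have := hP.1; omega
  have h2 : ∀ o, mass m o * (LamFn (starW p lam m o T) + 1)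
      ≤ mass m o * (2 * Real.exp (8 * d) * (9 / 4) ^ #T) := by
    intro o
    by_cases ho : mass m o = 0
    · simp [ho]
    refine mul_le_mul_of_nonneg_left ?_ (mass_nonneg hm.nonneg o)
    have h3 := starW_bounds hP h0 h1 hnp hm ho T
    have hW : 0 < starW p lam m o T :=
      (mul_pos (pow_pos hP.minRatio_pos _) (Real.exp_pos _)).trans_le h3.1
    have hB : (1 : ℝ) ≤ (3 / 2) ^ #T * Real.exp (4 * d) :=
      one_le_mul_of_one_le_of_one_le (one_le_pow₀ (by norm_num)) (Real.one_le_exp (by linarith))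
    have h4 := (le_abs_self _).trans (abs_LamFn_le hW h3.2 hB)
    have h5 : ((3 / 2 : ℝ) ^ #T * Real.exp (4 * d)) ^ 2 = Real.exp (8 * d) * (9 / 4) ^ #T := by
      rw [mul_pow, ← pow_mul, mul_comm #T 2, pow_mul, ← Real.exp_nat_mul]
      norm_num; rw [mul_comm]; ring_nf
    have h6 := one_le_pow₀ (n := 2) hB
    rw [h5] at h4 h6
    linarith
  refine (sum_le_sum fun o _ => h2 o).trans ?_
  rw [← sum_mul, hm.sum_mass hq, one_mul]

end Star

section StarCompare

variable {O : Type*} [Fintype O] {q n : ℕ} {m : O → (Fin n → Fin q) → ℝ}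

/-- The deviation of the joint conditional law of the vertices `f` from a product. -/
noncomputable def decorrAt (lam : ℝ) (m : O → (Fin n → Fin q) → ℝ) {γ : ℕ} (f : Fin γ → Fin n) : ℝ :=
  ∑ τ, ∑ o, |cm m o (fun σ => ∏ i, edgeFac q lam τ (σ (f i)))
      - mass m o * ∏ i, gib m o (fun σ => edgeFac q lam τ (σ (f i)))|

lemma gib_edgeFac {lam : ℝ} {o : O} (ho : mass m o ≠ 0) (v : Fin n) (τ : Fin q) :
    gib m o (fun σ => edgeFac q lam τ (σ v)) = 1 + lam * (q * marg m o v τ - 1) := by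
  simp only [edgeFac_eq]
  rw [gib_affine ho, marg]; ring

/-- Lipschitz constant of the entropy on the range of the likelihoods of degree `γ`. -/
noncomputable def lipC (q : ℕ) (lam d : ℝ) (γ : ℕ) : ℝ :=
  1 + |Real.log (minRatio q lam ^ γ * Real.exp (-(4 * d)))|
    + |Real.log ((3 / 2) ^ γ * Real.exp (4 * d))|

/-- Error caused by the non-neighbours. -/
noncomputable def offErr (q n : ℕ) (p d : ℝ) (γ : ℕ) : ℝ :=
  (3 / 2) ^ γ * (Real.exp (4 * d) * (2 * d * imbal q n + p * (2 * γ + 8 * d)))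

lemma starA_le_of_injective {lam p d : ℝ} (hP : PottsPar q lam) (hn : 0 < n) (h0 : 0 ≤ p)
    (h1 : p ≤ 1 / 4) (hnp : n * p ≤ d) (hd : 0 ≤ d) (hm : IsJoint m) {γ : ℕ} {f : Fin γ → Fin n}
    (hf : Function.Injective f) :
    starA p lam m (univ.image f) ≤ ∑ o, mass m o * (LamFn (vertexZ q lam fun i => marg m o (f i)) + 1)
      + lipC q lam d γ * (decorrAt lam m f + offErr q n p d γ) := by
  have hq : 0 < q := by have := hP.1; omega
  have hq' : (0 : ℝ) < q := by positivity
  set T := univ.image f with hT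
  have hcard : #T = γ := by rw [hT, card_image_of_injective _ hf]; simp
  have hc0 := hP.minRatio_pos
  set L := lipC q lam d γ with hL
  have hL0 : 0 ≤ L := by rw [hL]; unfold lipC; positivity
  have hprod : ∀ (τ : Fin q) (σ : Fin n → Fin q), ∏ v ∈ T, edgeFac q lam τ (σ v)
      = ∏ i, edgeFac q lam τ (σ (f i)) := fun τ σ => by
    rw [hT, prod_image (fun _ _ _ _ h => hf h)]
  have key : ∀ o, mass m o * (LamFn (starW p lam m o T) + 1)
      ≤ mass m o * (LamFn (vertexZ q lam fun i => marg m o (f i)) + 1)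
        + L * ((q : ℝ)⁻¹ * ∑ τ, (|cm m o (fun σ => ∏ i, edgeFac q lam τ (σ (f i)))
            - mass m o * ∏ i, gib m o (fun σ => edgeFac q lam τ (σ (f i)))|
          + (3 / 2) ^ γ * cm m o (fun σ => |offFac p lam τ T σ - 1|))) := by
    intro o
    have hcmabs : ∀ τ, 0 ≤ cm m o (fun σ => |offFac p lam τ T σ - 1|) := fun τ =>
      sum_nonneg fun σ _ => mul_nonneg (hm.nonneg o σ) (abs_nonneg _)
    by_cases ho : mass m o = 0
    · rw [ho, zero_mul, zero_mul, zero_add]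
      refine mul_nonneg hL0 (mul_nonneg (by positivity) (sum_nonneg fun τ _ => add_nonneg
        (abs_nonneg _) (mul_nonneg (by positivity) (hcmabs τ))))
    have hS := starW_bounds hP h0 h1 hnp hm ho T
    have hV : minRatio q lam ^ γ ≤ vertexZ q lam (fun i => marg m o (f i)) ∧
        vertexZ q lam (fun i => marg m o (f i)) ≤ (3 / 2) ^ γ := by
      refine avg_color_bounds hq fun τ => ?_
      have hfb := fun i => factor_bounds hP ((marg_mem hm.nonneg ho (f i)).1 τ)
        (le_one_of_mem_stdSimplex (marg_mem hm.nonneg ho (f i)) τ)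
      constructor
      · refine le_trans (by simp) (prod_le_prod (s := univ) (f := fun _ => minRatio q lam)
          (fun _ _ => hc0.le) fun i _ => (hfb i).1)
      · refine (prod_le_prod (s := univ) (g := fun _ => (3 / 2 : ℝ)) (fun i _ => hc0.le.trans (hfb i).1)
          fun i _ => (hfb i).2).trans (by simp [div_pow])
    rw [hcard] at hS
    have he1 : Real.exp (-(4 * d)) ≤ 1 := Real.exp_le_one_iff.2 (by linarith)
    have he2 : 1 ≤ Real.exp (4 * d) := Real.one_le_exp (by linarith)
    have hlip := abs_LamFn_sub_le (mul_pos (pow_pos hc0 γ) (Real.exp_pos _)) hS.1 hS.2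
      ((mul_le_of_le_one_right (pow_pos hc0 γ).le he1).trans hV.1)
      (hV.2.trans (le_mul_of_one_le_right (by positivity) he2))
    have hdiff : mass m o * (starW p lam m o T - vertexZ q lam (fun i => marg m o (f i)))
        = (q : ℝ)⁻¹ * ∑ τ, ((cm m o (fun σ => ∏ i, edgeFac q lam τ (σ (f i)))
            - mass m o * ∏ i, gib m o (fun σ => edgeFac q lam τ (σ (f i))))
          + cm m o (fun σ => (∏ i, edgeFac q lam τ (σ (f i))) * (offFac p lam τ T σ - 1))) := by
      have e1 : ∀ τ, cm m o (fun σ => (∏ i, edgeFac q lam τ (σ (f i))) * (offFac p lam τ T σ - 1))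
          = mass m o * gib m o (starLik p lam τ T)
            - cm m o (fun σ => ∏ i, edgeFac q lam τ (σ (f i))) := fun τ => by
        rw [mass_mul_gib hm.nonneg, cm, cm, cm, ← sum_sub_distrib]
        refine sum_congr rfl fun σ _ => ?_
        rw [starLik, hprod]; ring
      simp only [e1, gib_edgeFac ho]
      unfold starW vertexZ
      rw [← mul_sub, ← sum_sub_distrib, mul_left_comm, mul_sum]
      congr 1
      exact sum_congr rfl fun τ _ => by ring
    have habs : mass m o * |starW p lam m o T - vertexZ q lam (fun i => marg m o (f i))|
        ≤ (q : ℝ)⁻¹ * ∑ τ, (|cm m o (fun σ => ∏ i, edgeFac q lam τ (σ (f i)))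
            - mass m o * ∏ i, gib m o (fun σ => edgeFac q lam τ (σ (f i)))|
          + (3 / 2) ^ γ * cm m o (fun σ => |offFac p lam τ T σ - 1|)) := by
      rw [← abs_of_nonneg (mass_nonneg hm.nonneg o), ← abs_mul, hdiff, abs_mul,
        abs_of_pos (inv_pos.2 hq'), abs_of_nonneg (mass_nonneg hm.nonneg o)]
      refine mul_le_mul_of_nonneg_left ((abs_sum_le_sum_abs _ _).trans
        (sum_le_sum fun τ _ => (abs_add_le _ _).trans (add_le_add le_rfl ?_))) (by positivity)
      rw [cm, cm, mul_sum]
      refine (abs_sum_le_sum_abs _ _).trans (sum_le_sum fun σ _ => ?_)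
      have h2 := edgeFac_prod_bounds hP τ T σ
      rw [hprod, hcard] at h2
      rw [abs_mul, abs_mul, abs_of_nonneg (hm.nonneg o σ),
        abs_of_nonneg ((pow_pos hc0 γ).le.trans h2.1), mul_left_comm]
      exact mul_le_mul_of_nonneg_right h2.2 (mul_nonneg (hm.nonneg o σ) (abs_nonneg _))
    have h7 := mul_le_mul_of_nonneg_left ((le_abs_self _).trans hlip) (mass_nonneg hm.nonneg o)
    have h8 := mul_le_mul_of_nonneg_left habs hL0
    rw [mul_left_comm] at h7
    change _ ≤ L * _ at h7
    linarith
  refine (sum_le_sum fun o _ => key o).trans ?_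
  rw [sum_add_distrib]
  refine add_le_add le_rfl ?_
  rw [← mul_sum]
  refine mul_le_mul_of_nonneg_left ?_ hL0
  rw [← mul_sum, sum_comm]
  simp only [sum_add_distrib, ← mul_sum, hm.sum_cm]
  have hoff : ∑ τ : Fin q, ((q : ℝ) ^ n)⁻¹ * ∑ σ : Fin n → Fin q, |offFac p lam τ T σ - 1|
      ≤ Real.exp (4 * d) * (2 * d * imbal q n + q * (p * (2 * γ + 8 * d))) := by
    have h2 : ∀ τ : Fin q, ((q : ℝ) ^ n)⁻¹ * ∑ σ : Fin n → Fin q, |offFac p lam τ T σ - 1|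
        ≤ ((q : ℝ) ^ n)⁻¹ * ∑ σ : Fin n → Fin q, Real.exp (4 * d) *
          (2 * d * |(n : ℝ)⁻¹ * ∑ v, ker q τ (σ v)| + p * (2 * γ + 8 * d)) := fun τ => by
      refine mul_le_mul_of_nonneg_left (sum_le_sum fun σ _ => ?_) (by positivity)
      have := abs_offFac_sub_one_le hP hn h0 h1 hnp τ T σ
      rwa [hcard] at this
    refine (sum_le_sum fun τ _ => h2 τ).trans (le_of_eq ?_)
    unfold imbal
    rw [sum_comm (f := fun (σ : Fin n → Fin q) τ => |(n : ℝ)⁻¹ * ∑ v, ker q τ (σ v)|)]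
    simp only [← mul_sum, sum_add_distrib, sum_const, card_univ, Fintype.card_fin, nsmul_eq_mul,
      Fintype.card_fun]
    push_cast
    have : ((q : ℝ) ^ n) ≠ 0 := by positivity
    field_simp
  have hdec : 0 ≤ ∑ τ, ∑ o, |cm m o (fun σ => ∏ i, edgeFac q lam τ (σ (f i)))
      - mass m o * ∏ i, gib m o (fun σ => edgeFac q lam τ (σ (f i)))| :=
    sum_nonneg fun _ _ => sum_nonneg fun _ _ => abs_nonneg _
  have hqi : (q : ℝ)⁻¹ ≤ 1 := by
    rw [inv_le_one₀ hq']; exact_mod_cast hq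
  rw [mul_add]
  refine add_le_add (mul_le_of_le_one_left hdec hqi) ?_
  unfold offErr
  simp only [← mul_sum] at hoff
  rw [mul_left_comm]
  refine mul_le_mul_of_nonneg_left ?_ (by positivity)
  refine (mul_le_mul_of_nonneg_left hoff (inv_nonneg.2 hq'.le)).trans ?_
  rw [mul_left_comm]
  refine mul_le_mul_of_nonneg_left ?_ (Real.exp_pos _).le
  rw [mul_add, inv_mul_cancel_left₀ hq'.ne']
  exact add_le_add (mul_le_of_le_one_left (mul_nonneg (by linarith) (imbal_nonneg q n)) hqi) le_rfl

lemma factorial_mul_sum_powersetCard_le {γ : ℕ} {A : Finset (Fin n) → ℝ} {G : (Fin γ → Fin n) → ℝ}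
    (hG : ∀ f, 0 ≤ G f) (h : ∀ f : Fin γ → Fin n, Function.Injective f → A (univ.image f) ≤ G f) :
    (γ.factorial : ℝ) * ∑ T ∈ powersetCard γ univ, A T ≤ ∑ f, G f := by
  classical
  let φ : {T : Finset (Fin n) // #T = γ} × Equiv.Perm (Fin γ) → (Fin γ → Fin n) :=
    fun x i => x.1.1.orderEmbOfFin x.1.2 (x.2 i)
  have himg : ∀ x, univ.image (φ x) = x.1.1 := fun x => by
    have : φ x = (x.1.1.orderEmbOfFin x.1.2) ∘ x.2 := rfl
    rw [this, ← image_image, image_univ_of_surjective x.2.surjective]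
    apply Finset.coe_injective
    rw [coe_image, coe_univ, Set.image_univ, Finset.range_orderEmbOfFin]
  have hφinj : ∀ x, Function.Injective (φ x) := fun x =>
    (x.1.1.orderEmbOfFin x.1.2).injective.comp x.2.injective
  have hφ : Function.Injective φ := by
    rintro ⟨⟨T, hT⟩, π⟩ ⟨⟨T', hT'⟩, π'⟩ hxy
    have h1 : T = T' := ((himg _).symm.trans (congrArg (image · univ) hxy)).trans (himg _)
    subst h1
    have h2 : π = π' := by
      ext i
      have := congrFun hxy i
      exact congrArg Fin.val ((T.orderEmbOfFin hT).injective this)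
    rw [h2]
  have h1 : (γ.factorial : ℝ) * ∑ T ∈ powersetCard γ univ, A T
      = ∑ x : {T : Finset (Fin n) // #T = γ} × Equiv.Perm (Fin γ), A x.1.1 := by
    rw [Fintype.sum_prod_type]
    simp only [sum_const, card_univ, Fintype.card_perm, Fintype.card_fin, nsmul_eq_mul]
    rw [← mul_sum]
    congr 1
    rw [← Finset.sum_subtype (powersetCard γ univ) (f := A) (p := fun T => #T = γ)]
    intro T; simp [mem_powersetCard]
  rw [h1]
  calc ∑ x, A x.1.1 ≤ ∑ x, G (φ x) := sum_le_sum fun x _ => by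
        rw [← himg x]; exact h _ (hφinj x)
    _ = ∑ f ∈ univ.map ⟨φ, hφ⟩, G f := by rw [sum_map]; rfl
    _ ≤ ∑ f, G f := sum_le_univ_sum_of_nonneg hG

end StarCompare

section StarBound

variable {O : Type*} [Fintype O] {q n : ℕ} {m : O → (Fin n → Fin q) → ℝ}

/-- The binomial approximation of the Poisson weights. -/
noncomputable def binWt (n : ℕ) (p : ℝ) (γ : ℕ) : ℝ :=
  (n * p) ^ γ * (1 - p) ^ (n - γ) / γ.factorial

lemma binWt_le {p d : ℝ} (h0 : 0 ≤ p) (h1 : p ≤ 1) (hnp : n * p ≤ d) (γ : ℕ) :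
    binWt n p γ ≤ d ^ γ := by
  unfold binWt
  have h2 : (n * p) ^ γ ≤ d ^ γ := pow_le_pow_left₀ (by positivity) hnp γ
  have h3 : (1 - p) ^ (n - γ) ≤ 1 := pow_le_one₀ (by linarith) (by linarith)
  have h4 : (1 : ℝ) ≤ γ.factorial := by exact_mod_cast γ.factorial_pos
  have h5 : 0 ≤ (n * p) ^ γ := by positivity
  refine (div_le_self (mul_nonneg h5 (pow_nonneg (by linarith) _)) h4).trans ?_
  exact (mul_le_of_le_one_right h5 h3).trans h2

lemma tendsto_binWt (d : ℝ) (γ : ℕ) :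
    Filter.Tendsto (fun n : ℕ => binWt n (d / ((n : ℝ) + 1)) γ) Filter.atTop (nhds (poisWt d γ)) := by
  have hp : Filter.Tendsto (fun n : ℕ => d / ((n : ℝ) + 1)) Filter.atTop (nhds 0) := by
    have := (tendsto_const_div_atTop_nhds_zero_nat d).comp (Filter.tendsto_add_atTop_nat 1)
    refine this.congr fun n => by simp
  have h1 : Filter.Tendsto (fun n : ℕ => (n : ℝ) * (d / ((n : ℝ) + 1))) Filter.atTop (nhds d) := by
    have h2 : Filter.Tendsto (fun n : ℕ => d - d / ((n : ℝ) + 1)) Filter.atTop (nhds (d - 0)) :=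
      tendsto_const_nhds.sub hp
    rw [sub_zero] at h2
    refine h2.congr fun n => ?_
    have : (n : ℝ) + 1 ≠ 0 := by positivity
    field_simp; ring
  have h3 : Filter.Tendsto (fun n : ℕ => (1 - d / ((n : ℝ) + 1)) ^ (n + 1)) Filter.atTop
      (nhds (Real.exp (-d))) := by
    refine ((Real.tendsto_one_add_div_pow_exp (-d)).comp (Filter.tendsto_add_atTop_nat 1)).congr
      fun n => ?_
    simp only [Function.comp, neg_div, Nat.cast_add, Nat.cast_one, sub_eq_add_neg]
  have h4 : Filter.Tendsto (fun n : ℕ => (1 - d / ((n : ℝ) + 1)) ^ (γ + 1)) Filter.atTop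
      (nhds 1) := by
    have := (tendsto_const_nhds (x := (1 : ℝ))).sub hp |>.pow (γ + 1)
    simpa using this
  have h5 := ((h1.pow γ).mul (h3.div h4 one_ne_zero)).div_const (γ.factorial : ℝ)
  rw [div_one, mul_comm] at h5
  refine h5.congr' ?_
  have hlt := hp.eventually (gt_mem_nhds (show (0 : ℝ) < 1 by norm_num))
  filter_upwards [Filter.eventually_ge_atTop γ, hlt] with n hn hlt
  unfold binWt
  congr 2
  rw [Pi.div_apply, div_eq_iff (pow_ne_zero _ (by linarith)), ← pow_add]
  congr 1; omega

lemma tendsto_offErr (hq : 0 < q) (d : ℝ) (γ : ℕ) :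
    Filter.Tendsto (fun n : ℕ => offErr q n (d / ((n : ℝ) + 1)) d γ) Filter.atTop (nhds 0) := by
  have hp : Filter.Tendsto (fun n : ℕ => d / ((n : ℝ) + 1)) Filter.atTop (nhds 0) := by
    have := (tendsto_const_div_atTop_nhds_zero_nat d).comp (Filter.tendsto_add_atTop_nat 1)
    refine this.congr fun n => by simp
  have h := ((((tendsto_imbal hq).const_mul (2 * d)).add
    (hp.mul_const (2 * (γ : ℝ) + 8 * d))).const_mul (Real.exp (4 * d))).const_mul ((3 / 2 : ℝ) ^ γ)
  simpa [offErr] using h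

lemma abs_vertexObs_le {lam : ℝ} (hP : PottsPar q lam) (hn : 0 < n) (hm : IsJoint m) (γ : ℕ) :
    |vertexObs lam m γ| ≤ (9 / 4) ^ γ := by
  have hn' : (n : ℝ) ≠ 0 := by positivity
  have hq : 0 < q := by have := hP.1; omega
  refine (abs_sum_le_sum_abs _ _).trans ((sum_le_sum (g := fun o => mass m o * (9 / 4) ^ γ)
    fun o _ => ?_).trans (by rw [← sum_mul, hm.sum_mass hq, one_mul]))
  rw [abs_mul, abs_of_nonneg (mass_nonneg hm.nonneg o)]
  by_cases ho : mass m o = 0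
  · simp [ho]
  exact mul_le_mul_of_nonneg_left (abs_vertexEnt_le hP (fun _ => by positivity) (by simp [hn'])
    (marg_mem hm.nonneg ho) γ) (mass_nonneg hm.nonneg o)

lemma vertexObs_add_one {lam : ℝ} (hq : 0 < q) (hn : 0 < n) (hm : IsJoint m) (γ : ℕ) :
    vertexObs lam m γ + 1 = ((n : ℝ) ^ γ)⁻¹ * ∑ f : Fin γ → Fin n,
      ∑ o, mass m o * (LamFn (vertexZ q lam fun i => marg m o (f i)) + 1) := by
  have hn' : (n : ℝ) ≠ 0 := by positivity
  unfold vertexObs vertexEnt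
  simp only [mul_add, sum_add_distrib, mul_one, hm.sum_mass hq]
  rw [sum_comm, mul_sum]
  congr 1
  · refine sum_congr rfl fun o _ => ?_
    rw [mul_sum, mul_sum]
    exact sum_congr rfl fun f _ => by simp; ring
  · simp [hn']

lemma vertexObs_add_one_nonneg {lam : ℝ} (hP : PottsPar q lam) (hm : IsJoint m)
    {γ : ℕ} (f : Fin γ → Fin n) :
    0 ≤ ∑ o, mass m o * (LamFn (vertexZ q lam fun i => marg m o (f i)) + 1) := by
  refine sum_nonneg fun o _ => ?_
  by_cases ho : mass m o = 0
  · simp [ho]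
  exact mul_nonneg (mass_nonneg hm.nonneg o) (by
    linarith [neg_one_le_LamFn (vertexZ_bounds hP fun i => marg_mem hm.nonneg ho (f i)).1.le])

lemma lipC_nonneg (q : ℕ) (lam d : ℝ) (γ : ℕ) : 0 ≤ lipC q lam d γ := by unfold lipC; positivity

lemma offErr_nonneg {p d : ℝ} (h0 : 0 ≤ p) (hd : 0 ≤ d) (γ : ℕ) : 0 ≤ offErr q n p d γ := by
  unfold offErr
  have := imbal_nonneg q n
  positivity

lemma decorr_eq (lam : ℝ) (m : O → (Fin n → Fin q) → ℝ) (γ : ℕ) :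
    decorr lam m γ = ((n : ℝ) ^ γ)⁻¹ * ∑ f : Fin γ → Fin n, decorrAt lam m f := rfl

lemma decorrAt_nonneg (lam : ℝ) (m : O → (Fin n → Fin q) → ℝ) {γ : ℕ} (f : Fin γ → Fin n) :
    0 ≤ decorrAt lam m f := sum_nonneg fun _ _ => sum_nonneg fun _ _ => abs_nonneg _

lemma decorr_nonneg (lam : ℝ) (m : O → (Fin n → Fin q) → ℝ) (γ : ℕ) : 0 ≤ decorr lam m γ := by
  rw [decorr_eq]
  exact mul_nonneg (by positivity) (sum_nonneg fun f _ => decorrAt_nonneg lam m f)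

lemma sum_card_eq_starA_le {lam p d : ℝ} (hP : PottsPar q lam) (hn : 0 < n) (h0 : 0 ≤ p)
    (h1 : p ≤ 1 / 4) (hnp : n * p ≤ d) (hd : 0 ≤ d) (hm : IsJoint m) (γ : ℕ) :
    ∑ T ∈ powersetCard γ univ, nbWt n p T * starA p lam m T ≤ binWt n p γ *
      (vertexObs lam m γ + 1 + lipC q lam d γ * (decorr lam m γ + offErr q n p d γ)) := by
  have hq : 0 < q := by have := hP.1; omega
  have hn' : (n : ℝ) ≠ 0 := by positivity
  have h2 := factorial_mul_sum_powersetCard_le (γ := γ) (A := starA p lam m)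
    (fun f => add_nonneg (vertexObs_add_one_nonneg hP hm f) (mul_nonneg (lipC_nonneg q lam d γ)
      (add_nonneg (decorrAt_nonneg lam m f) (offErr_nonneg h0 hd γ))))
    (fun f hf => starA_le_of_injective hP hn h0 h1 hnp hd hm hf)
  have h3 : ∑ T ∈ powersetCard γ univ, nbWt n p T * starA p lam m T
      = (p ^ γ * (1 - p) ^ (n - γ)) * ∑ T ∈ powersetCard γ univ, starA p lam m T := by
    rw [mul_sum]
    refine sum_congr rfl fun T hT => ?_
    rw [nbWt, (mem_powersetCard.1 hT).2]
  have h4 : (0 : ℝ) < γ.factorial := by exact_mod_cast γ.factorial_pos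
  have h5 : vertexObs lam m γ + 1 + lipC q lam d γ * (decorr lam m γ + offErr q n p d γ)
      = ((n : ℝ) ^ γ)⁻¹ * ∑ f : Fin γ → Fin n,
        (∑ o, mass m o * (LamFn (vertexZ q lam fun i => marg m o (f i)) + 1)
          + lipC q lam d γ * (decorrAt lam m f + offErr q n p d γ)) := by
    rw [vertexObs_add_one hq hn hm, decorr_eq, sum_add_distrib, ← mul_sum, sum_add_distrib]
    simp only [sum_const, card_univ, Fintype.card_fun, Fintype.card_fin, nsmul_eq_mul]
    push_cast
    field_simp
  rw [h3, h5]
  have h6 : 0 ≤ p ^ γ * (1 - p) ^ (n - γ) :=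
    mul_nonneg (pow_nonneg h0 _) (pow_nonneg (by linarith) _)
  have h7 := mul_le_mul_of_nonneg_left h2 (div_nonneg h6 h4.le)
  rw [div_mul_eq_mul_div, mul_left_comm, mul_div_cancel_left₀ _ h4.ne'] at h7
  refine h7.trans (le_of_eq ?_)
  unfold binWt
  rw [mul_pow]
  field_simp

/-- The entropy of the neighbourhood of a new vertex is bounded by the vertex functional. -/
lemma starTrue_le {lam d : ℝ} (hP : PottsPar q lam) (hd : 0 < d) (Γ : ℕ) :
    ∃ C, 0 ≤ C ∧ ∃ δ : ℕ → ℝ, Filter.Tendsto δ Filter.atTop (nhds 0) ∧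
      ∀ᶠ n : ℕ in Filter.atTop, ∀ {O : Type} [Fintype O] {m : O → (Fin n → Fin q) → ℝ}, IsJoint m →
        starTrue (d / ((n : ℝ) + 1)) lam m ≤ ∑ γ ∈ range Γ, poisWt d γ * vertexObs lam m γ
          + C * ∑ γ ∈ range Γ, decorr lam m γ + 2 * Real.exp (12 * d) * (1 / 2) ^ Γ + δ n := by
  have hq : 0 < q := by have := hP.1; omega
  refine ⟨∑ γ ∈ range Γ, d ^ γ * lipC q lam d γ,
    sum_nonneg fun γ _ => mul_nonneg (by positivity) (lipC_nonneg q lam d γ),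
    fun n => ∑ γ ∈ range Γ, (|binWt n (d / ((n : ℝ) + 1)) γ - poisWt d γ| * (1 + (9 / 4) ^ γ)
      + d ^ γ * lipC q lam d γ * offErr q n (d / ((n : ℝ) + 1)) d γ), ?_, ?_⟩
  · have h1 : Filter.Tendsto (fun n : ℕ => ∑ γ ∈ range Γ,
        (|binWt n (d / ((n : ℝ) + 1)) γ - poisWt d γ| * (1 + (9 / 4) ^ γ)
        + d ^ γ * lipC q lam d γ * offErr q n (d / ((n : ℝ) + 1)) d γ)) Filter.atTop
        (nhds (∑ γ ∈ range Γ, (|poisWt d γ - poisWt d γ| * (1 + (9 / 4) ^ γ)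
          + d ^ γ * lipC q lam d γ * 0))) :=
      tendsto_finsetSum _ fun γ _ => ((((tendsto_binWt d γ).sub_const _).abs).mul_const _).add
        ((tendsto_offErr hq d γ).const_mul _)
    simpa using h1
  filter_upwards [eventually_div_nat_lt d (show (0 : ℝ) < 1 / 4 by norm_num)] with n hn O _ m hm
  obtain ⟨hn0, hlt⟩ := hn
  have hn' : (0 : ℝ) < n := by positivity
  set p := d / ((n : ℝ) + 1) with hp
  have h0 : 0 ≤ p := by positivity
  have hpn : p ≤ d / n := by rw [hp]; gcongr; linarith
  have h1 : p ≤ 1 / 4 := hpn.trans hlt.le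
  have hnp : n * p ≤ d := by
    refine (mul_le_mul_of_nonneg_left hpn hn'.le).trans (le_of_eq ?_)
    field_simp
  have hsplit := starTrue_add_one hq p lam hm
  rw [← sum_filter_add_sum_filter_not univ (fun T : Finset (Fin n) => #T < Γ)] at hsplit
  have hsmall : ∑ T : Finset (Fin n) with #T < Γ, nbWt n p T * starA p lam m T
      = ∑ γ ∈ range Γ, ∑ T ∈ powersetCard γ univ, nbWt n p T * starA p lam m T := by
    rw [← sum_fiberwise_of_maps_to (s := univ.filter fun T : Finset (Fin n) => #T < Γ)
      (t := range Γ) (g := fun T => #T) (by intro T hT; simpa using hT)]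
    refine sum_congr rfl fun γ hγ => sum_congr ?_ fun _ _ => rfl
    ext T
    simp only [mem_filter, mem_univ, true_and, mem_powersetCard, subset_univ]
    constructor
    · exact fun h => h.2
    · exact fun h => ⟨h ▸ mem_range.1 hγ, h⟩
  have htail : ∑ T : Finset (Fin n) with ¬ #T < Γ, nbWt n p T * starA p lam m T
      ≤ 2 * Real.exp (12 * d) * (1 / 2) ^ Γ := by
    have h2 : ∀ T ∈ univ.filter (fun T : Finset (Fin n) => ¬ #T < Γ), nbWt n p T * starA p lam m T
        ≤ 2 * Real.exp (8 * d) * (1 / 2) ^ Γ * (nbWt n p T * (9 / 2) ^ #T) := by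
      intro T hT
      have hT' : Γ ≤ #T := by simpa using hT
      have h3 := starA_le_tail hP h0 h1 hnp hd.le hm T
      have h4 : ((9 / 4 : ℝ)) ^ #T ≤ (1 / 2) ^ Γ * (9 / 2) ^ #T := by
        rw [show (9 / 4 : ℝ) = 1 / 2 * (9 / 2) by norm_num, mul_pow]
        exact mul_le_mul_of_nonneg_right
          (pow_le_pow_of_le_one (by norm_num) (by norm_num) hT') (by positivity)
      have h5 := nbWt_nonneg h0 (by linarith) T
      calc nbWt n p T * starA p lam m T
          ≤ nbWt n p T * (2 * Real.exp (8 * d) * ((1 / 2) ^ Γ * (9 / 2) ^ #T)) :=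
            mul_le_mul_of_nonneg_left (h3.trans (mul_le_mul_of_nonneg_left h4 (by positivity))) h5
        _ = _ := by ring
    refine (sum_le_sum h2).trans ?_
    rw [← mul_sum]
    have h6 : ∑ T : Finset (Fin n) with ¬ #T < Γ, nbWt n p T * (9 / 2) ^ #T ≤ Real.exp (4 * d) := by
      refine (sum_le_univ_sum_of_nonneg fun T => mul_nonneg (nbWt_nonneg h0 (by linarith) T)
        (by positivity)).trans ?_
      rw [sum_nbWt_mul_pow]
      have h7 : p * (9 / 2) + (1 - p) ≤ Real.exp (7 / 2 * p) := by
        linarith [Real.add_one_le_exp (7 / 2 * p)]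
      refine (pow_le_pow_left₀ (by linarith) h7 n).trans ?_
      rw [← Real.exp_nat_mul]
      exact Real.exp_le_exp.2 (by nlinarith)
    refine (mul_le_mul_of_nonneg_left h6 (by positivity)).trans (le_of_eq ?_)
    rw [show 12 * d = 8 * d + 4 * d by ring, Real.exp_add]; ring
  have hlevel : ∀ γ ∈ range Γ, ∑ T ∈ powersetCard γ univ, nbWt n p T * starA p lam m T
      ≤ poisWt d γ * vertexObs lam m γ + poisWt d γ
        + (∑ γ ∈ range Γ, d ^ γ * lipC q lam d γ) * decorr lam m γ
        + (|binWt n p γ - poisWt d γ| * (1 + (9 / 4) ^ γ)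
          + d ^ γ * lipC q lam d γ * offErr q n p d γ) := by
    intro γ hγ
    have h2 := sum_card_eq_starA_le hP hn0 h0 h1 hnp hd.le hm γ
    have h3 := abs_le.1 (abs_vertexObs_le hP hn0 hm γ)
    have h4 : 0 ≤ vertexObs lam m γ + 1 := by
      rw [vertexObs_add_one hq hn0 hm]
      exact mul_nonneg (by positivity) (sum_nonneg fun f _ => vertexObs_add_one_nonneg hP hm f)
    have h5 : (binWt n p γ - poisWt d γ) * (vertexObs lam m γ + 1)
        ≤ |binWt n p γ - poisWt d γ| * (1 + (9 / 4) ^ γ) :=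
      (mul_le_mul_of_nonneg_right (le_abs_self _) h4).trans
        (mul_le_mul_of_nonneg_left (by linarith) (abs_nonneg _))
    have hb := binWt_le h0 (by linarith) hnp γ
    have hL := lipC_nonneg q lam d γ
    have hbL := mul_le_mul_of_nonneg_right hb hL
    have h6 := mul_le_mul_of_nonneg_right hbL (offErr_nonneg (q := q) (n := n) h0 hd.le γ)
    have h7 := mul_le_mul_of_nonneg_right (hbL.trans (single_le_sum
      (f := fun γ => d ^ γ * lipC q lam d γ)
      (fun γ _ => mul_nonneg (pow_nonneg hd.le _) (lipC_nonneg q lam d γ)) hγ))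
      (decorr_nonneg lam m γ)
    linarith
  have hsum := sum_le_sum hlevel
  simp only [sum_add_distrib, ← mul_sum] at hsum
  have hpois : ∑ γ ∈ range Γ, poisWt d γ ≤ 1 :=
    sum_le_hasSum _ (fun γ _ => poisWt_nonneg hd.le γ) (poisWt_hasSum d)
  rw [hsmall] at hsplit
  simp only [sum_add_distrib]
  linarith

end StarBound

section EdgePosterior

variable {ι X : Type*} [Fintype ι] [DecidableEq ι] [Fintype X]

/-- Lipschitz constant of the entropy on the range of the edge likelihoods. -/
noncomputable def edgeLip (c0 : ℝ) : ℝ := 1 + |Real.log c0| + |Real.log (3 / 2)|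

lemma one_le_edgeLip (c0 : ℝ) : 1 ≤ edgeLip c0 := by
  unfold edgeLip; linarith [abs_nonneg (Real.log c0), abs_nonneg (Real.log (3 / 2))]

lemma abs_LamFn_one_add_le {c0 x : ℝ} (hc : 0 < c0) (h1 : c0 - 1 ≤ x) (h2 : x ≤ 1 / 2) :
    |LamFn (1 + x)| ≤ 9 / 4 := by
  have := abs_LamFn_le (x := 1 + x) (B := 3 / 2) (by linarith) (by linarith) (by norm_num)
  linarith

lemma mul_LamFn_one_add_div {a b : ℝ} (ha : 0 < a) :
    a * LamFn (1 + b / a) = (a + b) * Real.log ((a + b) / a) := by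
  unfold LamFn
  rw [one_add_div ha.ne']
  field_simp

/-- Removing an unlikely edge from the observation changes the edge entropy only slightly. -/
lemma edge_posterior_step {c0 : ℝ} (hc : 0 < c0) {p ℓ m s A1 B1 A0 B0 : ℝ}
    (hp0 : 0 ≤ p) (hp1 : p ≤ 1 / 2) (hℓ : 0 < ℓ) (hm1 : (c0 - 1) * ℓ ≤ m)
    (hm2 : m ≤ ℓ / 2) (hs0 : 0 ≤ s) (hs : s ≤ ℓ) (hA1 : A1 = ℓ + m) (hA1p : 0 < A1)
    (hB1 : (c0 - 1) * A1 ≤ B1) (hB1' : B1 ≤ A1 / 2) (hA0 : A0 = ℓ - p / (1 - p) * m)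
    (hB0 : B0 = m - p / (1 - p) * s) (hA0p : 0 < A0) (hB0l : (c0 - 1) * A0 ≤ B0)
    (hB0u : B0 ≤ A0 / 2) :
    p * (A1 * LamFn (1 + B1 / A1)) + (1 - p) * (A0 * LamFn (1 + B0 / A0))
      ≤ ℓ * LamFn (1 + m / ℓ) + 20 * edgeLip c0 * p * ℓ := by
  have hL := one_le_edgeLip c0
  have hq : 0 < 1 - p := by linarith
  set r := p / (1 - p) with hr
  have hr0 : 0 ≤ r := div_nonneg hp0 hq.le
  have hr2 : r ≤ 2 * p := by rw [hr, div_le_iff₀ hq]; nlinarith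
  have hx1 : c0 - 1 ≤ m / ℓ := by rwa [le_div_iff₀ hℓ]
  have hx2 : m / ℓ ≤ 1 / 2 := by rw [div_le_iff₀ hℓ]; linarith
  have hy1 : c0 - 1 ≤ B1 / A1 := by rwa [le_div_iff₀ hA1p]
  have hy2 : B1 / A1 ≤ 1 / 2 := by rw [div_le_iff₀ hA1p]; linarith
  have hz1 : c0 - 1 ≤ B0 / A0 := by rwa [le_div_iff₀ hA0p]
  have hz2 : B0 / A0 ≤ 1 / 2 := by rw [div_le_iff₀ hA0p]; linarith
  have hf1 := (abs_le.1 (abs_LamFn_one_add_le hc hy1 hy2)).2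
  obtain ⟨hf0, hf0'⟩ := abs_le.1 (abs_LamFn_one_add_le hc hx1 hx2)
  have hml : -ℓ ≤ m := by nlinarith
  have e1 : A1 * LamFn (1 + B1 / A1) ≤ 27 / 8 * ℓ := by nlinarith
  have hlip := abs_LamFn_sub_le hc (show c0 ≤ 1 + B0 / A0 by linarith)
    (show 1 + B0 / A0 ≤ 3 / 2 by linarith) (show c0 ≤ 1 + m / ℓ by linarith)
    (show 1 + m / ℓ ≤ 3 / 2 by linarith)
  change _ ≤ edgeLip c0 * _ at hlip
  have e2 : A0 * |1 + B0 / A0 - (1 + m / ℓ)| ≤ 2 * r * ℓ := by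
    have h1 : A0 * (1 + B0 / A0 - (1 + m / ℓ)) = -r * (s - m / ℓ * m) := by
      have : A0 * (B0 / A0) = B0 := mul_div_cancel₀ _ hA0p.ne'
      rw [show A0 * (1 + B0 / A0 - (1 + m / ℓ)) = A0 * (B0 / A0) - A0 * (m / ℓ) by ring, this, hB0,
        hA0]
      field_simp; ring
    rw [← abs_of_pos hA0p, ← abs_mul, abs_of_pos hA0p, h1, abs_mul, abs_neg, abs_of_nonneg hr0]
    have h2 : |s - m / ℓ * m| ≤ 2 * ℓ := by
      have h3 : m / ℓ * m ≤ ℓ := by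
        rw [div_mul_eq_mul_div, div_le_iff₀ hℓ]; nlinarith
      have h4 : 0 ≤ m / ℓ * m := by
        rw [div_mul_eq_mul_div]; exact div_nonneg (mul_self_nonneg m) hℓ.le
      rw [abs_le]; constructor <;> linarith
    calc r * |s - m / ℓ * m| ≤ r * (2 * ℓ) := mul_le_mul_of_nonneg_left h2 hr0
      _ = 2 * r * ℓ := by ring
  have e3 : A0 * LamFn (1 + B0 / A0) ≤ A0 * LamFn (1 + m / ℓ) + edgeLip c0 * (2 * r * ℓ) := by
    have h1 := mul_le_mul_of_nonneg_left ((le_abs_self _).trans hlip) hA0p.le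
    rw [mul_left_comm] at h1
    have h2 := mul_le_mul_of_nonneg_left e2 (by linarith : 0 ≤ edgeLip c0)
    linarith
  have e4 : A0 * LamFn (1 + m / ℓ) ≤ ℓ * LamFn (1 + m / ℓ) + r * ℓ * (9 / 4) := by
    have h1 : -(r * m) * LamFn (1 + m / ℓ) ≤ r * ℓ * (9 / 4) := by
      refine (le_abs_self _).trans ?_
      rw [abs_mul, abs_neg, abs_mul, abs_of_nonneg hr0]
      have h2 : |m| ≤ ℓ := abs_le.2 ⟨hml, by linarith⟩
      exact mul_le_mul (mul_le_mul_of_nonneg_left h2 hr0) (abs_LamFn_one_add_le hc hx1 hx2)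
        (abs_nonneg _) (by positivity)
    rw [hA0]; linarith
  have e5 : (1 - p) * (ℓ * LamFn (1 + m / ℓ)) ≤ ℓ * LamFn (1 + m / ℓ) + p * ℓ * (9 / 4) := by
    nlinarith [mul_nonneg hp0 hℓ.le]
  have e6 : (1 - p) * (r * ℓ * (9 / 4) + edgeLip c0 * (2 * r * ℓ))
      ≤ 2 * p * ℓ * (9 / 4) + edgeLip c0 * (2 * (2 * p) * ℓ) := by
    have h1 : 0 ≤ r * ℓ * (9 / 4) + edgeLip c0 * (2 * r * ℓ) := by positivity
    refine (mul_le_of_le_one_left h1 (by linarith)).trans ?_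
    gcongr
  have e7 := mul_le_mul_of_nonneg_left e1 hp0
  have e8 := mul_le_mul_of_nonneg_left (e3.trans (add_le_add e4 le_rfl)) hq.le
  have e9 : p * ℓ ≤ p * ℓ * edgeLip c0 := le_mul_of_one_le_right (by positivity) hL
  nlinarith [mul_nonneg hp0 hℓ.le]

/-- The entropy of an edge under the posterior given all edges. -/
lemma avg_edge_posterior_le {c0 : ℝ} (hc : 0 < c0) (hc1 : c0 ≤ 1) {θ : ι → X → ℝ} (hθ : Tilt c0 θ)
    {μ : X → ℝ} (hμ : PosWt μ) {p : ι → ℝ} (hp : Box p) (e : ι) :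
    avg p (fun g => tot p θ μ g * LamFn (1 + tot p θ (fun x => μ x * θ e x) g / tot p θ μ g))
      ≤ avg p (fun g => (totE p θ e μ g + totE p θ e (fun x => μ x * θ e x) g) *
          Real.log ((totE p θ e μ g + totE p θ e (fun x => μ x * θ e x) g) / totE p θ e μ g))
        + 20 * edgeLip c0 * p e * ∑ x, μ x := by
  have hE : avg p (fun g => totE p θ e μ g) = ∑ x, μ x := avg_tot p hp _ μ
  rw [← hE, ← avg_mul, ← avg_add, avg_coord p e]
  refine avg_mono hp fun g => ?_
  have hbd : ∀ g, (c0 - 1) * tot p θ μ g ≤ tot p θ (fun x => μ x * θ e x) g ∧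
      tot p θ (fun x => μ x * θ e x) g ≤ tot p θ μ g / 2 := fun g => by
    have hl := fun x => (lik_pos hc hp hθ g x).le
    simp only [tot, mul_sum, sum_div]
    constructor
    · refine sum_le_sum fun x _ => ?_
      have := mul_le_mul_of_nonneg_left (hθ e x).1 (mul_nonneg (hμ.1 x) (hl x))
      linarith
    · refine sum_le_sum fun x _ => ?_
      have := mul_le_mul_of_nonneg_left (hθ e x).2 (mul_nonneg (hμ.1 x) (hl x))
      linarith
  have hsq : ∀ x, 0 ≤ θ e x * θ e x ∧ θ e x * θ e x ≤ 1 := fun x => by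
    have := hθ e x
    constructor <;> nlinarith
  have hl := fun x => (lik_pos hc hp (hθ.update hc1 e) g x).le
  have hℓ := totE_pos hc hc1 hp hθ hμ e g
  have hm := totE_mul_bounds hc hc1 hp hθ hμ.1 e g
  rw [← mul_LamFn_one_add_div hℓ]
  refine edge_posterior_step (s := totE p θ e (fun x => μ x * θ e x * θ e x) g) hc (hp e).1 (hp e).2
    hℓ hm.1 hm.2 ?_ ?_ (tot_true p θ e μ g) (tot_pos hc hp hθ hμ _) (hbd _).1 (hbd _).2
    (tot_false p θ e μ g) (tot_false p θ e _ g) (tot_pos hc hp hθ hμ _) (hbd _).1 (hbd _).2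
  · refine sum_nonneg fun x _ => mul_nonneg ?_ (hl x)
    beta_reduce
    rw [mul_assoc]
    exact mul_nonneg (hμ.1 x) (hsq x).1
  · refine sum_le_sum fun x _ => mul_le_mul_of_nonneg_right ?_ (hl x)
    beta_reduce
    rw [mul_assoc]
    exact mul_le_of_le_one_right (hμ.1 x) (hsq x).2

/-- Entropy gained by raising the edge probabilities in terms of the full posterior. -/
lemma ent_gain_posterior {c0 : ℝ} (hc : 0 < c0) (hc1 : c0 ≤ 1) {θ : ι → X → ℝ} (hθ : Tilt c0 θ)
    {μ : X → ℝ} (hμ : ∀ x, 0 ≤ μ x) {p p' : ι → ℝ} (hp : Box p) (hp' : Box p')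
    (hpp : ∀ e, p e ≤ p' e) :
    ∑ e, (p' e - p e) * (avg p (fun g => tot p θ μ g *
        LamFn (1 + tot p θ (fun x => μ x * θ e x) g / tot p θ μ g))
        - ∑ x, μ x * θ e x - 20 * edgeLip c0 * p e * ∑ x, μ x)
      ≤ avg p' (fun g => LamFn (tot p' θ μ g)) - avg p (fun g => LamFn (tot p θ μ g)) := by
  by_cases h : ∃ x, 0 < μ x
  · refine le_trans (sum_le_sum fun e _ => mul_le_mul_of_nonneg_left ?_
      (sub_nonneg.2 (hpp e))) (ent_gain hc hc1 hθ ⟨hμ, h⟩ hp hp' hpp)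
    have h1 := avg_edge_posterior_le hc hc1 hθ ⟨hμ, h⟩ hp e
    have h2 : avg p (fun g => totE p θ e (fun x => μ x * θ e x) g) = ∑ x, μ x * θ e x :=
      avg_tot p hp _ _
    rw [avg_sub, h2]
    linarith
  · have h0 : μ = fun _ => 0 := by
      funext x; push Not at h; exact le_antisymm (h x) (hμ x)
    subst h0
    simp [tot, LamFn, avg]

end EdgePosterior

section PinnedEntropy

variable {q n : ℕ}

/-- Uniform weights restricted to the colorings with prescribed colors on `u`. -/
noncomputable def pinWt {s : ℕ} (u : Fin s → Fin n) (y : Fin s → Fin q) (σ : Fin n → Fin q) : ℝ :=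
  if σ ∘ u = y then ((q : ℝ) ^ n)⁻¹ else 0

/-- The entropy of the graph when the colors of the vertices `u` are revealed. -/
noncomputable def pinEnt (lam p : ℝ) {s : ℕ} (q : ℕ) (u : Fin s → Fin n) : ℝ :=
  ∑ y : Fin s → Fin q,
    avg (fun _ => p) (fun g => LamFn (tot (fun _ => p) (tilt q lam n) (pinWt u y) g))

/-- The joint law of the coloring and the graph. -/
noncomputable def joint (q : ℕ) (lam : ℝ) (n : ℕ) (p : ℝ) (g : GraphCfg n) (σ : Fin n → Fin q) : ℝ :=
  bern (fun _ => p) g * (((q : ℝ) ^ n)⁻¹ * lik (fun _ => p) (tilt q lam n) g σ)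

lemma isJoint_joint {lam p : ℝ} (hP : PottsPar q lam) (h0 : 0 ≤ p) (h1 : p ≤ 1 / 2) :
    IsJoint (joint q lam n p) := by
  refine ⟨fun g σ => mul_nonneg (bern_nonneg (box_const h0 h1) g) (mul_nonneg (by positivity)
    (lik_pos hP.minRatio_pos (box_const h0 h1) (tilt_tilt hP n) g σ).le), fun σ => ?_⟩
  have h := avg_tot (fun _ : EdgeIdx n => p) (box_const h0 h1) (tilt q lam n)
    (fun σ' => if σ' = σ then ((q : ℝ) ^ n)⁻¹ else 0)
  simpa [avg, tot, joint] using h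

lemma cm_pin_joint (lam p : ℝ) {s : ℕ} (u : Fin s → Fin n) (g : GraphCfg n) (y : Fin s → Fin q)
    (f : (Fin n → Fin q) → ℝ) : cm (pin (joint q lam n p) u) (g, y) f
      = bern (fun _ => p) g * tot (fun _ => p) (tilt q lam n) (fun σ => pinWt u y σ * f σ) g := by
  unfold cm pin joint tot pinWt
  rw [mul_sum]
  refine sum_congr rfl fun σ _ => ?_
  dsimp only
  split_ifs <;> ring

lemma mass_pin_joint (lam p : ℝ) {s : ℕ} (u : Fin s → Fin n) (g : GraphCfg n) (y : Fin s → Fin q) :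
    mass (pin (joint q lam n p) u) (g, y)
      = bern (fun _ => p) g * tot (fun _ => p) (tilt q lam n) (pinWt u y) g := by
  rw [mass_eq_cm, cm_pin_joint]; simp

lemma bern_pos {ι : Type*} [Fintype ι] [DecidableEq ι] {p : ℝ} (h0 : 0 < p) (h1 : p < 1)
    (g : ι → Bool) : 0 < bern (fun _ => p) g := by
  refine prod_pos fun e _ => ?_
  unfold bw
  split_ifs <;> linarith

lemma gib_pin_joint {lam p : ℝ} (h0 : 0 < p) (h1 : p < 1) {s : ℕ} (u : Fin s → Fin n)
    (g : GraphCfg n) (y : Fin s → Fin q) (f : (Fin n → Fin q) → ℝ) :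
    gib (pin (joint q lam n p) u) (g, y) f
      = tot (fun _ => p) (tilt q lam n) (fun σ => pinWt u y σ * f σ) g
        / tot (fun _ => p) (tilt q lam n) (pinWt u y) g := by
  rw [gib, cm_pin_joint, mass_pin_joint, mul_div_mul_left _ _ (bern_pos h0 h1 g).ne']

lemma sum_pinWt {s : ℕ} (u : Fin s → Fin n) (σ : Fin n → Fin q) :
    ∑ y, pinWt u y σ = ((q : ℝ) ^ n)⁻¹ := by
  simp [pinWt]

lemma pinWt_nonneg {s : ℕ} (u : Fin s → Fin n) (y : Fin s → Fin q) (σ : Fin n → Fin q) :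
    0 ≤ pinWt u y σ := by
  unfold pinWt; split_ifs <;> positivity

lemma sum_ker_pair {v v' : Fin n} (h : v ≠ v') : ∑ σ : Fin n → Fin q, ker q (σ v) (σ v') = 0 := by
  rw [← (Equiv.funSplitAt v' (Fin q)).symm.sum_comp, Fintype.sum_prod_type, sum_comm]
  refine sum_eq_zero fun x _ => ?_
  simp only [Equiv.funSplitAt_symm_apply, dif_pos, dif_neg h]
  exact sum_ker _

/-- The entropy gained by raising the edge probability, in terms of the edge functional. -/
lemma pinEnt_gain {lam p p' : ℝ} (hP : PottsPar q lam) (hn : 0 < n) (h0 : 0 < p) (hpp : p ≤ p')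
    (h1 : p' ≤ 1 / 2) {s : ℕ} (u : Fin s → Fin n) :
    (p' - p) * ((n : ℝ) ^ 2 / 2 * edgeTrue lam (pin (joint q lam n p) u) - 2 * n
      - 20 * edgeLip (minRatio q lam) * p * n ^ 2) ≤ pinEnt lam p' q u - pinEnt lam p q u := by
  have hq : 0 < q := by have := hP.1; omega
  have hc := hP.minRatio_pos
  have hn' : (n : ℝ) ≠ 0 := by positivity
  have hb := box_const (ι := EdgeIdx n) h0.le (hpp.trans h1)
  have hb' := box_const (ι := EdgeIdx n) (h0.le.trans hpp) h1
  have hJ := (isJoint_joint (n := n) hP h0.le (hpp.trans h1)).pin u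
  set m := pin (joint q lam n p) u with hm
  set F : Fin n → Fin n → ℝ := fun v v' =>
    ∑ o, mass m o * LamFn (1 + gib m o (fun σ => lam * ker q (σ v) (σ v'))) with hF
  have hgain := sum_le_sum fun y (_ : y ∈ (univ : Finset (Fin s → Fin q))) =>
    ent_gain_posterior hc hP.minRatio_le (tilt_tilt hP n) (pinWt_nonneg u y) hb hb' (fun _ => hpp)
  rw [sum_sub_distrib, sum_comm] at hgain
  change _ ≤ pinEnt lam p' q u - pinEnt lam p q u at hgain
  refine le_trans ?_ hgain
  have hterm : ∀ e : EdgeIdx n, ∑ y : Fin s → Fin q, (p' - p) *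
      (avg (fun _ => p) (fun g => tot (fun _ => p) (tilt q lam n) (pinWt u y) g *
        LamFn (1 + tot (fun _ => p) (tilt q lam n) (fun x => pinWt u y x * tilt q lam n e x) g
          / tot (fun _ => p) (tilt q lam n) (pinWt u y) g))
        - ∑ x, pinWt u y x * tilt q lam n e x - 20 * edgeLip (minRatio q lam) * p * ∑ x, pinWt u y x)
      = (p' - p) * (F e.1.1 e.1.2 - 20 * edgeLip (minRatio q lam) * p) := by
    intro e
    rw [← mul_sum, sum_sub_distrib, sum_sub_distrib, ← mul_sum]
    congr 1
    have e1 : ∑ y : Fin s → Fin q, ∑ x, pinWt u y x = 1 := by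
      rw [sum_comm]; simp only [sum_pinWt]; simp [hq.ne']
    have e2 : ∑ y : Fin s → Fin q, ∑ x, pinWt u y x * tilt q lam n e x = 0 := by
      rw [sum_comm]
      simp only [← sum_mul, sum_pinWt, tilt]
      rw [← mul_sum, ← mul_sum, sum_ker_pair e.2.ne, mul_zero, mul_zero]
    rw [e1, e2, sub_zero, mul_one]
    congr 1
    rw [hF]
    dsimp only
    rw [Fintype.sum_prod_type, sum_comm]
    refine sum_congr rfl fun y _ => sum_congr rfl fun g _ => ?_
    rw [hm, mass_pin_joint, gib_pin_joint h0 (by linarith), mul_assoc]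
    rfl
  simp only [hterm]
  rw [← mul_sum]
  refine mul_le_mul_of_nonneg_left ?_ (by linarith)
  have hsymm := sum_edgeIdx F (fun a b => by simp only [hF, ker_symm])
  have hFle : ∀ v, F v v ≤ 9 / 4 := by
    intro v
    have h2 : ∀ o, mass m o * LamFn (1 + gib m o (fun σ => lam * ker q (σ v) (σ v)))
        ≤ mass m o * (9 / 4) := by
      intro o
      by_cases ho : mass m o = 0
      · simp [ho]
      refine mul_le_mul_of_nonneg_left ((le_abs_self _).trans (abs_LamFn_one_add_le hc
        (le_gib hJ.nonneg ho fun σ => (lam_ker_bounds hP (σ v) (σ v)).1)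
        (gib_le hJ.nonneg o (by norm_num) fun σ => (lam_ker_bounds hP (σ v) (σ v)).2)))
        (mass_nonneg hJ.nonneg o)
    refine (sum_le_sum fun o _ => h2 o).trans ?_
    rw [← sum_mul, hJ.sum_mass hq, one_mul]
  have hdiag : ∑ v, F v v ≤ n * (9 / 4) :=
    (sum_le_sum fun v _ => hFle v).trans (by simp)
  have hET : (n : ℝ) ^ 2 * edgeTrue lam m = ∑ v, ∑ v', F v v' := by
    have e1 : ∑ v, ∑ v', F v v' = ∑ o, ∑ v, ∑ v', mass m o *
        LamFn (1 + gib m o (fun σ => lam * ker q (σ v) (σ v'))) := by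
      simp only [hF]
      rw [sum_comm]
      rw [show (∑ o, ∑ v, ∑ v', mass m o * LamFn (1 + gib m o (fun σ => lam * ker q (σ v) (σ v'))))
        = ∑ v, ∑ o, ∑ v', mass m o * LamFn (1 + gib m o (fun σ => lam * ker q (σ v) (σ v')))
        from sum_comm]
      rw [sum_comm]
      exact sum_congr rfl fun v _ => sum_comm
    rw [e1, edgeTrue, mul_sum]
    refine sum_congr rfl fun o _ => ?_
    simp only [← mul_sum]
    field_simp
  have hcard : (Fintype.card (EdgeIdx n) : ℝ) ≤ n ^ 2 := by
    have : Fintype.card (EdgeIdx n) ≤ Fintype.card (Fin n × Fin n) := Fintype.card_subtype_le _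
    rw [Fintype.card_prod, Fintype.card_fin, ← sq] at this
    exact_mod_cast this
  rw [sum_sub_distrib, sum_const, card_univ, nsmul_eq_mul]
  have hK : 0 ≤ 20 * edgeLip (minRatio q lam) * p := by
    have := one_le_edgeLip (minRatio q lam); positivity
  have := mul_le_mul_of_nonneg_right hcard hK
  have hnn : (0 : ℝ) ≤ n := by positivity
  linarith

end PinnedEntropy

section VertexAdding

variable {q n : ℕ}

lemma edgeJoin_bijective (n : ℕ) : Function.Bijective (Sum.elim
    (fun e : EdgeIdx n => (⟨(e.1.1.castSucc, e.1.2.castSucc), e.2⟩ : EdgeIdx (n + 1)))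
    (fun v : Fin n => ⟨(v.castSucc, Fin.last n), Fin.castSucc_lt_last v⟩)) := by
  constructor
  · rintro (e | v) (e' | v') h
    · simp only [Sum.elim_inl, Subtype.mk.injEq, Prod.mk.injEq, Fin.castSucc_inj] at h
      exact congrArg Sum.inl (Subtype.ext (Prod.ext h.1 h.2))
    · simp only [Sum.elim_inl, Sum.elim_inr, Subtype.mk.injEq, Prod.mk.injEq] at h
      exact absurd h.2 (Fin.castSucc_lt_last _).ne
    · simp only [Sum.elim_inl, Sum.elim_inr, Subtype.mk.injEq, Prod.mk.injEq] at h
      exact absurd h.2 (Fin.castSucc_lt_last _).ne'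
    · simp only [Sum.elim_inr, Subtype.mk.injEq, Prod.mk.injEq, Fin.castSucc_inj] at h
      exact congrArg Sum.inr h.1
  · rintro ⟨⟨a, b⟩, hab⟩
    change a < b at hab
    obtain ⟨a, rfl⟩ := Fin.exists_castSucc_eq.2 (hab.trans_le (Fin.le_last b)).ne
    by_cases hb : b = Fin.last n
    · subst hb
      exact ⟨Sum.inr a, rfl⟩
    · obtain ⟨b, rfl⟩ := Fin.exists_castSucc_eq.2 hb
      exact ⟨Sum.inl ⟨(a, b), hab⟩, rfl⟩

/-- The edges on `n + 1` vertices are those on `n` vertices and those at the last vertex. -/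
noncomputable def edgeJoin (n : ℕ) : EdgeIdx n ⊕ Fin n ≃ EdgeIdx (n + 1) :=
  Equiv.ofBijective _ (edgeJoin_bijective n)

lemma edgeJoin_inl (e : EdgeIdx n) :
    edgeJoin n (Sum.inl e) = ⟨(e.1.1.castSucc, e.1.2.castSucc), e.2⟩ := rfl

lemma edgeJoin_inr (v : Fin n) :
    edgeJoin n (Sum.inr v) = ⟨(v.castSucc, Fin.last n), Fin.castSucc_lt_last v⟩ := rfl

/-- Subsets as indicator functions. -/
def finsetIndicator (n : ℕ) : Finset (Fin n) ≃ (Fin n → Bool) where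
  toFun T v := decide (v ∈ T)
  invFun h := univ.filter (fun v => h v = true)
  left_inv T := by ext; simp
  right_inv h := by ext; simp

/-- The graph `g` with one more vertex whose neighbourhood is `T`. -/
noncomputable def extend (n : ℕ) : GraphCfg n × Finset (Fin n) ≃ GraphCfg (n + 1) :=
  ((Equiv.refl _).prodCongr (finsetIndicator n)).trans
    ((Equiv.sumArrowEquivProdArrow _ _ _).symm.trans ((edgeJoin n).arrowCongr (Equiv.refl _)))

lemma extend_inl (g : GraphCfg n) (T : Finset (Fin n)) (e : EdgeIdx n) :
    extend n (g, T) (edgeJoin n (Sum.inl e)) = g e := by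
  simp [extend]

lemma extend_inr (g : GraphCfg n) (T : Finset (Fin n)) (v : Fin n) :
    extend n (g, T) (edgeJoin n (Sum.inr v)) = decide (v ∈ T) := by
  simp [extend, finsetIndicator]

lemma prod_edgeJoin (f : EdgeIdx (n + 1) → ℝ) :
    ∏ e, f e = (∏ e, f (edgeJoin n (Sum.inl e))) * ∏ v, f (edgeJoin n (Sum.inr v)) := by
  rw [← (edgeJoin n).prod_comp, Fintype.prod_sum_type]

lemma prod_decide_mem (T : Finset (Fin n)) (a : Bool → Fin n → ℝ) :
    ∏ v, a (decide (v ∈ T)) v = (∏ v ∈ T, a true v) * ∏ v ∈ Tᶜ, a false v := by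
  rw [← prod_mul_prod_compl T]
  congr 1
  · exact prod_congr rfl fun v hv => by rw [decide_eq_true hv]
  · exact prod_congr rfl fun v hv => by rw [decide_eq_false (mem_compl.1 hv)]

lemma bern_extend (p : ℝ) (g : GraphCfg n) (T : Finset (Fin n)) :
    bern (fun _ => p) (extend n (g, T)) = bern (fun _ => p) g * nbWt n p T := by
  simp only [bern, prod_edgeJoin, extend_inl, extend_inr]
  rw [prod_decide_mem T (fun b _ => bw p b), nbWt]
  simp [bw, card_compl]

lemma lik_extend (lam p : ℝ) (g : GraphCfg n) (T : Finset (Fin n)) (σ : Fin n → Fin q) (τ : Fin q) :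
    lik (fun _ => p) (tilt q lam (n + 1)) (extend n (g, T)) (Fin.snoc σ τ : Fin (n + 1) → Fin q)
      = lik (fun _ => p) (tilt q lam n) g σ * starLik p lam τ T σ := by
  simp only [lik, prod_edgeJoin, extend_inl, extend_inr]
  congr 1
  · refine prod_congr rfl fun e _ => ?_
    simp [tilt, edgeJoin_inl]
  · rw [prod_decide_mem T (fun b v => lr p (tilt q lam (n + 1) (edgeJoin n (Sum.inr v))
      (Fin.snoc σ τ : Fin (n + 1) → Fin q)) b), starLik, offFac]
    simp only [tilt, edgeJoin_inr, Fin.snoc_castSucc, Fin.snoc_last, lr, edgeFac, ker_symm τ,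
      if_true, Bool.false_eq_true, if_false, sub_eq_add_neg]

lemma sum_snoc (f : (Fin (n + 1) → Fin q) → ℝ) :
    ∑ σ, f σ = ∑ τ, ∑ σ : Fin n → Fin q, f (Fin.snoc σ τ : Fin (n + 1) → Fin q) := by
  rw [← (Fin.snocEquiv (fun _ => Fin q)).sum_comp, Fintype.sum_prod_type]
  rfl

lemma pinWt_snoc {s : ℕ} (u : Fin s → Fin n) (y : Fin s → Fin q) (σ : Fin n → Fin q) (τ : Fin q) :
    pinWt (fun i => (u i).castSucc) y (Fin.snoc σ τ : Fin (n + 1) → Fin q)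
      = (q : ℝ)⁻¹ * pinWt u y σ := by
  have h : (Fin.snoc σ τ : Fin (n + 1) → Fin q) ∘ (fun i => (u i).castSucc) = σ ∘ u := by
    ext i; simp
  rw [pinWt, pinWt, h, pow_succ]
  split_ifs <;> simp [mul_comm]

lemma sum_nbWt_mul_starLik {p : ℝ} (h1 : p < 1) (lam : ℝ) (τ : Fin q) (σ : Fin n → Fin q) :
    ∑ T, nbWt n p T * starLik p lam τ T σ = 1 := by
  have h := Finset.prod_add (fun v => p * edgeFac q lam τ (σ v))
    (fun v => (1 - p) * (1 + -(p * (lam * ker q τ (σ v)) / (1 - p)))) (univ : Finset (Fin n))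
  rw [powerset_univ] at h
  have h2 : ∀ v : Fin n, p * edgeFac q lam τ (σ v)
      + (1 - p) * (1 + -(p * (lam * ker q τ (σ v)) / (1 - p))) = 1 := fun v => by
    have : 1 - p ≠ 0 := by linarith
    rw [edgeFac]; field_simp; ring
  simp only [h2, prod_const_one] at h
  rw [h]
  refine sum_congr rfl fun T _ => ?_
  rw [prod_mul_distrib, prod_mul_distrib, prod_const, prod_const, ← compl_eq_univ_sdiff, card_compl,
    Fintype.card_fin, nbWt, starLik, offFac]
  ring

lemma LamFn_mul_add (a b : ℝ) : LamFn (a * b) = LamFn a * b + a * LamFn b := by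
  unfold LamFn
  rcases eq_or_ne a 0 with rfl | ha
  · simp
  rcases eq_or_ne b 0 with rfl | hb
  · simp
  rw [Real.log_mul ha hb]; ring

lemma tot_extend {lam p : ℝ} (hP : PottsPar q lam) (h0 : 0 < p) (h1 : p ≤ 1 / 2) {s : ℕ}
    (u : Fin s → Fin n) (y : Fin s → Fin q) (g : GraphCfg n) (T : Finset (Fin n)) :
    tot (fun _ => p) (tilt q lam (n + 1)) (pinWt (fun i => (u i).castSucc) y) (extend n (g, T))
      = tot (fun _ => p) (tilt q lam n) (pinWt u y) g
        * starW p lam (pin (joint q lam n p) u) (g, y) T := by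
  have hm := (isJoint_joint (n := n) hP h0.le h1).pin u
  have hB := (bern_pos (ι := EdgeIdx n) h0 (by linarith : p < 1) g).ne'
  have h2 : ∀ f, tot (fun _ => p) (tilt q lam n) (pinWt u y) g
      * gib (pin (joint q lam n p) u) (g, y) f
      = tot (fun _ => p) (tilt q lam n) (fun σ => pinWt u y σ * f σ) g := fun f => by
    have h := mass_mul_gib hm.nonneg (g, y) f
    rw [mass_pin_joint, cm_pin_joint, mul_assoc] at h
    exact mul_left_cancel₀ hB h
  rw [starW, mul_left_comm, mul_sum]
  simp only [h2]
  rw [tot, sum_snoc, mul_sum]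
  refine sum_congr rfl fun τ _ => ?_
  rw [tot, mul_sum]
  refine sum_congr rfl fun σ _ => ?_
  rw [pinWt_snoc, lik_extend]
  ring

lemma sum_nbWt_mul_starW {p lam : ℝ} (hq : 0 < q) (h1 : p < 1) {O : Type*} [Fintype O]
    {m : O → (Fin n → Fin q) → ℝ} {o : O} (ho : mass m o ≠ 0) :
    ∑ T, nbWt n p T * starW p lam m o T = 1 := by
  have hq' : (q : ℝ) ≠ 0 := by positivity
  have h : ∀ τ : Fin q, ∑ T, nbWt n p T * gib m o (starLik p lam τ T) = 1 := fun τ => by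
    simp only [gib, cm, mul_div_assoc', ← sum_div, mul_sum]
    rw [sum_comm, div_eq_one_iff_eq ho, mass]
    refine sum_congr rfl fun σ _ => ?_
    conv_rhs => rw [← mul_one (m o σ), ← sum_nbWt_mul_starLik h1 lam τ σ, mul_sum]
    exact sum_congr rfl fun T _ => mul_left_comm _ _ _
  simp only [starW, mul_left_comm _ (q : ℝ)⁻¹, ← mul_sum]
  simp only [mul_sum (s := (univ : Finset (Fin q)))]
  rw [sum_comm]
  simp [h, hq']

/-- The chain rule for the entropy when a vertex is added. -/
lemma pinEnt_succ {lam p : ℝ} (hP : PottsPar q lam) (h0 : 0 < p) (h1 : p ≤ 1 / 2) {s : ℕ}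
    (u : Fin s → Fin n) :
    pinEnt lam p q (fun i => (u i).castSucc)
      = pinEnt lam p q u + starTrue p lam (pin (joint q lam n p) u) := by
  have hq : 0 < q := by have := hP.1; omega
  have hm := (isJoint_joint (n := n) hP h0.le h1).pin u
  rw [starTrue, Fintype.sum_prod_type, sum_comm, pinEnt, pinEnt, ← sum_add_distrib]
  refine sum_congr rfl fun y _ => ?_
  rw [avg, avg, ← (extend n).sum_comp, Fintype.sum_prod_type, ← sum_add_distrib]
  refine sum_congr rfl fun g _ => ?_
  simp only [bern_extend, tot_extend hP h0 h1, LamFn_mul_add, mul_add, sum_add_distrib, mul_sum]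
  congr 1
  · by_cases ho : tot (fun _ => p) (tilt q lam n) (pinWt u y) g = 0
    · simp [ho, LamFn]
    have h := sum_nbWt_mul_starW (lam := lam) hq (by linarith : p < 1)
      (m := pin (joint q lam n p) u) (o := (g, y)) (by
        rw [mass_pin_joint]
        exact mul_ne_zero (bern_pos h0 (by linarith) g).ne' ho)
    rw [← mul_one (bern _ g * LamFn _), ← h, mul_sum]
    exact sum_congr rfl fun T _ => by ring
  · refine sum_congr rfl fun T _ => ?_
    rw [mass_pin_joint]; ring

end VertexAdding

section PinMean

variable {q n S : ℕ}

/-- The mean over a random number of random pins. -/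
noncomputable def pinMean (S n : ℕ) (f : ∀ s : ℕ, (Fin s → Fin n) → ℝ) : ℝ :=
  (S : ℝ)⁻¹ * ∑ s ∈ range S, ((n : ℝ) ^ s)⁻¹ * ∑ u : Fin s → Fin n, f s u

lemma pinMean_mono {f g : ∀ s : ℕ, (Fin s → Fin n) → ℝ} (h : ∀ s < S, ∀ u, f s u ≤ g s u) :
    pinMean S n f ≤ pinMean S n g := by
  refine mul_le_mul_of_nonneg_left (sum_le_sum fun s hs => mul_le_mul_of_nonneg_left
    (sum_le_sum fun u _ => h s (mem_range.1 hs) u) (by positivity)) (by positivity)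

lemma pinMean_add (f g : ∀ s : ℕ, (Fin s → Fin n) → ℝ) :
    pinMean S n (fun s u => f s u + g s u) = pinMean S n f + pinMean S n g := by
  simp [pinMean, mul_add, sum_add_distrib]

lemma pinMean_mul (a : ℝ) (f : ∀ s : ℕ, (Fin s → Fin n) → ℝ) :
    pinMean S n (fun s u => a * f s u) = a * pinMean S n f := by
  simp only [pinMean, ← mul_sum, mul_left_comm _ a]

lemma pinMean_sum {κ : Type*} (t : Finset κ) (f : κ → ∀ s : ℕ, (Fin s → Fin n) → ℝ) :
    pinMean S n (fun s u => ∑ i ∈ t, f i s u) = ∑ i ∈ t, pinMean S n (f i) := by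
  classical
  induction t using Finset.induction_on with
  | empty => simp [pinMean]
  | insert a t ha ih => simp only [sum_insert ha, pinMean_add, ih]

lemma pinMean_const (hS : 0 < S) (hn : 0 < n) (a : ℝ) : pinMean S n (fun _ _ => a) = a := by
  have h : ∀ s, ((n : ℝ) ^ s)⁻¹ * ∑ _u : Fin s → Fin n, a = a := fun s => by
    have h := pow_inv_mul_card (n := n) (t := s) hn
    rw [← mul_one a, ← mul_sum, mul_left_comm, h]
  have hS' : (S : ℝ) ≠ 0 := by positivity
  rw [pinMean, sum_congr rfl fun s _ => h s, sum_const, card_range, nsmul_eq_mul,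
    inv_mul_cancel_left₀ hS']

lemma le_LamFn {t c : ℝ} (ht : 0 ≤ t) (hc : 0 < c) : t * Real.log c + t - c ≤ LamFn t := by
  rcases ht.eq_or_lt with rfl | ht
  · simp [LamFn, hc.le]
  have h := Real.log_le_sub_one_of_pos (div_pos hc ht)
  rw [Real.log_div hc.ne' ht.ne'] at h
  have h2 := mul_le_mul_of_nonneg_left h ht.le
  have h3 : t * (c / t - 1) = c - t := by field_simp
  rw [h3] at h2
  unfold LamFn
  linarith

lemma sum_LamFn_bounds {κ : Type*} [Fintype κ] {t : κ → ℝ} (ht : ∀ y, 0 ≤ t y)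
    (hs : 0 < ∑ y, t y) :
    LamFn (∑ y, t y) - (∑ y, t y) * Real.log (Fintype.card κ) ≤ ∑ y, LamFn (t y) ∧
      ∑ y, LamFn (t y) ≤ LamFn (∑ y, t y) := by
  constructor
  · have hne : Nonempty κ := by
      by_contra h
      rw [not_nonempty_iff] at h
      simp at hs
    have hK : (0 : ℝ) < Fintype.card κ := by exact_mod_cast Fintype.card_pos
    have h := sum_le_sum fun y (_ : y ∈ univ) => le_LamFn (ht y) (div_pos hs hK)
    rw [sum_sub_distrib, sum_add_distrib, ← sum_mul, sum_const, card_univ, nsmul_eq_mul,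
      mul_div_cancel₀ _ hK.ne', Real.log_div hs.ne' hK.ne'] at h
    unfold LamFn at h ⊢
    linarith
  · rw [LamFn, sum_mul]
    refine sum_le_sum fun y _ => ?_
    rcases (ht y).eq_or_lt with h | h
    · simp [← h, LamFn]
    · exact mul_le_mul_of_nonneg_left (Real.log_le_log h (single_le_sum (fun y _ => ht y)
        (mem_univ y))) h.le

lemma sum_tot_pinWt (lam p : ℝ) {s : ℕ} (u : Fin s → Fin n) (g : GraphCfg n) :
    ∑ y : Fin s → Fin q, tot (fun _ => p) (tilt q lam n) (pinWt u y) g = LR q lam n p g := by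
  simp only [tot, LR, unif]
  rw [sum_comm]
  simp only [← sum_mul, sum_pinWt]

/-- Revealing the colors of `s` vertices changes the entropy by at most `s log q`. -/
lemma pinEnt_bounds {lam p : ℝ} (hP : PottsPar q lam) (h0 : 0 ≤ p) (h1 : p ≤ 1 / 2) {s : ℕ}
    (u : Fin s → Fin n) : entD q lam n p - s * Real.log q ≤ pinEnt lam p q u ∧
      pinEnt lam p q u ≤ entD q lam n p := by
  have hb := box_const (ι := EdgeIdx n) h0 h1
  have hc := hP.minRatio_pos
  have hLR : ∀ g, 0 < LR q lam n p g := fun g =>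
    tot_pos hc hb (tilt_tilt hP n) (unif_posWt hP.1 n) g
  have hpt := fun g => sum_LamFn_bounds (t := fun y : Fin s → Fin q =>
    tot (fun _ => p) (tilt q lam n) (pinWt u y) g) (fun y => sum_nonneg fun σ _ =>
      mul_nonneg (pinWt_nonneg u y σ) (lik_pos hc hb (tilt_tilt hP n) g σ).le)
    (by rw [sum_tot_pinWt]; exact hLR g)
  simp only [sum_tot_pinWt] at hpt
  have hE : pinEnt lam p q u = avg (fun _ => p) (fun g => ∑ y : Fin s → Fin q,
      LamFn (tot (fun _ => p) (tilt q lam n) (pinWt u y) g)) := by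
    simp only [pinEnt, avg, mul_sum]
    exact sum_comm
  rw [hE]
  constructor
  · have h := avg_mono hb fun g => (hpt g).1
    refine le_trans (le_of_eq ?_) h
    have hcard : Real.log (Fintype.card (Fin s → Fin q)) = s * Real.log q := by
      simp [Real.log_pow]
    have hone : avg (fun _ => p) (LR q lam n p) = 1 := by
      rw [show LR q lam n p = tot (fun _ => p) (tilt q lam n) (unif q n) from rfl, avg_tot _ hb,
        unif_sum hP.1]
    rw [avg_sub, hcard, entD]
    congr 1
    have hmul : avg (fun _ => p) (fun g => LR q lam n p g * (s * Real.log q))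
        = avg (fun _ => p) (LR q lam n p) * (s * Real.log q) := by
      simp only [avg, sum_mul, mul_assoc]
    rw [hmul, hone, one_mul]
  · exact avg_mono hb fun g => (hpt g).2

/-- Pins among the first `n` vertices instead of all `n + 1` vertices. -/
lemma pinMean_succ_le {lam p : ℝ} (hP : PottsPar q lam) (hn : 0 < n) (h0 : 0 ≤ p) (h1 : p ≤ 1 / 2)
    (S : ℕ) : pinMean S (n + 1) (fun _ u => pinEnt lam p q u)
      ≤ pinMean S n (fun _ u => pinEnt lam p q (fun i => (u i).castSucc))
        + (S : ℝ)⁻¹ * ∑ s ∈ range S, (1 - ((n : ℝ) / (n + 1)) ^ s) * (s * Real.log q) := by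
  rw [pinMean, pinMean, ← mul_add, ← sum_add_distrib]
  refine mul_le_mul_of_nonneg_left (sum_le_sum fun s _ => ?_) (by positivity)
  have hn' : (0 : ℝ) < n := by positivity
  set E := entD q lam (n + 1) p
  set F : (Fin s → Fin (n + 1)) → ℝ := fun u => pinEnt lam p q u with hF
  have hb : ∀ u, E - s * Real.log q ≤ F u ∧ F u ≤ E := fun u => pinEnt_bounds hP h0 h1 u
  have hinj : Function.Injective (fun (u : Fin s → Fin n) (i : Fin s) => (u i).castSucc) :=
    fun u u' h => funext fun i => Fin.castSucc_injective _ (congrFun h i)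
  have h2 : ∑ u : Fin s → Fin n, (E - F (fun i => (u i).castSucc)) ≤ ∑ u, (E - F u) := by
    refine (sum_map univ ⟨_, hinj⟩ (fun u => E - F u)).symm.trans_le ?_
    exact sum_le_sum_of_subset_of_nonneg (subset_univ _) fun u _ _ => sub_nonneg.2 (hb u).2
  have h3 : ∑ u : Fin s → Fin n, (E - F (fun i => (u i).castSucc))
      ≤ (n : ℝ) ^ s * (s * Real.log q) :=
    (sum_le_sum fun u _ => (by linarith [(hb fun i => (u i).castSucc).1] :
      E - F (fun i => (u i).castSucc) ≤ s * Real.log q)).trans (by simp)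
  rw [sum_sub_distrib, sum_sub_distrib] at h2
  rw [sum_sub_distrib] at h3
  simp only [sum_const, card_univ, Fintype.card_pi, Fintype.card_fin, prod_const, nsmul_eq_mul,
    Nat.cast_pow, Nat.cast_add, Nat.cast_one] at h2 h3
  change (((n + 1 : ℕ) : ℝ) ^ s)⁻¹ * ∑ u, F u ≤ ((n : ℝ) ^ s)⁻¹ * ∑ u : Fin s → Fin n,
    F (fun i => (u i).castSucc) + _
  push_cast
  set A := ∑ u, F u
  set B := ∑ u : Fin s → Fin n, F (fun i => (u i).castSucc)
  have hx : 0 < (n : ℝ) ^ s := by positivity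
  have hy : 0 < ((n : ℝ) + 1) ^ s := by positivity
  have hxy : (n : ℝ) ^ s ≤ ((n : ℝ) + 1) ^ s := by gcongr; linarith
  rw [div_pow]
  set x := (n : ℝ) ^ s
  set y := ((n : ℝ) + 1) ^ s
  set K := s * Real.log q
  have e1 : x⁻¹ * B + (1 - x / y) * K - y⁻¹ * A
      = y⁻¹ * ((y * E - A) - (x * E - B)) + (1 - x / y) * (x⁻¹ * (x * K - (x * E - B))) := by
    field_simp; ring
  have e2 : 0 ≤ 1 - x / y := by rw [sub_nonneg, div_le_one hy]; exact hxy
  have e3 : 0 ≤ y⁻¹ * ((y * E - A) - (x * E - B)) := mul_nonneg (by positivity) (by linarith)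
  have e4 : 0 ≤ (1 - x / y) * (x⁻¹ * (x * K - (x * E - B))) :=
    mul_nonneg e2 (mul_nonneg (by positivity) (by linarith))
  linarith

lemma edgeTrue_le {lam : ℝ} (hP : PottsPar q lam) (hn : 0 < n) {O : Type*} [Fintype O]
    {m : O → (Fin n → Fin q) → ℝ} (hm : IsJoint m) : edgeTrue lam m ≤ 9 / 4 := by
  have hq : 0 < q := by have := hP.1; omega
  have h2 : ∀ o, mass m o * (((n : ℝ) ^ 2)⁻¹ * ∑ v, ∑ v',
      LamFn (1 + gib m o fun σ => lam * ker q (σ v) (σ v'))) ≤ mass m o * (9 / 4) := by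
    intro o
    by_cases ho : mass m o = 0
    · simp [ho]
    refine mul_le_mul_of_nonneg_left ?_ (mass_nonneg hm.nonneg o)
    rw [inv_mul_le_iff₀ (by positivity)]
    have h := sum_le_sum fun v (_ : v ∈ (univ : Finset (Fin n))) =>
      sum_le_sum fun v' (_ : v' ∈ (univ : Finset (Fin n))) =>
      (le_abs_self _).trans (abs_LamFn_one_add_le hP.minRatio_pos
        (le_gib hm.nonneg ho fun σ => (lam_ker_bounds hP (σ v) (σ v')).1)
        (gib_le hm.nonneg o (by norm_num) fun σ => (lam_ker_bounds hP (σ v) (σ v')).2))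
    refine h.trans (le_of_eq ?_)
    simp; ring
  refine (sum_le_sum fun o _ => h2 o).trans ?_
  rw [← sum_mul, hm.sum_mass hq, one_mul]

end PinMean

section Cavity

variable {q : ℕ}

/-- The entropy added by a new vertex given the pins. -/
lemma pinEnt_castSucc_le (hq : 3 ≤ q) {β d : ℝ} (hβ : 0 < β) (hd : 0 < d) (hdc : d < dcond q β)
    {Γ : ℕ} (hΓ : 2 ≤ Γ) : ∃ C : ℝ, 0 ≤ C ∧ ∃ δ : ℕ → ℝ, Filter.Tendsto δ Filter.atTop (nhds 0) ∧
      ∀ᶠ n : ℕ in Filter.atTop, ∀ (s : ℕ) (u : Fin s → Fin n),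
        pinEnt (pottsLam q β) (d / (n + 1)) q (fun i => (u i).castSucc)
          ≤ pinEnt (pottsLam q β) (d / n) q u
            + (C * ∑ i ∈ range Γ, √(pinEnergy (pin (joint q (pottsLam q β) n (d / (n + 1))) u) i
                - colEnergy (pin (joint q (pottsLam q β) n (d / (n + 1))) u))
              + (2 * Real.exp (12 * d) * (1 / 2) ^ Γ + δ n)) := by
  have hP := pottsPar_pottsLam hq hβ
  set lam := pottsLam q β
  obtain ⟨C1, hC1, δ, hδ, hstar⟩ := starTrue_le hP hd Γ
  obtain ⟨C2, hC2, hbethe⟩ := bethe_obs_le hq hβ hd hdc Γ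
  set L := edgeLip (minRatio q lam) with hL
  have hL1 : 1 ≤ L := one_le_edgeLip _
  set D := ∑ γ ∈ range Γ, 2 * (3 / 2 : ℝ) ^ γ * √q with hD
  have hD0 : 0 ≤ D := sum_nonneg fun γ _ => by positivity
  set K := 2 * d + 20 * L * d ^ 2 + 9 / 8 * d
  refine ⟨C1 * D + d / 2 * (L * (2 * √q)), by positivity,
    fun n => δ n + C2 * imbal q n + K * (1 / ((n : ℝ) + 1)), ?_, ?_⟩
  · have h := (hδ.add ((tendsto_imbal (q := q) (by omega)).const_mul C2)).add
      (tendsto_one_div_add_atTop_nhds_zero_nat.const_mul K)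
    simpa using h
  filter_upwards [hstar, eventually_div_nat_lt d (c := 1 / 2) (by norm_num)] with n hst hn s u
  obtain ⟨hn, hdn⟩ := hn
  have hn' : (0 : ℝ) < n := by positivity
  have hp0 : 0 < d / ((n : ℝ) + 1) := by positivity
  have hpp : d / ((n : ℝ) + 1) ≤ d / n := by gcongr; linarith
  have hJ := (isJoint_joint (n := n) hP hp0.le (hpp.trans hdn.le)).pin u
  rw [pinEnt_succ hP hp0 (hpp.trans hdn.le)]
  have hgain := pinEnt_gain hP hn hp0 hpp hdn.le u
  have hs := hst hJ
  have hET := edgeTrue_le hP hn hJ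
  set m := pin (joint q lam n (d / ((n : ℝ) + 1))) u
  have hb := hbethe hn hJ
  have he := edgeObs_le hP hn hJ
  change edgeObs lam m ≤ edgeTrue lam m + L * _ at he
  set Q := ∑ i ∈ range Γ, √(pinEnergy m i - colEnergy m)
  have h1Q : √(pinEnergy m 1 - colEnergy m) ≤ Q :=
    single_le_sum (f := fun i => √(pinEnergy m i - colEnergy m)) (fun i _ => Real.sqrt_nonneg _)
      (mem_range.2 (by omega))
  have hdec : ∑ γ ∈ range Γ, decorr lam m γ ≤ D * Q := by
    rw [hD, sum_mul]
    refine sum_le_sum fun γ hγ => (decorr_le hP hn hJ.nonneg (hJ.sum_mass (by omega)).le γ).trans ?_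
    refine mul_le_mul_of_nonneg_left (sum_le_sum_of_subset_of_nonneg ?_
      fun i _ _ => Real.sqrt_nonneg _) (by positivity)
    exact range_subset_range.2 (mem_range.1 hγ).le
  have hdec' := mul_le_mul_of_nonneg_left hdec hC1
  have he' : d / 2 * edgeObs lam m ≤ d / 2 * (edgeTrue lam m + L * (2 * (√q * Q))) := by
    refine mul_le_mul_of_nonneg_left (he.trans ?_) (by positivity)
    gcongr
  have hmain : d / 2 * edgeTrue lam m - (d / n - d / ((n : ℝ) + 1)) * ((n : ℝ) ^ 2 / 2 *
      edgeTrue lam m - 2 * n - 20 * L * (d / ((n : ℝ) + 1)) * n ^ 2) ≤ K * (1 / ((n : ℝ) + 1)) := by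
    have e1 : d / 2 * edgeTrue lam m - (d / n - d / ((n : ℝ) + 1)) * ((n : ℝ) ^ 2 / 2 *
        edgeTrue lam m - 2 * n - 20 * L * (d / ((n : ℝ) + 1)) * n ^ 2)
        = (d / 2 * edgeTrue lam m + 2 * d + 20 * L * d ^ 2 * (n / ((n : ℝ) + 1)))
          * (1 / ((n : ℝ) + 1)) := by
      field_simp; ring
    rw [e1]
    refine mul_le_mul_of_nonneg_right ?_ (by positivity)
    have e2 : (n : ℝ) / (n + 1) ≤ 1 := by rw [div_le_one (by positivity)]; linarith
    have e3 := mul_le_mul_of_nonneg_left e2 (show 0 ≤ 20 * L * d ^ 2 by positivity)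
    have e4 := mul_le_mul_of_nonneg_left hET (show 0 ≤ d / 2 by positivity)
    change _ ≤ 2 * d + 20 * L * d ^ 2 + 9 / 8 * d
    linarith
  have e5 : (C1 * D + d / 2 * (L * (2 * √q))) * Q
      = C1 * (D * Q) + d / 2 * (L * (2 * (√q * Q))) := by ring
  rw [e5]
  linarith

lemma pinMean_step (hq : 3 ≤ q) {β d : ℝ} (hβ : 0 < β) (hd : 0 < d) (hdc : d < dcond q β)
    {ε : ℝ} (hε : 0 < ε) : ∃ S : ℕ, 0 < S ∧ ∀ᶠ n : ℕ in Filter.atTop,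
      pinMean S (n + 1) (fun _ u => pinEnt (pottsLam q β) (d / (n + 1)) q u)
        ≤ pinMean S n (fun _ u => pinEnt (pottsLam q β) (d / n) q u) + ε := by
  have hP := pottsPar_pottsLam hq hβ
  have hΓ : ∃ Γ : ℕ, 2 ≤ Γ ∧ 2 * Real.exp (12 * d) * (1 / 2) ^ Γ < ε / 4 := by
    have h := (tendsto_pow_atTop_nhds_zero_of_lt_one (r := (1 / 2 : ℝ)) (by norm_num)
      (by norm_num)).const_mul (2 * Real.exp (12 * d))
    rw [mul_zero] at h
    exact ((Filter.eventually_ge_atTop 2).and (h.eventually_lt_const (by linarith))).exists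
  obtain ⟨Γ, hΓ2, hΓε⟩ := hΓ
  obtain ⟨C, hC, δ, hδ, hstep⟩ := pinEnt_castSucc_le hq hβ hd hdc hΓ2
  have hSex : ∃ S : ℕ, 0 < S ∧ C * ∑ i ∈ range Γ, √((i : ℝ) / S) < ε / 4 := by
    have h : Filter.Tendsto (fun S : ℕ => C * ∑ i ∈ range Γ, √((i : ℝ) / S)) Filter.atTop
        (nhds (C * ∑ i ∈ range Γ, √0)) :=
      (tendsto_finsetSum (range Γ) fun i _ => (Real.continuous_sqrt.tendsto 0).comp
        (tendsto_const_div_atTop_nhds_zero_nat ((i : ℕ) : ℝ))).const_mul C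
    simp only [Real.sqrt_zero, sum_const_zero, mul_zero] at h
    exact ((Filter.eventually_gt_atTop 0).and (h.eventually_lt_const (by linarith))).exists
  obtain ⟨S, hS, hSε⟩ := hSex
  refine ⟨S, hS, ?_⟩
  have hpins : Filter.Tendsto (fun n : ℕ => (S : ℝ)⁻¹ * ∑ s ∈ range S,
      (1 - ((n : ℝ) / (n + 1)) ^ s) * (s * Real.log q)) Filter.atTop (nhds 0) := by
    have h := (tendsto_finsetSum (range S) fun s (_ : s ∈ range S) =>
      ((tendsto_natCast_div_add_atTop (1 : ℝ)).pow s).const_sub 1 |>.mul_const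
        (s * Real.log q)).const_mul (S : ℝ)⁻¹
    simpa using h
  filter_upwards [hstep, eventually_div_nat_lt d (c := 1 / 2) (by norm_num),
    hpins.eventually_lt_const (show (0 : ℝ) < ε / 4 by linarith),
    hδ.eventually_lt_const (show (0 : ℝ) < ε / 4 by linarith)] with n hst hn hpn hδn
  obtain ⟨hn, hdn⟩ := hn
  have hn' : (0 : ℝ) < n := by positivity
  have hp0 : 0 < d / ((n : ℝ) + 1) := by positivity
  have hpp : d / ((n : ℝ) + 1) ≤ d / n := by gcongr; linarith
  have hJ := isJoint_joint (n := n) hP hp0.le (hpp.trans hdn.le)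
  refine (pinMean_succ_le hP hn hp0.le (hpp.trans hdn.le) S).trans ?_
  have h1 := pinMean_mono (S := S) fun s _ u => hst s u
  rw [pinMean_add, pinMean_add, pinMean_const hS hn, pinMean_mul, pinMean_sum] at h1
  have h2 : ∑ i ∈ range Γ, pinMean S n (fun s u =>
      √(pinEnergy (pin (joint q (pottsLam q β) n (d / (n + 1))) u) i
        - colEnergy (pin (joint q (pottsLam q β) n (d / (n + 1))) u)))
      ≤ ∑ i ∈ range Γ, √((i : ℝ) / S) :=
    sum_le_sum fun i _ => avg_sqrt_pinEnergy_le hn hJ.nonneg (hJ.sum_mass (by omega)).le hS i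
  have h3 := mul_le_mul_of_nonneg_left h2 hC
  linarith

/-- Below the condensation threshold the relative entropy is sublinear. -/
theorem entVanish_of_lt_dcond (hq : 3 ≤ q) {β d : ℝ} (hβ : 0 < β) (hd : 0 < d)
    (hdc : d < dcond q β) : EntVanish q (pottsLam q β) d := by
  have hP := pottsPar_pottsLam hq hβ
  have hbox := eventually_div_nat_lt d (c := 1 / 2) (by norm_num)
  have hnonneg : ∀ᶠ n : ℕ in Filter.atTop, 0 ≤ entD q (pottsLam q β) n (d / n) := by
    filter_upwards [hbox] with n hn
    have hb := box_const (ι := EdgeIdx n) (show 0 ≤ d / n by positivity) hn.2.le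
    exact avg_LamFn_nonneg (unif_sum hq n) hb
      fun g => tot_pos hP.minRatio_pos hb (tilt_tilt hP n) (unif_posWt hq n) g
  refine tendsto_order.2 ⟨fun a ha => ?_, fun ε hε => ?_⟩
  · filter_upwards [hnonneg] with n hn
    exact ha.trans_le (div_nonneg hn (by positivity))
  obtain ⟨S, hS, hstep⟩ := pinMean_step hq hβ hd hdc (show 0 < ε / 2 by linarith)
  set a : ℕ → ℝ := fun n => pinMean S n (fun _ u => pinEnt (pottsLam q β) (d / n) q u)
  obtain ⟨N, hN⟩ : ∃ N, ∀ n ≥ N, a (n + 1) ≤ a n + ε / 2 := by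
    obtain ⟨N, hN⟩ := Filter.eventually_atTop.1 hstep
    refine ⟨N, fun n hn => ?_⟩
    have h := hN n hn
    rw [← Nat.cast_succ] at h
    exact h
  have hind : ∀ k : ℕ, a (N + k) ≤ a N + k * (ε / 2) := by
    intro k
    induction k with
    | zero => simp
    | succ k ih =>
      have h := hN (N + k) (by omega)
      rw [← add_assoc]
      push_cast
      linarith
  have hlim : Filter.Tendsto (fun n : ℕ => (|a N| + S * Real.log q) / (n : ℝ)) Filter.atTop
      (nhds 0) := tendsto_const_div_atTop_nhds_zero_nat _
  filter_upwards [hbox, Filter.eventually_ge_atTop N,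
    hlim.eventually_lt_const (show (0 : ℝ) < ε / 2 by linarith)] with n hn hNn hl
  obtain ⟨hn, hdn⟩ := hn
  have hn' : (0 : ℝ) < n := by positivity
  have hlq : 0 ≤ Real.log q := Real.log_nonneg (by linarith [hP.q_pos])
  have h1 : entD q (pottsLam q β) n (d / n) - S * Real.log q ≤ a n := by
    rw [← pinMean_const hS hn (entD q (pottsLam q β) n (d / n) - S * Real.log q)]
    refine pinMean_mono fun s hs u => ?_
    have h := (pinEnt_bounds hP (show 0 ≤ d / n by positivity) hdn.le u).1
    have h2 : (s : ℝ) * Real.log q ≤ S * Real.log q := by gcongr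
    linarith
  have h2 := hind (n - N)
  rw [Nat.add_sub_cancel' hNn, Nat.cast_sub hNn] at h2
  rw [div_lt_iff₀ hn'] at hl ⊢
  have h3 : ((n : ℝ) - N) * (ε / 2) ≤ n * (ε / 2) := by gcongr; linarith [Nat.cast_nonneg (α := ℝ) N]
  linarith [le_abs_self (a N)]

end Cavity

end BlockModel

/-- Theorem "Thm_contigPotts": for all `q ≥ 3`, `β > 0` and
`0 < d < d_cond(q,β)`, the Erdős–Rényi random graph `𝔾(n,d/n)` and the stochastic block
model `𝔾*` are mutually contiguous: for every sequence `(A_n)` of sets of graphs,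
`P[𝔾 ∈ A_n] → 0` if and only if `P[𝔾* ∈ A_n] → 0`. -/
theorem stmt19 (q : ℕ) (hq : 3 ≤ q) (β : ℝ) (hβ : 0 < β) (d : ℝ) (hd0 : 0 < d)
    (hd : d < dcond q β) (A : ∀ n : ℕ, Finset (GraphCfg n)) :
    Filter.Tendsto (fun n : ℕ => ∑ g ∈ A n, erProb n (d / n) g)
        Filter.atTop (nhds 0) ↔
      Filter.Tendsto (fun n : ℕ => ∑ g ∈ A n, sbmProb q β d n g)
        Filter.atTop (nhds 0) := by
  obtain ⟨d₂, hd2, hd2c⟩ := exists_between hd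
  obtain ⟨d₁, hd1, hd12⟩ := exists_between hd2
  have hP := BlockModel.pottsPar_pottsLam hq hβ
  have h1 : 0 < d₁ := hd0.trans hd1
  have hent := BlockModel.entVanish_of_lt_dcond hq hβ (h1.trans hd12) hd2c
  have hKS := BlockModel.mul_sq_lt_one_of_lt_dcond hq hβ h1 (hd12.trans hd2c)
  exact BlockModel.contiguous_of_unifInt hq hβ hd0 hd1 (BlockModel.unifInt_of_corrVanish hP h1 hKS
    (BlockModel.corrVanish_of_entVanish hP h1 hd12 hent)) A
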